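/- arXiv:1211.1559 — 3 statements merged into one kernel-verified Lean document; each statement's English description precedes it below -/
import Mathlib

section
/- Let 2 ≤ p < ∞ and k(x) = x^{−τ} with 0 < τ < 1/p'. Then the operator T_K, with K either the weakly singular kernel (WS) or the Volterra kernel (VO), maps L_p[0,1] boundedly into C[0,1], and there is a constant c > 0 (independent of n) such that e_n(T_K : L_p[0,1] → C[0,1]) ≤ c · n^{τ − 1} for all n ∈ ℕ. -/
open MeasureTheory

/-- The `n`-th entropy number of a subset `A` of a pseudometric space. -/
noncomputable def entropyNum {X : Type*} [PseudoMetricSpace X] (A : Set X) (n : ℕ) : ℝ :=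
  sInf {ε : ℝ | 0 ≤ ε ∧ ∃ T : Finset X, T.card ≤ n ∧ A ⊆ ⋃ x ∈ T, Metric.closedBall x ε}

/-- The `n`-th dyadic entropy number of a subset `A`. -/
noncomputable def dyadEntropyNum {X : Type*} [PseudoMetricSpace X] (A : Set X) (n : ℕ) : ℝ :=
  entropyNum A (2 ^ (n - 1))

/-- The `n`-th entropy number of a bounded linear operator. -/
noncomputable def opEntropyNum {X Y : Type*} [SeminormedAddCommGroup X] [SeminormedAddCommGroup Y]
    [NormedSpace ℝ X] [NormedSpace ℝ Y] (T : X →L[ℝ] Y) (n : ℕ) : ℝ :=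
  entropyNum (T '' Metric.closedBall 0 1) n

/-- The `n`-th dyadic entropy number of a bounded linear operator. -/
noncomputable def opDyadEntropyNum {X Y : Type*} [SeminormedAddCommGroup X]
    [SeminormedAddCommGroup Y] [NormedSpace ℝ X] [NormedSpace ℝ Y]
    (T : X →L[ℝ] Y) (n : ℕ) : ℝ :=
  opEntropyNum T (2 ^ (n - 1))

/-- The absolutely convex hull of a set: all finite sums `∑ λ i • a i` with `∑ |λ i| ≤ 1`. -/
def absConvHull {X : Type*} [AddCommGroup X] [Module ℝ X] (A : Set X) : Set X :=
  {x | ∃ (n : ℕ) (a : Fin n → X) (lam : Fin n → ℝ),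
    (∀ i, a i ∈ A) ∧ (∑ i, |lam i|) ≤ 1 ∧ x = ∑ i, lam i • a i}

/-- The `i`-th Rademacher function. -/
noncomputable def rademacherFn (i : ℕ) (t : ℝ) : ℝ :=
  Real.sign (Real.sin (2 ^ i * Real.pi * t))

/-- `X` is of type `p` with constant `ρ`. -/
def IsTypePWith (X : Type*) [SeminormedAddCommGroup X] [NormedSpace ℝ X] (p ρ : ℝ) : Prop :=
  ∀ (k : ℕ) (x : Fin k → X),
    (∫ t in (0:ℝ)..1, ‖∑ i : Fin k, rademacherFn (i.1 + 1) t • x i‖) ≤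
      ρ * (∑ i : Fin k, ‖x i‖ ^ p) ^ (1 / p)

/-- `X` is a Banach space of type `p`. -/
def IsTypeP (X : Type*) [SeminormedAddCommGroup X] [NormedSpace ℝ X] (p : ℝ) : Prop :=
  ∃ ρ > 0, IsTypePWith X p ρ

/-- Membership in the generalized Lorentz sequence space `l_{r,s,α}`, `0 < s < ∞`:
`∑_{n ≥ 1} (log₂(n+1))^{-αs} n^{s/r-1} ξ_n^s < ∞`. -/
def MemLorentz (r s α : ℝ) (ξ : ℕ → ℝ) : Prop :=
  Summable fun n : ℕ =>
    (Real.logb 2 ((n : ℝ) + 2)) ^ (-(α * s)) * ((n : ℝ) + 1) ^ (s / r - 1) * ξ (n + 1) ^ s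

/-- Membership in the generalized Lorentz sequence space `l_{r,∞,α}`:
`sup_{n ≥ 1} (log₂(n+1))^{-α} n^{1/r} ξ_n < ∞`. -/
def MemLorentzTop (r α : ℝ) (ξ : ℕ → ℝ) : Prop :=
  ∃ C : ℝ, ∀ n : ℕ, 1 ≤ n →
    (Real.logb 2 ((n : ℝ) + 1)) ^ (-α) * (n : ℝ) ^ (1 / r) * ξ n ≤ C

/-- The `n`-th Kolmogorov number of a bounded linear operator. -/
noncomputable def kolmogorovNum {X Y : Type*} [SeminormedAddCommGroup X] [NormedSpace ℝ X]
    [NormedAddCommGroup Y] [NormedSpace ℝ Y] (T : X →L[ℝ] Y) (n : ℕ) : ℝ :=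
  sInf {c : ℝ | ∃ F : Submodule ℝ Y, Module.rank ℝ F < (n : Cardinal) ∧
    ∀ x ∈ Metric.closedBall (0 : X) 1, Metric.infDist (T x) (F : Set Y) ≤ c}

/-- The `l`-norm of an operator from a finite-dimensional Euclidean space. -/
noncomputable def ellNormFin {Y : Type*} [SeminormedAddCommGroup Y] [NormedSpace ℝ Y] {n : ℕ}
    (S : EuclideanSpace ℝ (Fin n) →L[ℝ] Y) : ℝ :=
  (∫ x : Fin n → ℝ, ‖S ((WithLp.equiv 2 (Fin n → ℝ)).symm x)‖ ^ 2
      ∂(Measure.pi fun _ : Fin n => ProbabilityTheory.gaussianReal 0 1)) ^ ((1 : ℝ) / 2)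

/-- The `l`-norm of an operator between Banach spaces. -/
noncomputable def ellNorm {X Y : Type*} [SeminormedAddCommGroup X] [NormedSpace ℝ X]
    [SeminormedAddCommGroup Y] [NormedSpace ℝ Y] (T : X →L[ℝ] Y) : ℝ :=
  sSup {c : ℝ | ∃ (n : ℕ) (A : EuclideanSpace ℝ (Fin n) →L[ℝ] X),
    ‖A‖ ≤ 1 ∧ c = ellNormFin (T.comp A)}

/-- The `n`-th approximation number of `T` with respect to the `l`-norm. -/
noncomputable def approxNumEll {X Y : Type*} [SeminormedAddCommGroup X] [NormedSpace ℝ X]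
    [SeminormedAddCommGroup Y] [NormedSpace ℝ Y] (T : X →L[ℝ] Y) (n : ℕ) : ℝ :=
  sInf {c : ℝ | ∃ A : X →L[ℝ] Y,
    Module.rank ℝ (LinearMap.range (A : X →ₗ[ℝ] Y)) < (n : Cardinal) ∧ c = ellNorm (T - A)}

theorem sum_Icc_pow_natAbs_le {x : ℝ} (hx0 : 0 ≤ x) (hx : x ≤ 1 / 2) (N : ℕ) :
    ∑ z ∈ Finset.Icc (-(N : ℤ)) N, x ^ z.natAbs ≤ 1 + 4 * x := by
  have key : ∑ z ∈ Finset.Icc (-(N : ℤ)) N, x ^ z.natAbs ≤ 1 + 4 * x * (1 - (1 / 2) ^ N) := by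
    induction N with
    | zero => simp
    | succ N ih =>
      have hset : Finset.Icc (-((N + 1 : ℕ) : ℤ)) ((N + 1 : ℕ) : ℤ) =
          insert (-((N + 1 : ℕ) : ℤ)) (insert (((N + 1 : ℕ) : ℤ)) (Finset.Icc (-(N : ℤ)) N)) := by
        ext z
        simp only [Finset.mem_Icc, Finset.mem_insert]
        omega
      rw [hset, Finset.sum_insert, Finset.sum_insert]
      · have h1 : x ^ N ≤ (1 / 2) ^ N := pow_le_pow_left₀ hx0 hx N
        simp only [Int.natAbs_neg, Int.natAbs_natCast, pow_succ]
        nlinarith [mul_le_mul_of_nonneg_left h1 hx0]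
      · simp only [Finset.mem_Icc]; omega
      · simp only [Finset.mem_Icc, Finset.mem_insert]; omega
  have : 0 ≤ 4 * x * (1 / 2 : ℝ) ^ N := by positivity
  linarith

/-- The integer vectors of `ℓ¹`-norm at most `V` lie in a finite set whose cardinality is
controlled by a generating-function bound with free parameter `x`. -/
theorem exists_finset_int_vec (ι : Type*) [Fintype ι] {V x : ℝ} (hV : 0 ≤ V) (hx0 : 0 < x)
    (hx : x ≤ 1 / 2) :
    ∃ S : Finset (ι → ℤ), (∀ z : ι → ℤ, ∑ i, |(z i : ℝ)| ≤ V → z ∈ S) ∧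
      (S.card : ℝ) ≤ Real.exp (4 * x * Fintype.card ι + V * Real.log (1 / x)) := by
  classical
  set N := ⌊V⌋₊ with hN
  have hcast : ∀ z : ι → ℤ, ∑ i, |(z i : ℝ)| = ((∑ i, (z i).natAbs : ℕ) : ℝ) := by
    intro z
    push_cast
    exact Finset.sum_congr rfl fun i _ => by simp
  refine ⟨(Fintype.piFinset fun _ : ι => Finset.Icc (-(N : ℤ)) N).filter
    (fun z => ∑ i, (z i).natAbs ≤ N), ?_, ?_⟩
  · intro z hz
    rw [hcast] at hz
    have h1 : ∑ i, (z i).natAbs ≤ N := Nat.le_floor hz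
    simp only [Finset.mem_filter, Fintype.mem_piFinset, Finset.mem_Icc]
    refine ⟨fun i => ?_, h1⟩
    have h2 : (z i).natAbs ≤ ∑ i, (z i).natAbs :=
      Finset.single_le_sum (f := fun i => (z i).natAbs) (fun _ _ => Nat.zero_le _)
        (Finset.mem_univ i)
    omega
  · set S := (Fintype.piFinset fun _ : ι => Finset.Icc (-(N : ℤ)) N).filter
      (fun z => ∑ i, (z i).natAbs ≤ N) with hS
    have h1 : (S.card : ℝ) * x ^ N ≤ Real.exp (4 * x * Fintype.card ι) := by
      calc (S.card : ℝ) * x ^ N = ∑ z ∈ S, x ^ N := by simp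
        _ ≤ ∑ z ∈ S, ∏ i, x ^ (z i).natAbs := by
            refine Finset.sum_le_sum fun z hz => ?_
            rw [Finset.prod_pow_eq_pow_sum]
            exact pow_le_pow_of_le_one hx0.le (by linarith) (Finset.mem_filter.mp hz).2
        _ ≤ ∑ z ∈ Fintype.piFinset fun _ : ι => Finset.Icc (-(N : ℤ)) N,
              ∏ i, x ^ (z i).natAbs :=
            Finset.sum_le_sum_of_subset_of_nonneg (Finset.filter_subset _ _)
              fun _ _ _ => by positivity
        _ = ∏ _i : ι, ∑ z ∈ Finset.Icc (-(N : ℤ)) N, x ^ z.natAbs := by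
            rw [Finset.prod_univ_sum]
        _ ≤ ∏ _i : ι, Real.exp (4 * x) := by
            refine Finset.prod_le_prod (fun _ _ => by positivity) fun _ _ => ?_
            refine (sum_Icc_pow_natAbs_le hx0.le hx N).trans ?_
            linarith [Real.add_one_le_exp (4 * x)]
        _ = Real.exp (4 * x * Fintype.card ι) := by
            rw [Finset.prod_const, ← Real.exp_nat_mul, Finset.card_univ, mul_comm]
    have hlog : 0 ≤ Real.log (1 / x) := Real.log_nonneg (by rw [le_div_iff₀ hx0]; linarith)
    have h2 : (x ^ N)⁻¹ ≤ Real.exp (V * Real.log (1 / x)) := by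
      have : (x ^ N)⁻¹ = Real.exp (N * Real.log (1 / x)) := by
        rw [Real.exp_nat_mul, Real.exp_log (by positivity), one_div, inv_pow]
      rw [this]
      exact Real.exp_le_exp.mpr (mul_le_mul_of_nonneg_right (Nat.floor_le hV) hlog)
    have hxN : 0 < x ^ N := by positivity
    rw [Real.exp_add]
    calc (S.card : ℝ) = (S.card * x ^ N) * (x ^ N)⁻¹ := by field_simp
      _ ≤ _ := mul_le_mul h1 h2 (by positivity) (Real.exp_pos _).le

theorem abs_round_le_rpow {p : ℝ} (hp : 1 ≤ p) (x : ℝ) :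
    |(round x : ℝ)| ≤ 2 ^ p * |x| ^ p := by
  by_cases h : round x = 0
  · rw [h]; simp; positivity
  · have h1 : (1 : ℝ) ≤ |(round x : ℝ)| := by exact_mod_cast Int.one_le_abs h
    have h2 := abs_sub_round x
    have h3 : |(round x : ℝ)| ≤ |x| + 1 / 2 := by
      have := abs_sub_abs_le_abs_sub (round x : ℝ) x
      rw [abs_sub_comm] at this
      linarith
    rw [← Real.mul_rpow (by norm_num) (abs_nonneg x)]
    calc |(round x : ℝ)| ≤ 2 * |x| := by linarith
      _ ≤ (2 * |x|) ^ p := Real.self_le_rpow_of_one_le (by linarith) hp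

theorem abs_sub_le_of_round_div_eq {ε x y : ℝ} (hε : 0 < ε) (h : round (x / ε) = round (y / ε)) :
    |x - y| ≤ ε := by
  have h1 := abs_sub_round (x / ε)
  have h2 := abs_sub_round (y / ε)
  rw [h] at h1
  have h3 : |x / ε - y / ε| ≤ 1 := by
    rw [abs_le] at *
    constructor <;> linarith
  rw [← sub_div, abs_div, abs_of_pos hε, div_le_one hε] at h3
  exact h3

theorem entropyNum_le_of_map {X β : Type*} [PseudoMetricSpace X] {A : Set X} {N : ℕ} {ε : ℝ}
    (hε : 0 ≤ ε) (Φ : X → β) (S : Finset β) (hS : ∀ a ∈ A, Φ a ∈ S) (hN : S.card ≤ N)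
    (hΦ : ∀ a ∈ A, ∀ b ∈ A, Φ a = Φ b → dist a b ≤ ε) : entropyNum A N ≤ ε := by
  classical
  refine csInf_le ⟨0, fun _ h => h.1⟩ ⟨hε, ?_⟩
  rcases A.eq_empty_or_nonempty with rfl | ⟨a₀, ha₀⟩
  · exact ⟨∅, by simp, by simp⟩
  refine ⟨S.image fun b => if h : ∃ a ∈ A, Φ a = b then h.choose else a₀,
    Finset.card_image_le.trans hN, fun a ha => ?_⟩
  have hex : ∃ a' ∈ A, Φ a' = Φ a := ⟨a, ha, rfl⟩
  simp only [Set.mem_iUnion, Finset.mem_image, exists_prop]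
  refine ⟨_, ⟨Φ a, hS a ha, rfl⟩, ?_⟩
  rw [dif_pos hex, Metric.mem_closedBall]
  exact hΦ a ha _ hex.choose_spec.1 hex.choose_spec.2.symm

/-- Evaluation of a continuous function on `[0,1]` at an arbitrary real, after projection. -/
noncomputable def extendEval (φ : C(Set.Icc (0 : ℝ) 1, ℝ)) (t : ℝ) : ℝ :=
  φ (Set.projIcc 0 1 zero_le_one t)

theorem continuous_extendEval (φ : C(Set.Icc (0 : ℝ) 1, ℝ)) : Continuous (extendEval φ) :=
  φ.continuous.comp continuous_projIcc

/-- The `k`-th increment of `φ` on the uniform grid of mesh `2⁻ʲ`. -/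
noncomputable def dyadicIncr (φ : C(Set.Icc (0 : ℝ) 1, ℝ)) (j k : ℕ) : ℝ :=
  extendEval φ ((k + 1) / 2 ^ j) - extendEval φ (k / 2 ^ j)

theorem dist_le_of_dyadic {φ ψ : C(Set.Icc (0 : ℝ) 1, ℝ)} {c : ℝ} (hc : 0 ≤ c) (m : ℕ)
    (h : ∀ i k : ℕ, k ≤ 2 ^ (m + i) →
      |extendEval φ (k / 2 ^ (m + i)) - extendEval ψ (k / 2 ^ (m + i))| ≤ c) :
    dist φ ψ ≤ c := by
  rw [ContinuousMap.dist_le hc]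
  intro t
  have h2 : Filter.Tendsto (fun i : ℕ => (2 : ℝ) ^ (m + i)) Filter.atTop Filter.atTop :=
    (tendsto_pow_atTop_atTop_of_one_lt (by norm_num : (1 : ℝ) < 2)).comp
      (Filter.tendsto_add_atTop_nat m |>.congr fun i => add_comm i m)
  have h3 : Filter.Tendsto (fun i : ℕ => (⌊(t : ℝ) * 2 ^ (m + i)⌋₊ : ℝ) / 2 ^ (m + i))
      Filter.atTop (nhds (t : ℝ)) :=
    (tendsto_nat_floor_mul_div_atTop (R := ℝ) t.2.1).comp h2
  have h4 := (((continuous_extendEval φ).sub (continuous_extendEval ψ)).abs.tendsto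
    (t : ℝ)).comp h3
  have h5 : |extendEval φ t - extendEval ψ t| ≤ c := by
    refine le_of_tendsto h4 (Filter.Eventually.of_forall fun i => h i _ ?_)
    have : ((⌊(t : ℝ) * 2 ^ (m + i)⌋₊ : ℕ) : ℝ) ≤ ((2 ^ (m + i) : ℕ) : ℝ) := by
      refine (Nat.floor_le (mul_nonneg t.2.1 (by positivity))).trans ?_
      push_cast
      exact mul_le_of_le_one_left (by positivity) t.2.2
    exact_mod_cast this
  simpa [extendEval, Real.dist_eq] using h5

/-- Functions which agree up to `ε` on the coarse grid and whose increments on the finer grids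
agree up to a geometric error are uniformly close. -/
theorem dist_le_of_dyadicIncr {φ ψ : C(Set.Icc (0 : ℝ) 1, ℝ)} {ε ρ : ℝ} (hε : 0 ≤ ε)
    (hρ0 : 0 ≤ ρ) (hρ : ρ < 1) (m : ℕ)
    (hbase : ∀ k : ℕ, k ≤ 2 ^ m →
      |extendEval φ (k / 2 ^ m) - extendEval ψ (k / 2 ^ m)| ≤ ε)
    (hinc : ∀ i k : ℕ, k < 2 ^ (m + (i + 1)) →
      |dyadicIncr φ (m + (i + 1)) k - dyadicIncr ψ (m + (i + 1)) k| ≤ ε * ρ ^ (i + 1)) :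
    dist φ ψ ≤ ε * (1 - ρ)⁻¹ := by
  refine dist_le_of_dyadic (mul_nonneg hε (inv_nonneg.mpr (by linarith))) m fun i k hk => ?_
  have key : ∀ i k : ℕ, k ≤ 2 ^ (m + i) →
      |extendEval φ (k / 2 ^ (m + i)) - extendEval ψ (k / 2 ^ (m + i))| ≤
        ε * ∑ l ∈ Finset.range (i + 1), ρ ^ l := by
    intro i
    induction i with
    | zero => intro k hk; simpa using hbase k hk
    | succ i ih =>
      intro k hk
      rw [Finset.sum_range_succ, mul_add]
      have hhalf : ∀ k' : ℕ, ((2 * k' : ℕ) : ℝ) / 2 ^ (m + (i + 1)) = k' / 2 ^ (m + i) := by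
        intro k'
        rw [← add_assoc, pow_succ]
        push_cast
        field_simp
      have hpow : 2 ^ (m + (i + 1)) = 2 * 2 ^ (m + i) := by rw [← add_assoc, pow_succ]; ring
      rcases Nat.even_or_odd' k with ⟨k', rfl | rfl⟩
      · rw [hhalf]
        have : 0 ≤ ε * ρ ^ (i + 1) := by positivity
        linarith [ih k' (by omega)]
      · have h1 := ih k' (by omega)
        have h2 := hinc i (2 * k') (by omega)
        rw [← hhalf] at h1
        unfold dyadicIncr at h2
        push_cast at h1 h2 ⊢
        rw [abs_le] at *
        constructor <;> linarith [h1.1, h1.2, h2.1, h2.2]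
  refine (key i k hk).trans (mul_le_mul_of_nonneg_left ?_ hε)
  rw [← tsum_geometric_of_lt_one hρ0 hρ]
  exact (summable_geometric_of_lt_one hρ0 hρ).sum_le_tsum _ fun _ _ => by positivity

theorem abs_round_sub_round_le {p : ℝ} (hp : 1 ≤ p) (x y : ℝ) :
    |((round x - round y : ℤ) : ℝ)| ≤ 2 + |x - y| ^ p := by
  have h1 := abs_sub_round x
  have h2 := abs_sub_round y
  have h3 : |((round x - round y : ℤ) : ℝ)| ≤ |x - y| + 1 := by
    push_cast
    have h4 : (round x - round y : ℝ) = (x - y) - (x - round x) + (y - round y) := by ring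
    rw [h4]
    refine (abs_add_le _ _).trans ?_
    have := abs_sub (x - y) (x - round x)
    linarith
  have h4 : |x - y| ≤ 1 + |x - y| ^ p := by
    rcases le_total |x - y| 1 with h | h
    · have : 0 ≤ |x - y| ^ p := by positivity
      linarith
    · linarith [Real.self_le_rpow_of_one_le h hp]
  linarith

theorem exists_finset_level {p B r : ℝ} (hB : 0 ≤ B) (hr0 : 0 ≤ r) (m i : ℕ) :
    ∃ S : Finset (Fin (2 ^ (m + (i + 1))) → ℤ),
      (∀ z : Fin (2 ^ (m + (i + 1))) → ℤ,
        ∑ k, |(z k : ℝ)| ≤ 2 ^ p * B * 2 ^ m * r ^ (i + 1) → z ∈ S) ∧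
      (S.card : ℝ) ≤ Real.exp ((4 * (1 / 2) ^ (i + 1) +
        2 ^ p * B * Real.log 4 * (((i + 1 : ℕ) : ℝ) ^ 1 * r ^ (i + 1))) * 2 ^ m) := by
  obtain ⟨S, hS, hc⟩ := exists_finset_int_vec (Fin (2 ^ (m + (i + 1))))
    (V := 2 ^ p * B * 2 ^ m * r ^ (i + 1)) (x := (1 / 4) ^ (i + 1)) (by positivity)
    (by positivity) (by
      calc ((1 : ℝ) / 4) ^ (i + 1) ≤ (1 / 4) ^ 1 :=
            pow_le_pow_of_le_one (by norm_num) (by norm_num) (by omega)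
        _ ≤ 1 / 2 := by norm_num)
  refine ⟨S, hS, hc.trans_eq ?_⟩
  congr 1
  have hlog : Real.log (1 / (1 / 4) ^ (i + 1)) = (i + 1 : ℕ) * Real.log 4 := by
    rw [one_div, ← inv_pow, Real.log_pow]; norm_num
  have h24 : ((1 : ℝ) / 4) ^ (i + 1) * 2 ^ (i + 1) = (1 / 2) ^ (i + 1) := by
    rw [← mul_pow]; norm_num
  rw [hlog, Fintype.card_fin]
  push_cast
  rw [pow_add 2 m (i + 1)]
  linear_combination 4 * 2 ^ m * h24

/-- Multiscale quantization: if the increments of the members of `A` on the grids of mesh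
`2^{-(m+i)}` are suitably bounded in `ℓ^p`, then `A` is covered by `exp (D 2^m)` balls of radius
comparable to `ε`, where `D` does not depend on `m` and `ε`. -/
theorem exists_entropyNum_le_of_dyadicIncr {p B r ρ : ℝ} (hp : 1 ≤ p) (hB : 0 ≤ B) (hr0 : 0 ≤ r)
    (hr : r < 1) (hρ0 : 0 < ρ) (hρ : ρ < 1) :
    ∃ D : ℝ, 0 ≤ D ∧ ∀ (A : Set C(Set.Icc (0 : ℝ) 1, ℝ)) (m N : ℕ) (ε : ℝ), 0 < ε →
      (∀ φ ∈ A, |(round (extendEval φ 0 / ε) : ℝ)| ≤ B * 2 ^ m) →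
      (∀ φ ∈ A, ∀ i : ℕ, ∑ k : Fin (2 ^ (m + i)),
        (|dyadicIncr φ (m + i) k| / (ε * ρ ^ i)) ^ p ≤ B * 2 ^ m * r ^ i) →
      Real.exp (D * 2 ^ m) ≤ N → entropyNum A N ≤ ε * (1 - ρ)⁻¹ := by
  have hl2 : 0 ≤ Real.log 2 := Real.log_nonneg (by norm_num)
  have hl4 : 0 ≤ Real.log 4 := Real.log_nonneg (by norm_num)
  set a : ℕ → ℝ := fun i => 4 * (1 / 2) ^ (i + 1) +
    2 ^ p * B * Real.log 4 * (((i + 1 : ℕ) : ℝ) ^ 1 * r ^ (i + 1)) with ha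
  have ha0 : ∀ i, 0 ≤ a i := fun i => by positivity
  have hasum : Summable a := by
    refine Summable.add ?_ ?_
    · refine Summable.mul_left _ ?_
      exact (summable_nat_add_iff (f := fun i : ℕ => ((1 : ℝ) / 2) ^ i) 1).mpr
        (summable_geometric_of_lt_one (by norm_num) (by norm_num))
    · refine Summable.mul_left _ ?_
      exact (summable_nat_add_iff (f := fun i : ℕ => (i : ℝ) ^ 1 * r ^ i) 1).mpr
        (summable_pow_mul_geometric_of_norm_lt_one 1
          (by rwa [Real.norm_eq_abs, abs_of_nonneg hr0]))
  have hts : 0 ≤ ∑' i, a i := tsum_nonneg ha0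
  refine ⟨(2 + B * Real.log 2) + (2 + (2 + B) * Real.log 2) + ∑' i, a i, by positivity, ?_⟩
  intro A m N ε hε h0 hinc hN
  have hlev : ∀ φ ∈ A, ∀ i : ℕ, ∑ k : Fin (2 ^ (m + i)),
      |(round (dyadicIncr φ (m + i) k / (ε * ρ ^ i)) : ℝ)| ≤ 2 ^ p * B * 2 ^ m * r ^ i := by
    intro φ hφ i
    calc _ ≤ ∑ k : Fin (2 ^ (m + i)),
          2 ^ p * (|dyadicIncr φ (m + i) k| / (ε * ρ ^ i)) ^ p := by
          refine Finset.sum_le_sum fun k _ => (abs_round_le_rpow hp _).trans ?_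
          rw [abs_div, abs_of_pos (by positivity : 0 < ε * ρ ^ i)]
      _ ≤ 2 ^ p * (B * 2 ^ m * r ^ i) := by
          rw [← Finset.mul_sum]
          exact mul_le_mul_of_nonneg_left (hinc φ hφ i) (by positivity)
      _ = _ := by ring
  obtain ⟨I, hI⟩ : ∃ I : ℕ, ∀ i ≥ I, 2 ^ p * B * 2 ^ m * r ^ i < 1 := by
    have h1 : Filter.Tendsto (fun i : ℕ => 2 ^ p * B * 2 ^ m * r ^ i) Filter.atTop
        (nhds (2 ^ p * B * 2 ^ m * 0)) :=
      (tendsto_pow_atTop_nhds_zero_of_lt_one hr0 hr).const_mul _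
    rw [mul_zero] at h1
    exact Filter.eventually_atTop.mp (h1.eventually (gt_mem_nhds one_pos))
  obtain ⟨S₀, hS₀, hc₀⟩ := exists_finset_int_vec Unit (V := B * 2 ^ m) (x := 1 / 2)
    (by positivity) (by norm_num) le_rfl
  obtain ⟨S₁, hS₁, hc₁⟩ := exists_finset_int_vec (Fin (2 ^ m)) (V := (2 + B) * 2 ^ m)
    (x := 1 / 2) (by positivity) (by norm_num) le_rfl
  choose S hS hc using fun i => exists_finset_level (p := p) hB hr0 m i
  let Φ : C(Set.Icc (0 : ℝ) 1, ℝ) → (Unit → ℤ) × (Fin (2 ^ m) → ℤ) ×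
      ((i : Fin I) → (Fin (2 ^ (m + ((i : ℕ) + 1))) → ℤ)) := fun φ =>
    (fun _ => round (extendEval φ 0 / ε),
     fun k => round (extendEval φ (((k : ℕ) + 1) / 2 ^ m) / ε) -
        round (extendEval φ ((k : ℕ) / 2 ^ m) / ε),
     fun i k => round (dyadicIncr φ (m + ((i : ℕ) + 1)) k / (ε * ρ ^ ((i : ℕ) + 1))))
  refine entropyNum_le_of_map (mul_nonneg hε.le (inv_nonneg.mpr (by linarith))) Φ
    (S₀ ×ˢ (S₁ ×ˢ Fintype.piFinset fun i : Fin I => S i)) ?_ ?_ ?_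
  · intro φ hφ
    simp only [Φ, Finset.mem_product, Fintype.mem_piFinset]
    refine ⟨hS₀ _ (by simpa using h0 φ hφ), hS₁ _ ?_, fun i => hS i _ (hlev φ hφ _)⟩
    have hb := hinc φ hφ 0
    simp only [pow_zero, mul_one, Nat.add_zero] at hb
    calc _ ≤ ∑ k : Fin (2 ^ m), (2 + (|dyadicIncr φ m k| / ε) ^ p) := by
          refine Finset.sum_le_sum fun k _ => (abs_round_sub_round_le hp _ _).trans_eq ?_
          rw [← sub_div, abs_div, abs_of_pos hε]
          rfl
      _ ≤ _ := by
          rw [Finset.sum_add_distrib]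
          simp only [Finset.sum_const, Finset.card_univ, Fintype.card_fin, nsmul_eq_mul]
          push_cast
          linarith
  · have hprod : ((∏ i : Fin I, (S i).card : ℕ) : ℝ) ≤ Real.exp ((∑' i, a i) * 2 ^ m) := by
      push_cast
      calc ∏ i : Fin I, ((S i).card : ℝ) ≤ ∏ i : Fin I, Real.exp (a i * 2 ^ m) :=
            Finset.prod_le_prod (fun _ _ => Nat.cast_nonneg _) fun i _ => hc i
        _ = Real.exp ((∑ i : Fin I, a i) * 2 ^ m) := by rw [← Real.exp_sum, Finset.sum_mul]
        _ ≤ _ := by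
            refine Real.exp_le_exp.mpr (mul_le_mul_of_nonneg_right ?_ (by positivity))
            rw [Fin.sum_univ_eq_sum_range a I]
            exact hasum.sum_le_tsum _ fun i _ => ha0 i
    have h1m : (1 : ℝ) ≤ 2 ^ m := one_le_pow₀ (by norm_num)
    have hreal : (((S₀ ×ˢ (S₁ ×ˢ Fintype.piFinset fun i : Fin I => S i)).card : ℕ) : ℝ) ≤ N := by
      refine le_trans ?_ hN
      rw [Finset.card_product, Finset.card_product, Fintype.card_piFinset, Nat.cast_mul,
        Nat.cast_mul, add_mul, add_mul, Real.exp_add, Real.exp_add, mul_assoc]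
      refine mul_le_mul (hc₀.trans ?_) (mul_le_mul (hc₁.trans ?_) hprod (Nat.cast_nonneg _)
        (Real.exp_pos _).le) (mul_nonneg (Nat.cast_nonneg _) (Nat.cast_nonneg _))
        (Real.exp_pos _).le
      · refine Real.exp_le_exp.mpr ?_
        rw [Fintype.card_unit, one_div_one_div, Nat.cast_one]
        linarith
      · refine Real.exp_le_exp.mpr (le_of_eq ?_)
        rw [Fintype.card_fin, one_div_one_div]
        push_cast
        ring
    exact_mod_cast hreal
  · intro φ hφ ψ hψ hΦ
    simp only [Φ, Prod.mk.injEq] at hΦ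
    obtain ⟨e0, e1, e2⟩ := hΦ
    refine dist_le_of_dyadicIncr hε.le hρ0.le hρ m ?_ ?_
    · have hround : ∀ k : ℕ, k ≤ 2 ^ m → round (extendEval φ (k / 2 ^ m) / ε) =
          round (extendEval ψ (k / 2 ^ m) / ε) := by
        intro k
        induction k with
        | zero => intro _; simpa using congrFun e0 ()
        | succ k ih =>
          intro hk
          have h1 := congrFun e1 ⟨k, by omega⟩
          have h2 := ih (by omega)
          simp only at h1
          push_cast
          omega
      exact fun k hk => abs_sub_le_of_round_div_eq hε (hround k hk)
    · intro i k hk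
      refine abs_sub_le_of_round_div_eq (by positivity) ?_
      by_cases hi : i < I
      · exact congrFun (congrFun e2 ⟨i, hi⟩) ⟨k, hk⟩
      · have hz : ∀ χ ∈ A, round (dyadicIncr χ (m + (i + 1)) k / (ε * ρ ^ (i + 1))) = 0 := by
          intro χ hχ
          have h1 := (hlev χ hχ (i + 1)).trans_lt (hI (i + 1) (by omega))
          have h2 := (Finset.single_le_sum (f := fun k : Fin (2 ^ (m + (i + 1))) =>
            |(round (dyadicIncr χ (m + (i + 1)) k / (ε * ρ ^ (i + 1))) : ℝ)|)
            (fun _ _ => abs_nonneg _) (Finset.mem_univ ⟨k, hk⟩)).trans_lt h1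
          rw [← Int.abs_lt_one_iff]
          exact_mod_cast h2
        rw [hz φ hφ, hz ψ hψ]

/-- A set of continuous functions on `[0,1]` satisfying a discrete Besov condition of smoothness
`s > 1/p` has dyadic entropy numbers of order `n^{-s}`. -/
theorem exists_entropyNum_le_rpow {p s C : ℝ} (hp : 1 ≤ p) (hsp : 1 < s * p) (hs1 : s ≤ 1)
    (hC : 0 ≤ C) (A : Set C(Set.Icc (0 : ℝ) 1, ℝ)) (hnorm : ∀ φ ∈ A, ‖φ‖ ≤ C)
    (hinc : ∀ φ ∈ A, ∀ j : ℕ,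
      ∑ k : Fin (2 ^ j), |dyadicIncr φ j k| ^ p ≤ C * ((2 : ℝ) ^ j) ^ (1 - s * p)) :
    ∃ c > 0, ∀ n : ℕ, 1 ≤ n → entropyNum A (2 ^ (n - 1)) ≤ c * (n : ℝ) ^ (-s) := by
  have hs0 : 0 < s := by
    by_contra h
    have : s * p ≤ 0 := mul_nonpos_of_nonpos_of_nonneg (not_lt.mp h) (by linarith)
    linarith
  set δ := (s * p - 1) / 2 with hδ
  have hδ0 : 0 < δ := by rw [hδ]; linarith
  set r : ℝ := 2 ^ (-δ) with hr
  set ρ : ℝ := 2 ^ (-(δ / p)) with hρ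
  have hr0 : 0 < r := by positivity
  have hr1 : r < 1 := Real.rpow_lt_one_of_one_lt_of_neg (by norm_num) (by linarith)
  have hρ0 : 0 < ρ := by positivity
  have hρ1 : ρ < 1 := Real.rpow_lt_one_of_one_lt_of_neg (by norm_num)
    (by have : 0 < δ / p := by positivity
        linarith)
  have hρp : ρ ^ p = r := by
    rw [hρ, ← Real.rpow_mul (by norm_num)]
    congr 1
    field_simp
  obtain ⟨D₀, hD₀, hcov⟩ := exists_entropyNum_le_of_dyadicIncr (B := C + 1) hp (by linarith)
    hr0.le hr1 hρ0 hρ1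
  have hmain : ∀ m N : ℕ, Real.exp (D₀ * 2 ^ m) ≤ N →
      entropyNum A N ≤ ((2 : ℝ) ^ m) ^ (-s) * (1 - ρ)⁻¹ := by
    intro m N hN
    have h2m : (1 : ℝ) ≤ 2 ^ m := one_le_pow₀ (by norm_num)
    have h2m0 : (0 : ℝ) < 2 ^ m := by positivity
    refine hcov A m N _ (by positivity) ?_ ?_ hN
    · intro φ hφ
      have h1 : |extendEval φ 0| ≤ C := (φ.norm_coe_le_norm _).trans (hnorm φ hφ)
      have h2 : |extendEval φ 0 / ((2 : ℝ) ^ m) ^ (-s)| ≤ C * 2 ^ m := by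
        rw [abs_div, abs_of_pos (by positivity : 0 < ((2 : ℝ) ^ m) ^ (-s)),
          Real.rpow_neg h2m0.le, div_inv_eq_mul]
        refine mul_le_mul h1 ?_ (by positivity) hC
        calc ((2 : ℝ) ^ m) ^ s ≤ (2 ^ m) ^ (1 : ℝ) := Real.rpow_le_rpow_of_exponent_le h2m hs1
          _ = 2 ^ m := Real.rpow_one _
      have h3 := abs_sub_round (extendEval φ 0 / ((2 : ℝ) ^ m) ^ (-s))
      rw [abs_le] at *
      constructor <;> linarith
    · intro φ hφ i
      have hε : (((2 : ℝ) ^ m) ^ (-s) * ρ ^ i) ^ p = ((2 : ℝ) ^ m) ^ (-(s * p)) * r ^ i := by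
        rw [Real.mul_rpow (by positivity) (by positivity), ← Real.rpow_mul h2m0.le,
          ← Real.rpow_pow_comm hρ0.le, hρp, neg_mul]
      have hrr : (2 : ℝ) ^ (1 - s * p) = r * r := by
        rw [hr, ← Real.rpow_add (by norm_num)]
        congr 1
        rw [hδ]
        ring
      have hR : ((2 : ℝ) ^ (m + i)) ^ (1 - s * p) =
          ((2 : ℝ) ^ m) ^ (1 - s * p) * (r ^ i * r ^ i) := by
        rw [pow_add, Real.mul_rpow (by positivity) (by positivity), ← mul_pow, ← hrr,
          Real.rpow_pow_comm (by norm_num)]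
      have hm : ((2 : ℝ) ^ m) ^ (1 - s * p) = 2 ^ m * ((2 : ℝ) ^ m) ^ (-(s * p)) := by
        rw [sub_eq_add_neg, Real.rpow_add h2m0, Real.rpow_one]
      have hX : 0 < ((2 : ℝ) ^ m) ^ (-(s * p)) * r ^ i := by positivity
      calc _ = (∑ k : Fin (2 ^ (m + i)), |dyadicIncr φ (m + i) k| ^ p) /
            (((2 : ℝ) ^ m) ^ (-(s * p)) * r ^ i) := by
            rw [Finset.sum_div]
            refine Finset.sum_congr rfl fun k _ => ?_
            rw [Real.div_rpow (abs_nonneg _) (by positivity), hε]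
        _ ≤ C * 2 ^ m * r ^ i := by
            rw [div_le_iff₀ hX]
            refine (hinc φ hφ (m + i)).trans_eq ?_
            rw [hR, hm]
            ring
        _ ≤ _ := by gcongr; linarith
  set D := D₀ + 1 with hD
  have hD1 : 1 ≤ D := by linarith
  have hρi : 0 < (1 - ρ)⁻¹ := inv_pos.mpr (by linarith)
  refine ⟨(8 * D) ^ s * (1 - ρ)⁻¹ + 2 * C * (3 * D) ^ s + 1, by positivity, fun n hn => ?_⟩
  have hn0 : (1 : ℝ) ≤ n := by exact_mod_cast hn
  have hns : 0 < (n : ℝ) ^ (-s) := by positivity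
  have hscale : ∀ a : ℝ, 0 < a → ((n : ℝ) / a) ^ (-s) = a ^ s * (n : ℝ) ^ (-s) := by
    intro a ha
    rw [Real.div_rpow (by linarith) ha.le, Real.rpow_neg ha.le, div_inv_eq_mul, mul_comm]
  have hP1 : 0 ≤ (8 * D) ^ s * (1 - ρ)⁻¹ * (n : ℝ) ^ (-s) := by positivity
  have hP2 : 0 ≤ 2 * C * (3 * D) ^ s * (n : ℝ) ^ (-s) := by positivity
  rcases le_or_gt (2 * D) (n - 1) with hbig | hsmall
  · obtain ⟨m, hm1, hm2⟩ := exists_nat_pow_near (x := ((n : ℝ) - 1) / (2 * D)) (y := 2)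
      (by rw [le_div_iff₀ (by linarith)]; linarith) (by norm_num)
    rw [le_div_iff₀ (by linarith)] at hm1
    rw [div_lt_iff₀ (by linarith), pow_succ] at hm2
    have h2m0 : (0 : ℝ) < 2 ^ m := by positivity
    refine (hmain m _ ?_).trans ?_
    · push_cast
      rw [← Real.rpow_natCast 2 (n - 1), Real.rpow_def_of_pos (by norm_num), Nat.cast_sub hn]
      refine Real.exp_le_exp.mpr ?_
      have := Real.log_two_gt_d9
      push_cast
      nlinarith
    · have h1 : ((2 : ℝ) ^ m) ^ (-s) ≤ ((n : ℝ) / (8 * D)) ^ (-s) := by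
        refine Real.rpow_le_rpow_of_nonpos (by positivity) ?_ (by linarith)
        rw [div_le_iff₀ (by linarith)]
        linarith
      rw [hscale _ (by linarith)] at h1
      have h2 := mul_le_mul_of_nonneg_right h1 hρi.le
      linarith
  · have h1 : entropyNum A (2 ^ (n - 1)) ≤ 2 * C := by
      refine entropyNum_le_of_map (by linarith) (fun _ => ()) {()} (by simp)
        (by simpa using Nat.one_le_two_pow) fun φ hφ ψ hψ _ => ?_
      rw [dist_eq_norm]
      linarith [norm_sub_le φ ψ, hnorm φ hφ, hnorm ψ hψ]
    have h2 : (1 : ℝ) ≤ ((n : ℝ) / (3 * D)) ^ (-s) :=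
      Real.one_le_rpow_of_pos_of_le_one_of_nonpos (by positivity)
        (by rw [div_le_one (by linarith)]; linarith) (by linarith)
    rw [hscale _ (by linarith)] at h2
    have h3 := mul_le_mul_of_nonneg_left h2 (by linarith : 0 ≤ 2 * C)
    linarith

theorem integrable_one_add_abs_rpow_mul_abs_rpow {γ θ : ℝ} (hγ : 0 ≤ γ) (hθ : θ < 1)
    (hγθ : 1 < γ + θ) :
    Integrable fun v : ℝ => (1 + |v|) ^ (-γ) * |v| ^ (-θ) := by
  have hmeas : Measurable fun v : ℝ => (1 + |v|) ^ (-γ) * |v| ^ (-θ) := by fun_prop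
  have hIoc : IntegrableOn (fun v : ℝ => (1 + |v|) ^ (-γ) * |v| ^ (-θ)) (Set.Ioc 0 1) := by
    have h1 : IntegrableOn (fun v : ℝ => v ^ (-θ)) (Set.Ioc 0 1) :=
      (intervalIntegrable_iff_integrableOn_Ioc_of_le zero_le_one).mp
        (intervalIntegral.intervalIntegrable_rpow' (by linarith))
    refine h1.mono' hmeas.aestronglyMeasurable ?_
    filter_upwards [ae_restrict_mem measurableSet_Ioc] with v hv
    rw [Real.norm_of_nonneg (by positivity), abs_of_pos hv.1]
    exact mul_le_of_le_one_left (Real.rpow_nonneg hv.1.le _)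
      (Real.rpow_le_one_of_one_le_of_nonpos (by linarith [hv.1]) (neg_nonpos.mpr hγ))
  have hIoi : IntegrableOn (fun v : ℝ => (1 + |v|) ^ (-γ) * |v| ^ (-θ)) (Set.Ioi 1) := by
    have h1 : IntegrableOn (fun v : ℝ => v ^ (-(γ + θ))) (Set.Ioi 1) :=
      integrableOn_Ioi_rpow_of_lt (by linarith) one_pos
    refine h1.mono' hmeas.aestronglyMeasurable ?_
    filter_upwards [ae_restrict_mem measurableSet_Ioi] with v hv
    have hv0 : (0 : ℝ) < v := one_pos.trans hv
    rw [Real.norm_of_nonneg (by positivity), abs_of_pos hv0, neg_add, Real.rpow_add hv0]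
    exact mul_le_mul_of_nonneg_right
      (Real.rpow_le_rpow_of_nonpos hv0 (by linarith) (by linarith)) (Real.rpow_nonneg hv0.le _)
  have hpos : IntegrableOn (fun v : ℝ => (1 + |v|) ^ (-γ) * |v| ^ (-θ)) (Set.Ioi 0) := by
    rw [← Set.Ioc_union_Ioi_eq_Ioi (zero_le_one' ℝ)]
    exact hIoc.union hIoi
  have hneg : IntegrableOn (fun v : ℝ => (1 + |v|) ^ (-γ) * |v| ^ (-θ)) (Set.Iic 0) := by
    rw [← integrableOn_Ici_iff_integrableOn_Ioi, ← neg_zero] at hpos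
    simpa using hpos.comp_neg_Iic
  rw [← integrableOn_univ, ← Set.Iic_union_Ioi (a := (0 : ℝ))]
  exact hneg.union hpos

theorem add_abs_rpow_mul_abs_rpow_eq {γ θ h : ℝ} (hh : 0 < h) (c x : ℝ) :
    (h + |x - c|) ^ (-γ) * |x - c| ^ (-θ) =
      h ^ (-(γ + θ)) * ((1 + |(x - c) / h|) ^ (-γ) * |(x - c) / h| ^ (-θ)) := by
  have h1 : h + |x - c| = h * (1 + |(x - c) / h|) := by
    rw [abs_div, abs_of_pos hh]; field_simp
  have h2 : |x - c| = h * |(x - c) / h| := by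
    rw [abs_div, abs_of_pos hh]; field_simp
  have h3 : |x - c| ^ (-θ) = h ^ (-θ) * |(x - c) / h| ^ (-θ) := by
    rw [← Real.mul_rpow hh.le (abs_nonneg _), ← h2]
  rw [h1, Real.mul_rpow hh.le (by positivity), h3, neg_add, Real.rpow_add hh]
  ring

theorem integrable_add_abs_rpow_mul_abs_rpow {γ θ h : ℝ} (hγ : 0 ≤ γ) (hθ : θ < 1)
    (hγθ : 1 < γ + θ) (hh : 0 < h) (c : ℝ) :
    Integrable fun x : ℝ => (h + |x - c|) ^ (-γ) * |x - c| ^ (-θ) := by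
  simp_rw [add_abs_rpow_mul_abs_rpow_eq hh c]
  exact (((integrable_one_add_abs_rpow_mul_abs_rpow hγ hθ hγθ).comp_div hh.ne').comp_sub_right
    c).const_mul _

theorem integral_add_abs_rpow_mul_abs_rpow {γ θ h : ℝ} (hh : 0 < h) (c : ℝ) :
    ∫ x : ℝ, (h + |x - c|) ^ (-γ) * |x - c| ^ (-θ) =
      h ^ (1 - (γ + θ)) * ∫ v : ℝ, (1 + |v|) ^ (-γ) * |v| ^ (-θ) := by
  simp_rw [add_abs_rpow_mul_abs_rpow_eq hh c]
  rw [integral_const_mul,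
    integral_sub_right_eq_self (fun x : ℝ => (1 + |x / h|) ^ (-γ) * |x / h| ^ (-θ)) c,
    Measure.integral_comp_div (fun v : ℝ => (1 + |v|) ^ (-γ) * |v| ^ (-θ)) h, abs_of_pos hh,
    smul_eq_mul, ← mul_assoc, sub_eq_neg_add, Real.rpow_add hh, Real.rpow_one]

theorem exists_sum_one_add_abs_sub_rpow_le {b : ℝ} (hb : 1 < b) :
    ∃ S : ℝ, 0 < S ∧ ∀ (y : ℝ) (N : ℕ), ∑ k : Fin N, (1 + |y - (k : ℕ)|) ^ (-b) ≤ S := by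
  set g : ℤ → ℝ := fun z => (1 + |(z : ℝ)|) ^ (-b) with hg
  have hg0 : ∀ z, 0 ≤ g z := fun z => by positivity
  have hnat : Summable fun n : ℕ => ((n : ℝ) + 1) ^ (-b) := by
    have := (summable_nat_add_iff (f := fun n : ℕ => (n : ℝ) ^ (-b)) 1).mpr
      (Real.summable_nat_rpow.mpr (by linarith))
    simpa using this
  have hsum : Summable g := by
    refine Summable.of_nat_of_neg ?_ ?_
    · simpa [hg, add_comm] using hnat
    · simpa [hg, add_comm] using hnat
  have hts : 0 ≤ ∑' z, g z := tsum_nonneg hg0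
  refine ⟨2 ^ b * ∑' z, g z + 1, by positivity, fun y N => ?_⟩
  calc ∑ k : Fin N, (1 + |y - (k : ℕ)|) ^ (-b) ≤ ∑ k : Fin N, 2 ^ b * g (⌊y⌋ - (k : ℕ)) := by
        refine Finset.sum_le_sum fun k _ => ?_
        have h1 : (1 + |(⌊y⌋ : ℝ) - (k : ℕ)|) / 2 ≤ 1 + |y - (k : ℕ)| := by
          have h2 := Int.floor_le y
          have h3 := Int.lt_floor_add_one y
          have h4 : |(⌊y⌋ : ℝ) - (k : ℕ)| ≤ 1 + |y - (k : ℕ)| := by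
            rw [abs_le]
            constructor <;> linarith [neg_abs_le (y - (k : ℕ)), le_abs_self (y - (k : ℕ))]
          linarith [abs_nonneg (y - (k : ℕ))]
        refine (Real.rpow_le_rpow_of_nonpos (by positivity) h1 (by linarith)).trans_eq ?_
        rw [Real.div_rpow (by positivity) (by norm_num), Real.rpow_neg zero_le_two, div_inv_eq_mul,
          mul_comm, hg]
        push_cast
        rfl
    _ = 2 ^ b * ∑ k : Fin N, g (⌊y⌋ - (k : ℕ)) := by rw [Finset.mul_sum]
    _ = 2 ^ b * ∑ z ∈ Finset.univ.image fun k : Fin N => (⌊y⌋ - (k : ℕ) : ℤ), g z := by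
        rw [Finset.sum_image]
        intro a _ b _ hab
        ext
        simp only at hab
        omega
    _ ≤ 2 ^ b * ∑' z, g z := by
        gcongr
        exact hsum.sum_le_tsum _ fun z _ => hg0 z
    _ ≤ _ := by linarith

/-- Size and regularity estimates shared by the weakly singular and the Volterra kernel. -/
structure IsWeaklySingularKernel (τ : ℝ) (K : ℝ → ℝ → ℝ) : Prop where
  measurable : ∀ t, Measurable (K t)
  abs_le : ∀ t x, |K t x| ≤ |x - t| ^ (-τ)
  abs_sub_le : ∀ t t' x, t < t' → x ≠ t → x ≠ t' → |K t' x - K t x| ≤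
    3 * (t' - t) / (t' - t + |x - t|) * (|x - t| ^ (-τ) + |x - t'| ^ (-τ))

theorem rpow_neg_sub_rpow_neg_le {τ a b : ℝ} (hτ : τ ≤ 1) (ha : 0 < a) (hab : a ≤ b) :
    a ^ (-τ) - b ^ (-τ) ≤ (b - a) / b * a ^ (-τ) := by
  have hb : 0 < b := ha.trans_le hab
  have h1 : a / b ≤ (a / b) ^ τ :=
    Real.self_le_rpow_of_le_one (by positivity) ((div_le_one hb).mpr hab) hτ
  have h2 : b ^ (-τ) = (a / b) ^ τ * a ^ (-τ) := by
    rw [Real.div_rpow ha.le hb.le, Real.rpow_neg hb.le, Real.rpow_neg ha.le]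
    have := Real.rpow_pos_of_pos ha τ
    field_simp
  have h3 := mul_le_mul_of_nonneg_right h1 (Real.rpow_nonneg ha.le (-τ))
  rw [h2, sub_div, div_self hb.ne']
  linarith

theorem abs_rpow_neg_sub_rpow_neg_le {τ a b h : ℝ} (hτ0 : 0 ≤ τ) (hτ : τ ≤ 1) (ha : 0 < a)
    (hb : 0 < b) (hab : |b - a| ≤ h) (hh : h ≤ a + b) :
    |b ^ (-τ) - a ^ (-τ)| ≤ 3 * h / (h + a) * (a ^ (-τ) + b ^ (-τ)) := by
  have hh0 : 0 ≤ h := (abs_nonneg _).trans hab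
  have key : ∀ u v : ℝ, 0 < u → u ≤ v → v - u ≤ h → h + a ≤ 3 * v →
      u ^ (-τ) - v ^ (-τ) ≤ 3 * h / (h + a) * (u ^ (-τ) + v ^ (-τ)) := by
    intro u v hu huv hd hv
    have hv0 : 0 < v := hu.trans_le huv
    have hu' := Real.rpow_nonneg hu.le (-τ)
    have hv' := Real.rpow_nonneg hv0.le (-τ)
    have h1 : (v - u) / v ≤ 3 * h / (h + a) := by
      rw [div_le_div_iff₀ hv0 (by linarith)]
      nlinarith
    calc _ ≤ (v - u) / v * u ^ (-τ) := rpow_neg_sub_rpow_neg_le hτ hu huv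
      _ ≤ 3 * h / (h + a) * u ^ (-τ) := mul_le_mul_of_nonneg_right h1 hu'
      _ ≤ _ := by
        refine mul_le_mul_of_nonneg_left (by linarith) (by positivity)
  rw [_root_.abs_le] at hab
  rcases le_total a b with h | h
  · rw [abs_sub_comm, abs_of_nonneg
      (sub_nonneg.mpr (Real.rpow_le_rpow_of_nonpos ha h (by linarith)))]
    exact key a b ha h (by linarith) (by linarith)
  · rw [abs_of_nonneg (sub_nonneg.mpr (Real.rpow_le_rpow_of_nonpos hb h (by linarith))),
      add_comm (a ^ (-τ))]
    exact key b a hb h (by linarith) (by linarith)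

theorem isWeaklySingularKernel_abs {τ : ℝ} (hτ0 : 0 ≤ τ) (hτ : τ ≤ 1) :
    IsWeaklySingularKernel τ fun t x => |t - x| ^ (-τ) where
  measurable t := by fun_prop
  abs_le t x := by rw [abs_sub_comm, abs_of_nonneg (by positivity)]
  abs_sub_le t t' x htt hxt hxt' := by
    rw [abs_sub_comm t' x, abs_sub_comm t x]
    refine abs_rpow_neg_sub_rpow_neg_le hτ0 hτ (abs_pos.mpr (sub_ne_zero.mpr hxt))
      (abs_pos.mpr (sub_ne_zero.mpr hxt')) ?_ ?_
    · refine (abs_abs_sub_abs_le _ _).trans_eq ?_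
      rw [sub_sub_sub_cancel_left, abs_sub_comm, abs_of_pos (by linarith)]
    · linarith [le_abs_self (x - t), neg_abs_le (x - t')]

theorem isWeaklySingularKernel_volterra {τ : ℝ} (hτ0 : 0 ≤ τ) (hτ : τ ≤ 1) :
    IsWeaklySingularKernel τ fun t x => if x < t then (t - x) ^ (-τ) else 0 where
  measurable t := Measurable.ite measurableSet_Iio (by fun_prop) measurable_const
  abs_le t x := by
    split_ifs with h
    · rw [abs_sub_comm x t, abs_of_pos (sub_pos.mpr h),
        abs_of_nonneg (Real.rpow_nonneg (by linarith) _)]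
    · rw [abs_zero]; positivity
  abs_sub_le t t' x htt hxt hxt' := by
    have hnn : 0 ≤ 3 * (t' - t) / (t' - t + |x - t|) * (|x - t| ^ (-τ) + |x - t'| ^ (-τ)) := by
      have : 0 < t' - t := by linarith
      positivity
    rcases lt_or_gt_of_ne hxt with h1 | h1
    · rw [if_pos h1, if_pos (h1.trans htt), abs_sub_comm x t, abs_sub_comm x t',
        abs_of_pos (sub_pos.mpr h1), abs_of_pos (sub_pos.mpr (h1.trans htt))]
      refine abs_rpow_neg_sub_rpow_neg_le hτ0 hτ (by linarith) (by linarith) ?_ (by linarith)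
      rw [sub_sub_sub_cancel_right, abs_of_pos (by linarith)]
    · rw [if_neg h1.le.not_gt]
      rcases lt_or_gt_of_ne hxt' with h2 | h2
      · have h3 := Real.rpow_nonneg (sub_pos.mpr h2).le (-τ)
        have h4 := Real.rpow_nonneg (sub_pos.mpr h1).le (-τ)
        rw [if_pos h2, sub_zero, abs_of_nonneg h3, abs_sub_comm x t', abs_of_pos (sub_pos.mpr h2),
          abs_of_pos (sub_pos.mpr h1)]
        have h5 : 1 ≤ 3 * (t' - t) / (t' - t + (x - t)) := by
          rw [le_div_iff₀ (by linarith)]; linarith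
        nlinarith
      · rwa [if_neg h2.le.not_gt, sub_zero, abs_zero]

theorem weighted_kernel_rpow_le {h d d' τ β q : ℝ} (hh : 0 < h) (hd : 0 < d) (hd' : 0 < d')
    (hdd : d' ≤ h + d) (hq : 0 ≤ q) (hβ : 0 ≤ (1 - β) * q) {a : ℝ} (ha0 : 0 ≤ a)
    (ha : a ≤ 3 * h / (h + d) * (d ^ (-τ) + d' ^ (-τ))) :
    (a * (h + d) ^ β) ^ q ≤ (6 * h) ^ q * ((h + d) ^ (-((1 - β) * q)) * d ^ (-(τ * q)) +
      2 ^ ((1 - β) * q) * ((h + d') ^ (-((1 - β) * q)) * d' ^ (-(τ * q)))) := by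
  have hhd : 0 < h + d := by linarith
  have hpow : ∀ u : ℝ, 0 < u → (u ^ (-τ)) ^ q = u ^ (-(τ * q)) := fun u hu => by
    rw [← Real.rpow_mul hu.le, neg_mul]
  set M := max (d ^ (-τ)) (d' ^ (-τ)) with hM
  have hM0 : 0 ≤ M := le_max_of_le_left (Real.rpow_nonneg hd.le _)
  have h1 : a * (h + d) ^ β ≤ (6 * h) * ((h + d) ^ (-(1 - β)) * M) := by
    have h2 : d ^ (-τ) + d' ^ (-τ) ≤ 2 * M := by
      linarith [le_max_left (d ^ (-τ)) (d' ^ (-τ)), le_max_right (d ^ (-τ)) (d' ^ (-τ))]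
    have h3 : a ≤ 3 * h / (h + d) * (2 * M) :=
      ha.trans (mul_le_mul_of_nonneg_left h2 (by positivity))
    calc a * (h + d) ^ β ≤ 3 * h / (h + d) * (2 * M) * (h + d) ^ β :=
          mul_le_mul_of_nonneg_right h3 (by positivity)
      _ = (6 * h) * ((h + d) ^ (-(1 - β)) * M) := by
          rw [neg_sub, Real.rpow_sub hhd, Real.rpow_one]
          field_simp
          ring
  have h2 : M ^ q ≤ d ^ (-(τ * q)) + d' ^ (-(τ * q)) := by
    have e1 := Real.rpow_nonneg hd.le (-(τ * q))
    have e2 := Real.rpow_nonneg hd'.le (-(τ * q))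
    rcases max_choice (d ^ (-τ)) (d' ^ (-τ)) with h | h
    · rw [hM, h, hpow d hd]; linarith
    · rw [hM, h, hpow d' hd']; linarith
  have h3 : (h + d) ^ (-((1 - β) * q)) ≤
      2 ^ ((1 - β) * q) * (h + d') ^ (-((1 - β) * q)) := by
    have : (h + d') / 2 ≤ h + d := by linarith
    refine (Real.rpow_le_rpow_of_nonpos (by linarith) this (by linarith)).trans_eq ?_
    rw [Real.div_rpow (by linarith) zero_le_two, Real.rpow_neg zero_le_two, div_inv_eq_mul,
      mul_comm]
  calc (a * (h + d) ^ β) ^ q ≤ ((6 * h) * ((h + d) ^ (-(1 - β)) * M)) ^ q :=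
        Real.rpow_le_rpow (by positivity) h1 hq
    _ = (6 * h) ^ q * ((h + d) ^ (-((1 - β) * q)) * M ^ q) := by
        rw [Real.mul_rpow (by positivity) (by positivity),
          Real.mul_rpow (by positivity) hM0, ← Real.rpow_mul hhd.le, neg_mul]
    _ ≤ (6 * h) ^ q * ((h + d) ^ (-((1 - β) * q)) * (d ^ (-(τ * q)) + d' ^ (-(τ * q)))) := by
        gcongr
    _ ≤ _ := by
        rw [mul_add, ← mul_assoc (2 ^ _)]
        gcongr

theorem exists_abs_integral_kernel_sub_rpow_le {p q τ : ℝ} (hpq : p.HolderConjugate q)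
    (hτ0 : 0 < τ) (hτq : τ * q < 1) :
    ∃ M : ℝ, 0 ≤ M ∧ ∀ (K : ℝ → ℝ → ℝ), IsWeaklySingularKernel τ K → ∀ f : ℝ → ℝ,
      MemLp f (ENNReal.ofReal p) (volume.restrict (Set.Icc 0 1)) → ∀ t t' : ℝ, t < t' →
      |∫ x in Set.Icc 0 1, (K t' x - K t x) * f x| ^ p ≤
        M * (t' - t) ^ (p - 1 - τ * p + (1 / p + τ / 2) * p) *
          ∫ x in Set.Icc 0 1, (t' - t + |x - t|) ^ (-((1 / p + τ / 2) * p)) * |f x| ^ p := by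
  set β := 1 / p + τ / 2 with hβ
  set γ := (1 - β) * q with hγ
  set θ := τ * q with hθ
  have hp0 := hpq.pos
  have hq0 := hpq.symm.pos
  have hβ0 : 0 ≤ β := by positivity
  have hγ' : γ = 1 - τ * q / 2 := by
    have h1 : (1 - 1 / p) * q = 1 := by
      rw [one_div, hpq.one_sub_inv, inv_mul_cancel₀ hq0.ne']
    rw [hγ, hβ]
    linear_combination h1
  have hγ0 : 0 ≤ γ := by rw [hγ']; linarith
  have hγθ : 1 < γ + θ := by
    rw [hγ', hθ]
    have := mul_pos hτ0 hq0
    linarith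
  set I := ∫ v : ℝ, (1 + |v|) ^ (-γ) * |v| ^ (-θ) with hI
  have hI0 : 0 ≤ I := integral_nonneg fun v => by positivity
  refine ⟨(6 ^ q * ((1 + 2 ^ γ) * I)) ^ (p - 1), by positivity, ?_⟩
  intro K hK f hf t t' htt
  set h := t' - t with hh
  have hh0 : 0 < h := sub_pos.mpr htt
  set G : ℝ → ℝ := fun x => |K t' x - K t x| * (h + |x - t|) ^ β with hG
  set F : ℝ → ℝ := fun x => |f x| * (h + |x - t|) ^ (-β) with hF
  have hF0 : ∀ x, 0 ≤ F x := fun x => by positivity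
  have hG0 : ∀ x, 0 ≤ G x := fun x => by positivity
  set H : ℝ → ℝ := fun x => (6 * h) ^ q * ((h + |x - t|) ^ (-γ) * |x - t| ^ (-θ) +
      2 ^ γ * ((h + |x - t'|) ^ (-γ) * |x - t'| ^ (-θ))) with hH
  have hH0 : ∀ x, 0 ≤ H x := fun x => by positivity
  have hHint : Integrable H :=
    ((integrable_add_abs_rpow_mul_abs_rpow hγ0 hτq hγθ hh0 t).add
      ((integrable_add_abs_rpow_mul_abs_rpow hγ0 hτq hγθ hh0 t').const_mul _)).const_mul _
  have hHval : ∫ x, H x = (6 ^ q * ((1 + 2 ^ γ) * I)) * h ^ (q + (1 - (γ + θ))) := by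
    rw [hH, integral_const_mul, integral_add
      (integrable_add_abs_rpow_mul_abs_rpow hγ0 hτq hγθ hh0 t)
      ((integrable_add_abs_rpow_mul_abs_rpow hγ0 hτq hγθ hh0 t').const_mul _),
      integral_const_mul, integral_add_abs_rpow_mul_abs_rpow hh0,
      integral_add_abs_rpow_mul_abs_rpow hh0, Real.mul_rpow (by norm_num) hh0.le,
      Real.rpow_add hh0]
    ring
  have hGH : ∀ x, x ≠ t → x ≠ t' → G x ^ q ≤ H x := by
    intro x hxt hxt'
    refine weighted_kernel_rpow_le hh0 (abs_pos.mpr (sub_ne_zero.mpr hxt))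
      (abs_pos.mpr (sub_ne_zero.mpr hxt')) ?_ hq0.le hγ0 (abs_nonneg _)
      (hK.abs_sub_le t t' x htt hxt hxt')
    have := abs_add_le (x - t) (t - t')
    rw [sub_add_sub_cancel, abs_of_neg (by linarith : t - t' < 0)] at this
    linarith
  have hGHae : ∀ᵐ x ∂(volume.restrict (Set.Icc (0 : ℝ) 1)), G x ^ q ≤ H x := by
    refine ae_restrict_of_ae ?_
    filter_upwards [Measure.ae_ne volume t, Measure.ae_ne volume t'] with x h1 h2
    exact hGH x h1 h2
  have hGm : Measurable G := by
    have h1 := hK.measurable t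
    have h2 := hK.measurable t'
    rw [hG]
    refine Measurable.mul ?_ (by fun_prop)
    simp only [← Real.norm_eq_abs]
    exact (h2.sub h1).norm
  have hGq : Integrable (fun x => G x ^ q) (volume.restrict (Set.Icc (0 : ℝ) 1)) := by
    refine hHint.restrict.mono' (hGm.pow_const q).aestronglyMeasurable ?_
    filter_upwards [hGHae] with x hx
    rwa [Real.norm_of_nonneg (Real.rpow_nonneg (hG0 x) q)]
  have hGmem : MemLp G (ENNReal.ofReal q) (volume.restrict (Set.Icc (0 : ℝ) 1)) := by
    rw [← integrable_norm_rpow_iff hGm.aestronglyMeasurable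
      (by simpa using hq0) ENNReal.ofReal_ne_top, ENNReal.toReal_ofReal hq0.le]
    simpa [Real.norm_of_nonneg (hG0 _)] using hGq
  have hFmem : MemLp F (ENNReal.ofReal p) (volume.restrict (Set.Icc (0 : ℝ) 1)) := by
    refine MemLp.of_le_mul (c := h ^ (-β)) hf ?_ (Filter.Eventually.of_forall fun x => ?_)
    · refine AEStronglyMeasurable.mul hf.1.norm ?_
      exact Measurable.aestronglyMeasurable (by fun_prop)
    · have hpow : (h + |x - t|) ^ (-β) ≤ h ^ (-β) :=
        Real.rpow_le_rpow_of_nonpos hh0 (by linarith [abs_nonneg (x - t)]) (by linarith)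
      rw [Real.norm_of_nonneg (hF0 x), Real.norm_eq_abs, mul_comm]
      exact mul_le_mul_of_nonneg_left hpow (abs_nonneg _)
  have hHol := integral_mul_le_Lp_mul_Lq_of_nonneg hpq (Filter.Eventually.of_forall hF0)
    (Filter.Eventually.of_forall hG0) hFmem hGmem
  have hleft : |∫ x in Set.Icc 0 1, (K t' x - K t x) * f x| ≤
      ∫ x in Set.Icc 0 1, F x * G x := by
    refine abs_integral_le_integral_abs.trans_eq (integral_congr_ae
      (Filter.Eventually.of_forall fun x => ?_))
    have hx : 0 < h + |x - t| := by positivity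
    have : (h + |x - t|) ^ (-β) * (h + |x - t|) ^ β = 1 := by
      rw [← Real.rpow_add hx, neg_add_cancel, Real.rpow_zero]
    simp only [hF, hG, abs_mul]
    linear_combination (-(|f x| * |K t' x - K t x|)) * this
  have hFp : ∫ x in Set.Icc 0 1, F x ^ p =
      ∫ x in Set.Icc 0 1, (h + |x - t|) ^ (-(β * p)) * |f x| ^ p := by
    refine integral_congr_ae (Filter.Eventually.of_forall fun x => ?_)
    simp only [hF]
    rw [Real.mul_rpow (abs_nonneg _) (by positivity), ← Real.rpow_mul (by positivity), neg_mul,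
      mul_comm]
  have hFp0 : 0 ≤ ∫ x in Set.Icc 0 1, F x ^ p :=
    integral_nonneg fun x => Real.rpow_nonneg (hF0 x) p
  have hGq0 : 0 ≤ ∫ x in Set.Icc 0 1, G x ^ q :=
    integral_nonneg fun x => Real.rpow_nonneg (hG0 x) q
  have hGle : ∫ x in Set.Icc 0 1, G x ^ q ≤ ∫ x, H x :=
    (integral_mono_ae hGq hHint.restrict hGHae).trans
      (setIntegral_le_integral hHint (Filter.Eventually.of_forall hH0))
  calc |∫ x in Set.Icc 0 1, (K t' x - K t x) * f x| ^ p
      ≤ ((∫ x in Set.Icc 0 1, F x ^ p) ^ (1 / p) *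
          (∫ x in Set.Icc 0 1, G x ^ q) ^ (1 / q)) ^ p :=
        Real.rpow_le_rpow (abs_nonneg _) (hleft.trans hHol) hp0.le
    _ = (∫ x in Set.Icc 0 1, F x ^ p) * (∫ x in Set.Icc 0 1, G x ^ q) ^ (p - 1) := by
        rw [Real.mul_rpow (by positivity) (by positivity), ← Real.rpow_mul hFp0,
          ← Real.rpow_mul hGq0, one_div_mul_cancel hp0.ne', Real.rpow_one,
          ← hpq.div_conj_eq_sub_one, one_div_mul_eq_div]
    _ ≤ (∫ x in Set.Icc 0 1, F x ^ p) * (∫ x, H x) ^ (p - 1) :=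
        mul_le_mul_of_nonneg_left
          (Real.rpow_le_rpow hGq0 hGle (sub_nonneg.mpr hpq.lt.le)) hFp0
    _ = _ := by
        rw [hHval, Real.mul_rpow (by positivity) (by positivity), ← Real.rpow_mul hh0.le, hFp]
        have he : (q + (1 - (γ + θ))) * (p - 1) = p - 1 - τ * p + β * p := by
          have h1 : q * (p - 1) = p := by
            rw [← hpq.div_conj_eq_sub_one]; field_simp
          rw [hγ, hθ]
          linear_combination (β - τ) * h1
        rw [he]
        ring

theorem exists_abs_integral_kernel_le {p q τ : ℝ} (hpq : p.HolderConjugate q)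
    (hτ0 : 0 < τ) (hτq : τ * q < 1) :
    ∃ M : ℝ, 0 ≤ M ∧ ∀ (K : ℝ → ℝ → ℝ), IsWeaklySingularKernel τ K → ∀ t ∈ Set.Icc (0 : ℝ) 1,
      MemLp (K t) (ENNReal.ofReal q) (volume.restrict (Set.Icc 0 1)) ∧
      ∀ f : ℝ → ℝ, MemLp f (ENNReal.ofReal p) (volume.restrict (Set.Icc 0 1)) →
        |∫ x in Set.Icc 0 1, K t x * f x| ≤ M * (∫ x in Set.Icc 0 1, |f x| ^ p) ^ (1 / p) := by
  have hp0 := hpq.pos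
  have hq0 := hpq.symm.pos
  set θ := τ * q with hθ
  have hI : Integrable fun v : ℝ => (1 + |v|) ^ (-(1 : ℝ)) * |v| ^ (-θ) :=
    integrable_one_add_abs_rpow_mul_abs_rpow zero_le_one hτq (by have := mul_pos hτ0 hq0; linarith)
  set I := ∫ v : ℝ, (1 + |v|) ^ (-(1 : ℝ)) * |v| ^ (-θ) with hIdef
  have hI0 : 0 ≤ I := integral_nonneg fun v => by positivity
  refine ⟨(2 * I) ^ (1 / q), by positivity, fun K hK t ht => ?_⟩
  have hle : ∀ x ∈ Set.Icc (0 : ℝ) 1, |K t x| ^ q ≤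
      2 * ((1 + |x - t|) ^ (-(1 : ℝ)) * |x - t| ^ (-θ)) := by
    intro x hx
    have h1 : |x - t| ≤ 1 := abs_le.mpr ⟨by linarith [hx.1, ht.2], by linarith [hx.2, ht.1]⟩
    have h2 : (1 : ℝ) ≤ 2 * (1 + |x - t|) ^ (-(1 : ℝ)) := by
      rw [Real.rpow_neg_one, ← div_eq_mul_inv, le_div_iff₀ (by positivity)]
      linarith
    calc |K t x| ^ q ≤ (|x - t| ^ (-τ)) ^ q :=
          Real.rpow_le_rpow (abs_nonneg _) (hK.abs_le t x) hq0.le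
      _ = 1 * |x - t| ^ (-θ) := by rw [← Real.rpow_mul (abs_nonneg _), neg_mul, one_mul]
      _ ≤ 2 * (1 + |x - t|) ^ (-(1 : ℝ)) * |x - t| ^ (-θ) := by gcongr
      _ = _ := by ring
  have hae : ∀ᵐ x ∂(volume.restrict (Set.Icc (0 : ℝ) 1)), |K t x| ^ q ≤
      2 * ((1 + |x - t|) ^ (-(1 : ℝ)) * |x - t| ^ (-θ)) := by
    filter_upwards [ae_restrict_mem measurableSet_Icc] with x hx using hle x hx
  have hIt : Integrable fun x : ℝ => 2 * ((1 + |x - t|) ^ (-(1 : ℝ)) * |x - t| ^ (-θ)) :=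
    (hI.comp_sub_right t).const_mul 2
  have hKm := hK.measurable t
  have hKabs : Measurable fun x => |K t x| := by
    simp only [← Real.norm_eq_abs]
    exact hKm.norm
  have hKq : Integrable (fun x => |K t x| ^ q) (volume.restrict (Set.Icc (0 : ℝ) 1)) := by
    refine hIt.restrict.mono' (hKabs.pow_const q).aestronglyMeasurable ?_
    filter_upwards [hae] with x hx
    rwa [Real.norm_of_nonneg (by positivity)]
  have hKmem : MemLp (K t) (ENNReal.ofReal q) (volume.restrict (Set.Icc 0 1)) := by
    rw [← integrable_norm_rpow_iff hKm.aestronglyMeasurable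
      (by simpa using hq0) ENNReal.ofReal_ne_top, ENNReal.toReal_ofReal hq0.le]
    exact hKq
  refine ⟨hKmem, fun f hf => ?_⟩
  have hHol := integral_mul_le_Lp_mul_Lq_of_nonneg hpq
    (Filter.Eventually.of_forall fun x => abs_nonneg (f x))
    (Filter.Eventually.of_forall fun x => abs_nonneg (K t x)) hf.norm hKmem.norm
  have hKle : ∫ x in Set.Icc 0 1, |K t x| ^ q ≤ 2 * I := by
    refine (integral_mono_ae hKq hIt.restrict hae).trans
      ((setIntegral_le_integral hIt (Filter.Eventually.of_forall fun x => ?_)).trans_eq ?_)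
    · positivity
    · rw [integral_const_mul,
        integral_sub_right_eq_self (fun x : ℝ => (1 + |x|) ^ (-(1 : ℝ)) * |x| ^ (-θ)) t]
  have hKq0 : 0 ≤ ∫ x in Set.Icc 0 1, |K t x| ^ q := integral_nonneg fun x => by positivity
  have hf0 : 0 ≤ ∫ x in Set.Icc 0 1, |f x| ^ p := integral_nonneg fun x => by positivity
  calc |∫ x in Set.Icc 0 1, K t x * f x| ≤ ∫ x in Set.Icc 0 1, |f x| * |K t x| := by
        refine abs_integral_le_integral_abs.trans_eq (integral_congr_ae
          (Filter.Eventually.of_forall fun x => ?_))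
        simp only [abs_mul, mul_comm]
    _ ≤ _ := hHol
    _ ≤ _ := by
        rw [mul_comm]
        exact mul_le_mul_of_nonneg_right (Real.rpow_le_rpow hKq0 hKle (by positivity))
          (by positivity)

theorem integrable_add_abs_rpow_mul_abs_rpow_of_memLp {p b h : ℝ} {μ : Measure ℝ} (hp : 0 < p)
    (hb : 0 ≤ b) (hh : 0 < h) (c : ℝ) {f : ℝ → ℝ} (hf : MemLp f (ENNReal.ofReal p) μ) :
    Integrable (fun x => (h + |x - c|) ^ (-b) * |f x| ^ p) μ := by
  have hfp : Integrable (fun x => |f x| ^ p) μ := by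
    have := hf.integrable_norm_rpow (by simpa using hp) ENNReal.ofReal_ne_top
    simpa [ENNReal.toReal_ofReal hp.le] using this
  refine (hfp.const_mul (h ^ (-b))).mono' ?_ (Filter.Eventually.of_forall fun x => ?_)
  · exact (Measurable.aestronglyMeasurable (by fun_prop)).mul hfp.1
  · rw [Real.norm_of_nonneg (by positivity)]
    exact mul_le_mul_of_nonneg_right
      (Real.rpow_le_rpow_of_nonpos hh (by linarith [abs_nonneg (x - c)]) (by linarith))
      (by positivity)

/-- Hölder and averaged dyadic increment estimates for the image of an `L_p` function under a
weakly singular integral operator. -/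
theorem exists_integral_kernel_increment_le {p q τ : ℝ} (hpq : p.HolderConjugate q)
    (hτ0 : 0 < τ) (hτq : τ * q < 1) :
    ∃ C : ℝ, 0 ≤ C ∧ ∀ (K : ℝ → ℝ → ℝ), IsWeaklySingularKernel τ K → ∀ f : ℝ → ℝ,
      MemLp f (ENNReal.ofReal p) (volume.restrict (Set.Icc 0 1)) →
      (∀ t ∈ Set.Icc (0 : ℝ) 1, ∀ t' ∈ Set.Icc (0 : ℝ) 1, t < t' →
        |(∫ x in Set.Icc 0 1, K t' x * f x) - ∫ x in Set.Icc 0 1, K t x * f x| ^ p ≤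
          C * (t' - t) ^ (p - 1 - τ * p) * ∫ x in Set.Icc 0 1, |f x| ^ p) ∧
      ∀ j : ℕ, ∑ k : Fin (2 ^ j),
        |(∫ x in Set.Icc 0 1, K ((((k : ℕ) : ℝ) + 1) / 2 ^ j) x * f x) -
          ∫ x in Set.Icc 0 1, K (((k : ℕ) : ℝ) / 2 ^ j) x * f x| ^ p ≤
          C * ((2 : ℝ) ^ j) ^ (1 - (1 - τ) * p) * ∫ x in Set.Icc 0 1, |f x| ^ p := by
  have hp0 := hpq.pos
  obtain ⟨M₀, -, hM₀⟩ := exists_abs_integral_kernel_le hpq hτ0 hτq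
  obtain ⟨M, hM0, hM⟩ := exists_abs_integral_kernel_sub_rpow_le hpq hτ0 hτq
  set b := (1 / p + τ / 2) * p with hb
  have hb1 : 1 < b := by
    have h1 : b = 1 + τ * p / 2 := by rw [hb]; field_simp
    have := mul_pos hτ0 hp0
    linarith
  obtain ⟨S, hS0, hS⟩ := exists_sum_one_add_abs_sub_rpow_le hb1
  refine ⟨M * (1 + S), by positivity, fun K hK f hf => ?_⟩
  set N := ∫ x in Set.Icc 0 1, |f x| ^ p with hN
  have hN0 : 0 ≤ N := integral_nonneg fun x => by positivity
  have hfp : Integrable (fun x => |f x| ^ p) (volume.restrict (Set.Icc 0 1)) := by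
    have := hf.integrable_norm_rpow (by simpa using hp0) ENNReal.ofReal_ne_top
    simpa [ENNReal.toReal_ofReal hp0.le] using this
  have hsub : ∀ t ∈ Set.Icc (0 : ℝ) 1, ∀ t' ∈ Set.Icc (0 : ℝ) 1, t < t' →
      |(∫ x in Set.Icc 0 1, K t' x * f x) - ∫ x in Set.Icc 0 1, K t x * f x| ^ p ≤
        M * (t' - t) ^ (p - 1 - τ * p + b) *
          ∫ x in Set.Icc 0 1, (t' - t + |x - t|) ^ (-b) * |f x| ^ p := by
    intro t ht t' ht' htt
    have := hpq.symm.ennrealOfReal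
    have h1 : Integrable (fun x => K t x * f x) (volume.restrict (Set.Icc 0 1)) :=
      (hM₀ K hK t ht).1.integrable_mul hf
    have h2 : Integrable (fun x => K t' x * f x) (volume.restrict (Set.Icc 0 1)) :=
      (hM₀ K hK t' ht').1.integrable_mul hf
    rw [← integral_sub h2 h1]
    simp_rw [← sub_mul]
    exact hM K hK f hf t t' htt
  constructor
  · intro t ht t' ht' htt
    have hh : 0 < t' - t := sub_pos.mpr htt
    have hle : ∫ x in Set.Icc 0 1, (t' - t + |x - t|) ^ (-b) * |f x| ^ p ≤
        (t' - t) ^ (-b) * N := by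
      rw [hN, ← integral_const_mul]
      refine integral_mono
        (integrable_add_abs_rpow_mul_abs_rpow_of_memLp hp0 (by linarith) hh t hf)
        (hfp.const_mul _) fun x => ?_
      exact mul_le_mul_of_nonneg_right
        (Real.rpow_le_rpow_of_nonpos hh (by linarith [abs_nonneg (x - t)]) (by linarith))
        (by positivity)
    calc _ ≤ _ := hsub t ht t' ht' htt
      _ ≤ M * (t' - t) ^ (p - 1 - τ * p + b) * ((t' - t) ^ (-b) * N) := by gcongr
      _ = M * (t' - t) ^ (p - 1 - τ * p) * N := by
          rw [Real.rpow_add hh, Real.rpow_neg hh.le]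
          have := Real.rpow_pos_of_pos hh b
          field_simp
      _ ≤ M * (1 + S) * (t' - t) ^ (p - 1 - τ * p) * N := by
          gcongr
          exact le_mul_of_one_le_right hM0 (by linarith)
  · intro j
    set h : ℝ := 1 / 2 ^ j with hh
    have hh0 : 0 < h := by positivity
    have hscale : ∀ (k : ℕ) (x : ℝ), (h + |x - k * h|) ^ (-b) =
        h ^ (-b) * (1 + |x / h - k|) ^ (-b) := by
      intro k x
      rw [← Real.mul_rpow hh0.le (by positivity), mul_add, mul_one]
      have e : x - k * h = h * (x / h - k) := by field_simp
      rw [e, abs_mul, abs_of_pos hh0]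
    have hterm : ∀ k : Fin (2 ^ j),
        |(∫ x in Set.Icc 0 1, K ((((k : ℕ) : ℝ) + 1) / 2 ^ j) x * f x) -
          ∫ x in Set.Icc 0 1, K (((k : ℕ) : ℝ) / 2 ^ j) x * f x| ^ p ≤
        M * h ^ (p - 1 - τ * p + b) *
          ∫ x in Set.Icc 0 1, (h + |x - (k : ℕ) * h|) ^ (-b) * |f x| ^ p := by
      intro k
      have hk : ((k : ℕ) : ℝ) + 1 ≤ 2 ^ j := by exact_mod_cast k.2
      have hk0 : (0 : ℝ) ≤ (k : ℕ) := Nat.cast_nonneg _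
      have h2 : (0 : ℝ) < 2 ^ j := by positivity
      have := hsub (((k : ℕ) : ℝ) / 2 ^ j) ⟨by positivity, (div_le_one h2).mpr (by linarith)⟩
        ((((k : ℕ) : ℝ) + 1) / 2 ^ j) ⟨by positivity, (div_le_one h2).mpr hk⟩
        (div_lt_div_of_pos_right (by linarith) h2)
      have e1 : (((k : ℕ) : ℝ) + 1) / 2 ^ j - ((k : ℕ) : ℝ) / 2 ^ j = h := by rw [hh]; ring
      have e2 : ((k : ℕ) : ℝ) * h = ((k : ℕ) : ℝ) / 2 ^ j := by rw [hh]; ring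
      rw [e1] at this
      rwa [e2]
    have hint : ∀ k ∈ (Finset.univ : Finset (Fin (2 ^ j))), Integrable
        (fun x => (h + |x - (k : ℕ) * h|) ^ (-b) * |f x| ^ p)
        (volume.restrict (Set.Icc 0 1)) := fun k _ =>
      integrable_add_abs_rpow_mul_abs_rpow_of_memLp hp0 (by linarith) hh0 _ hf
    have hsum : ∑ k : Fin (2 ^ j),
        ∫ x in Set.Icc 0 1, (h + |x - (k : ℕ) * h|) ^ (-b) * |f x| ^ p ≤ h ^ (-b) * S * N := by
      rw [← integral_finsetSum _ hint, hN, ← integral_const_mul]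
      refine integral_mono (integrable_finsetSum _ hint) (hfp.const_mul _) fun x => ?_
      simp only [hscale, ← Finset.sum_mul, ← Finset.mul_sum]
      gcongr
      exact hS _ _
    calc _ ≤ ∑ k : Fin (2 ^ j), M * h ^ (p - 1 - τ * p + b) *
          ∫ x in Set.Icc 0 1, (h + |x - (k : ℕ) * h|) ^ (-b) * |f x| ^ p :=
          Finset.sum_le_sum fun k _ => hterm k
      _ ≤ M * h ^ (p - 1 - τ * p + b) * (h ^ (-b) * S * N) := by
          rw [← Finset.mul_sum]; gcongr
      _ = M * S * ((2 : ℝ) ^ j) ^ (1 - (1 - τ) * p) * N := by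
          have e : ((2 : ℝ) ^ j) ^ (1 - (1 - τ) * p) = h ^ (p - 1 - τ * p) := by
            rw [hh, one_div, Real.inv_rpow (by positivity), ← Real.rpow_neg (by positivity)]
            congr 1
            ring
          rw [e, Real.rpow_add hh0, Real.rpow_neg hh0.le]
          have := Real.rpow_pos_of_pos hh0 b
          field_simp
      _ ≤ M * (1 + S) * ((2 : ℝ) ^ j) ^ (1 - (1 - τ) * p) * N := by
          gcongr
          linarith

theorem continuous_of_abs_sub_rpow_le {p a C : ℝ} (hp : 0 < p) (ha : 0 < a)
    {g : Set.Icc (0 : ℝ) 1 → ℝ}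
    (hg : ∀ t t' : Set.Icc (0 : ℝ) 1, t < t' → |g t' - g t| ^ p ≤ C * ((t' : ℝ) - t) ^ a) :
    Continuous g := by
  have key : ∀ t t' : Set.Icc (0 : ℝ) 1,
      dist (g t') (g t) ≤ (C * |(t' : ℝ) - t| ^ a) ^ (1 / p) := by
    intro t t'
    have : |g t' - g t| ^ p ≤ C * |(t' : ℝ) - t| ^ a := by
      rcases lt_trichotomy t t' with h | h | h
      · rw [abs_of_pos (sub_pos.mpr (Subtype.coe_lt_coe.mpr h))]
        exact hg t t' h
      · simp [h, Real.zero_rpow hp.ne', Real.zero_rpow ha.ne']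
      · rw [abs_sub_comm (g t'), abs_sub_comm (t' : ℝ),
          abs_of_pos (sub_pos.mpr (Subtype.coe_lt_coe.mpr h))]
        exact hg t' t h
    have h2 := Real.rpow_le_rpow (by positivity) this (by positivity : 0 ≤ 1 / p)
    rwa [← Real.rpow_mul (abs_nonneg _), mul_one_div_cancel hp.ne', Real.rpow_one] at h2
  refine continuous_iff_continuousAt.mpr fun t => tendsto_iff_dist_tendsto_zero.mpr ?_
  refine squeeze_zero (fun _ => dist_nonneg) (key t) ?_
  have hcont : Continuous fun t' : Set.Icc (0 : ℝ) 1 =>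
      (C * |(t' : ℝ) - t| ^ a) ^ (1 / p) :=
    (continuous_const.mul ((by fun_prop : Continuous fun t' : Set.Icc (0 : ℝ) 1 =>
      |(t' : ℝ) - t|).rpow_const fun _ => Or.inr ha.le)).rpow_const
      fun _ => Or.inr (by positivity)
  have h0 := hcont.tendsto t
  simpa [Real.zero_rpow ha.ne', Real.zero_rpow (inv_pos.mpr hp).ne'] using h0

theorem Lp_norm_eq_integral_abs_rpow {p : ℝ} {μ : Measure ℝ} (hp : 0 < p)
    (f : Lp ℝ (ENNReal.ofReal p) μ) : ‖f‖ = (∫ x, |f x| ^ p ∂μ) ^ (1 / p) := by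
  rw [Lp.norm_def, (Lp.memLp f).eLpNorm_eq_integral_rpow_norm (by simpa using hp)
    ENNReal.ofReal_ne_top, ENNReal.toReal_ofReal hp.le, ENNReal.toReal_ofReal, one_div]
  · simp
  · positivity

theorem exists_continuousLinearMap_integral_kernel {p q τ : ℝ} [Fact (1 ≤ ENNReal.ofReal p)]
    (hpq : p.HolderConjugate q) (hτ0 : 0 < τ) (hτq : τ * q < 1) {K : ℝ → ℝ → ℝ}
    (hK : IsWeaklySingularKernel τ K) :
    ∃ T : Lp ℝ (ENNReal.ofReal p) (volume.restrict (Set.Icc (0 : ℝ) 1)) →L[ℝ]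
        C(Set.Icc (0 : ℝ) 1, ℝ),
      ∀ f t, T f t = ∫ x in Set.Icc (0 : ℝ) 1, K t x * f x := by
  have hp0 := hpq.pos
  obtain ⟨M, hM0, hM⟩ := exists_abs_integral_kernel_le hpq hτ0 hτq
  obtain ⟨C, -, hC⟩ := exists_integral_kernel_increment_le hpq hτ0 hτq
  have hexp : 0 < p - 1 - τ * p := by
    have h1 : (τ * q) * (p - 1) = τ * p := by
      rw [← hpq.div_conj_eq_sub_one]
      have := hpq.symm.pos
      field_simp
    have h2 := mul_lt_mul_of_pos_right hτq (sub_pos.mpr hpq.lt)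
    linarith
  have hint : ∀ (f : Lp ℝ (ENNReal.ofReal p) (volume.restrict (Set.Icc (0 : ℝ) 1)))
      (t : Set.Icc (0 : ℝ) 1),
      Integrable (fun x => K t x * f x) (volume.restrict (Set.Icc (0 : ℝ) 1)) := by
    intro f t
    have := hpq.symm.ennrealOfReal
    exact (hM K hK t t.2).1.integrable_mul (Lp.memLp f)
  have hcont : ∀ f : Lp ℝ (ENNReal.ofReal p) (volume.restrict (Set.Icc (0 : ℝ) 1)),
      Continuous fun t : Set.Icc (0 : ℝ) 1 => ∫ x in Set.Icc (0 : ℝ) 1, K t x * f x := by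
    intro f
    refine continuous_of_abs_sub_rpow_le hp0 hexp
      (C := C * ∫ x in Set.Icc 0 1, |f x| ^ p) fun t t' htt => ?_
    refine ((hC K hK f (Lp.memLp f)).1 t t.2 t' t'.2 htt).trans_eq ?_
    ring
  let L : Lp ℝ (ENNReal.ofReal p) (volume.restrict (Set.Icc (0 : ℝ) 1)) →ₗ[ℝ]
      C(Set.Icc (0 : ℝ) 1, ℝ) :=
    { toFun := fun f => ⟨fun t => ∫ x in Set.Icc (0 : ℝ) 1, K t x * f x, hcont f⟩
      map_add' := fun f g => by
        ext t
        simp only [ContinuousMap.coe_mk, ContinuousMap.add_apply]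
        rw [← integral_add (hint f t) (hint g t)]
        refine integral_congr_ae ?_
        filter_upwards [Lp.coeFn_add f g] with x hx
        rw [hx, Pi.add_apply, mul_add]
      map_smul' := fun c f => by
        ext t
        simp only [ContinuousMap.coe_mk, ContinuousMap.smul_apply, RingHom.id_apply, smul_eq_mul]
        rw [← integral_const_mul]
        refine integral_congr_ae ?_
        filter_upwards [Lp.coeFn_smul c f] with x hx
        rw [hx, Pi.smul_apply, smul_eq_mul, mul_left_comm] }
  refine ⟨L.mkContinuous M fun f => ?_, fun f t => rfl⟩
  rw [ContinuousMap.norm_le _ (by positivity)]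
  intro t
  rw [Lp_norm_eq_integral_abs_rpow hp0]
  exact (hM K hK t t.2).2 f (Lp.memLp f)

/-- For `2 ≤ p < ∞` and `k(x) = x^{-τ}` with `0 < τ < 1/p'`, the operator
`T_K` (with `K` the weakly singular or the Volterra kernel) maps `L_p[0,1]` boundedly into
`C[0,1]`, and `e_n(T_K) ≤ c n^{τ-1}`. -/
theorem stmt13 (p p' τ : ℝ) (hp : 2 ≤ p) (hp' : 1 / p + 1 / p' = 1)
    (hτ0 : 0 < τ) (hτ : τ < 1 / p') :
    letI : Fact (1 ≤ ENNReal.ofReal p) := ⟨ENNReal.one_le_ofReal.mpr (by linarith)⟩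
    ∀ K : ℝ → ℝ → ℝ,
      ((K = fun t x => |t - x| ^ (-τ)) ∨
       (K = fun t x => if x < t then (t - x) ^ (-τ) else 0)) →
      ∃ T : Lp ℝ (ENNReal.ofReal p) (volume.restrict (Set.Icc (0:ℝ) 1)) →L[ℝ]
          C(Set.Icc (0:ℝ) 1, ℝ),
        (∀ (f : Lp ℝ (ENNReal.ofReal p) (volume.restrict (Set.Icc (0:ℝ) 1)))
            (t : Set.Icc (0:ℝ) 1),
          T f t = ∫ x in (0:ℝ)..1, K (t : ℝ) x * f x) ∧
        ∃ c > 0, ∀ n : ℕ, 1 ≤ n → opDyadEntropyNum T n ≤ c * (n : ℝ) ^ (τ - 1) := by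
  intro K hK
  have : Fact (1 ≤ ENNReal.ofReal p) := ⟨ENNReal.one_le_ofReal.mpr (by linarith)⟩
  have hpq : p.HolderConjugate p' := Real.holderConjugate_iff.mpr
    ⟨by linarith, by simpa only [one_div] using hp'⟩
  have hp0 := hpq.pos
  have hq0 := hpq.symm.pos
  have hτq : τ * p' < 1 := (lt_div_iff₀ hq0).mp hτ
  have hτ1 : τ ≤ 1 := by
    have := one_div_pos.mpr hp0
    linarith
  have hws : IsWeaklySingularKernel τ K := by
    rcases hK with rfl | rfl
    · exact isWeaklySingularKernel_abs hτ0.le hτ1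
    · exact isWeaklySingularKernel_volterra hτ0.le hτ1
  obtain ⟨T, hT⟩ := exists_continuousLinearMap_integral_kernel hpq hτ0 hτq hws
  refine ⟨T, fun f t => ?_, ?_⟩
  · rw [hT, intervalIntegral.integral_of_le zero_le_one, integral_Icc_eq_integral_Ioc]
  obtain ⟨C, hC0, hC⟩ := exists_integral_kernel_increment_le hpq hτ0 hτq
  have hsp : 1 < (1 - τ) * p := by
    have h1 : τ < 1 - 1 / p := by linarith
    have h2 := mul_lt_mul_of_pos_right (by linarith : 1 / p < 1 - τ) hp0
    rwa [one_div_mul_cancel hp0.ne'] at h2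
  have hnorm : ∀ φ ∈ T '' Metric.closedBall 0 1, ‖φ‖ ≤ max ‖T‖ C := by
    rintro _ ⟨f, hf, rfl⟩
    exact (T.le_of_opNorm_le_of_le le_rfl (mem_closedBall_zero_iff.mp hf)).trans
      ((mul_one _).trans_le (le_max_left _ _))
  have hinc : ∀ φ ∈ T '' Metric.closedBall 0 1, ∀ j, ∑ k : Fin (2 ^ j), |dyadicIncr φ j k| ^ p ≤
      max ‖T‖ C * ((2 : ℝ) ^ j) ^ (1 - (1 - τ) * p) := by
    rintro _ ⟨f, hf, rfl⟩ j
    have hN0 : 0 ≤ ∫ x in Set.Icc 0 1, |f x| ^ p := integral_nonneg fun x => by positivity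
    have hN1 : ∫ x in Set.Icc 0 1, |f x| ^ p ≤ 1 := by
      have h1 := mem_closedBall_zero_iff.mp hf
      rw [Lp_norm_eq_integral_abs_rpow hp0] at h1
      by_contra! h2
      exact absurd h1 (not_le.mpr (Real.one_lt_rpow h2 (by positivity)))
    have heval : ∀ t ∈ Set.Icc (0 : ℝ) 1,
        extendEval (T f) t = ∫ x in Set.Icc (0 : ℝ) 1, K t x * f x := by
      intro t ht
      rw [extendEval, Set.projIcc_of_mem zero_le_one ht, hT]
    have hincr : ∀ k : Fin (2 ^ j), dyadicIncr (T f) j k =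
        (∫ x in Set.Icc 0 1, K ((((k : ℕ) : ℝ) + 1) / 2 ^ j) x * f x) -
          ∫ x in Set.Icc 0 1, K (((k : ℕ) : ℝ) / 2 ^ j) x * f x := by
      intro k
      have hk : ((k : ℕ) : ℝ) + 1 ≤ 2 ^ j := by exact_mod_cast k.2
      have h2 : (0 : ℝ) < 2 ^ j := by positivity
      rw [dyadicIncr, heval _ ⟨by positivity, (div_le_one h2).mpr hk⟩,
        heval _ ⟨by positivity, (div_le_one h2).mpr (by linarith)⟩]
    simp only [hincr]
    calc _ ≤ C * ((2 : ℝ) ^ j) ^ (1 - (1 - τ) * p) * ∫ x in Set.Icc 0 1, |f x| ^ p :=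
          (hC K hws f (Lp.memLp f)).2 j
      _ ≤ C * ((2 : ℝ) ^ j) ^ (1 - (1 - τ) * p) * 1 := by gcongr
      _ ≤ max ‖T‖ C * ((2 : ℝ) ^ j) ^ (1 - (1 - τ) * p) := by
          rw [mul_one]; gcongr; exact le_max_right _ _
  obtain ⟨c, hc0, hc⟩ := exists_entropyNum_le_rpow (by linarith) hsp (by linarith)
    (hC0.trans (le_max_right _ _)) (T '' Metric.closedBall 0 1) hnorm hinc
  refine ⟨c, hc0, fun n hn => ?_⟩
  rw [show τ - 1 = -(1 - τ) by ring]
  exact hc n hn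
end

section
/- Let 2 ≤ p < ∞ and k(x) = x^{−1/p'} (c_0 − ln x)^{−β} with 1/p' < β < ∞ and c_0 > 0 chosen so that k is strictly decreasing on (0,1] (e.g. c_0 > βp'). Then the operator T_K, with K either the weakly singular kernel (WS) or the Volterra kernel (VO), maps L_p[0,1] boundedly into C[0,1], and there is a constant c > 0 (independent of n) such that for all n ∈ ℕ: e_n(T_K : L_p[0,1] → C[0,1]) ≤ c · n^{1/p' − β} if 1/p' < β < 1; e_n(T_K : L_p[0,1] → C[0,1]) ≤ c · n^{−1/p} (log(n+1))^{1 − β} if 1 < β < ∞; and e_n(T_K : L_p[0,1] → C[0,1]) ≤ c · n^{−1/p} log(n+1) if β = 1. -/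
open MeasureTheory

theorem sum_prod_map_le_two {α : Type*} [Fintype α] (x : α → ℝ) (hx : ∀ a, 0 ≤ x a)
    (hs : ∑ a, x a ≤ 1 / 2) (k : ℕ) (S : Finset (List α)) (hS : ∀ L ∈ S, L.length ≤ k) :
    ∑ L ∈ S, (L.map x).prod ≤ 2 := by
  classical
  have hnn : ∀ L : List α, 0 ≤ (L.map x).prod := fun L ↦
    List.prod_nonneg (by simpa using fun a _ ↦ hx a)
  induction k generalizing S with
  | zero =>
    have : S ⊆ {[]} := fun L hL ↦ by simpa using hS L hL
    calc _ ≤ ∑ L ∈ ({[]} : Finset (List α)), (L.map x).prod :=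
          Finset.sum_le_sum_of_subset_of_nonneg this fun L _ _ ↦ hnn L
      _ ≤ 2 := by simp
  | succ k ih =>
    set S' : Finset (List α) := (S.filter (· ≠ [])).image List.tail
    have hsub : S ⊆ insert [] ((Finset.univ ×ˢ S').image fun y : α × List α ↦ y.1 :: y.2) := by
      intro L hL
      cases L with
      | nil => simp
      | cons a L =>
        simp only [Finset.mem_insert, Finset.mem_image, Finset.mem_product]
        refine Or.inr ⟨(a, L), ⟨Finset.mem_univ _, ?_⟩, rfl⟩
        exact Finset.mem_image.2 ⟨a :: L, by simpa using hL, rfl⟩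
    have hS' : ∀ L ∈ S', L.length ≤ k := by
      intro L hL
      obtain ⟨L', hL', rfl⟩ := Finset.mem_image.1 hL
      have := hS L' (Finset.mem_filter.1 hL').1
      simp only [List.length_tail]; omega
    calc ∑ L ∈ S, (L.map x).prod
        ≤ ∑ L ∈ insert [] ((Finset.univ ×ˢ S').image fun y : α × List α ↦ y.1 :: y.2),
            (L.map x).prod := Finset.sum_le_sum_of_subset_of_nonneg hsub fun L _ _ ↦ hnn L
      _ = 1 + ∑ y ∈ Finset.univ ×ˢ S', x y.1 * (y.2.map x).prod := by
          rw [Finset.sum_insert (by simp), Finset.sum_image]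
          · simp
          · rintro ⟨a, L⟩ _ ⟨b, L'⟩ _ h
            simpa using h
      _ = 1 + (∑ a, x a) * ∑ L ∈ S', (L.map x).prod := by
          rw [Finset.sum_product, Finset.sum_mul_sum]
      _ ≤ 1 + 1 / 2 * 2 := by
          gcongr
          · exact Finset.sum_nonneg fun L _ ↦ hnn L
          · exact ih S' hS'
      _ = 2 := by norm_num

/-- A Kraft type inequality for lists with a bounded total cost. -/
theorem exists_finset_lists {α : Type*} [Fintype α] (a : α → ℝ) (ha : ∀ i, 0 < a i) (M : ℝ)
    (hM : 0 ≤ M) (hs : ∑ i, (2 : ℝ) ^ (-(M * a i)) ≤ 1 / 2) :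
    ∃ S : Finset (List α), (∀ L : List α, (L.map a).sum ≤ 1 → L ∈ S) ∧
      (S.card : ℝ) ≤ 2 ^ (M + 1) := by
  classical
  have hfin : {L : List α | (L.map a).sum ≤ 1}.Finite := by
    obtain ⟨δ, hδ, hδa⟩ : ∃ δ > 0, ∀ i, δ ≤ a i := by
      rcases isEmpty_or_nonempty α with h | h
      · exact ⟨1, one_pos, fun i ↦ h.elim i⟩
      · obtain ⟨i, hi⟩ := Finite.exists_min a
        exact ⟨a i, ha i, hi⟩
    refine (List.finite_length_le α ⌊1 / δ⌋₊).subset fun L hL ↦ ?_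
    have h1 : ∀ L : List α, L.length * δ ≤ (L.map a).sum := by
      intro L
      induction L with
      | nil => simp
      | cons i L ih =>
        simp only [List.length_cons, List.map_cons, List.sum_cons]
        push_cast
        linarith [hδa i]
    have h2 := (h1 L).trans hL
    exact Nat.le_floor (by rwa [le_div_iff₀ hδ])
  refine ⟨hfin.toFinset, fun L hL ↦ by simpa using hL, ?_⟩
  have hprod : ∀ L : List α, (L.map fun i ↦ (2 : ℝ) ^ (-(M * a i))).prod =
      2 ^ (-(M * (L.map a).sum)) := by
    intro L
    induction L with
    | nil => simp
    | cons i L ih =>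
      simp only [List.map_cons, List.prod_cons, List.sum_cons, ih]
      rw [← Real.rpow_add two_pos]
      ring_nf
  have key := sum_prod_map_le_two (fun i ↦ (2 : ℝ) ^ (-(M * a i))) (fun i ↦ by positivity) hs
    (hfin.toFinset.sup List.length) hfin.toFinset fun L hL ↦ Finset.le_sup (f := List.length) hL
  have h3 : (hfin.toFinset.card : ℝ) * 2 ^ (-M) ≤ 2 := by
    refine le_trans ?_ key
    rw [← nsmul_eq_mul]
    refine Finset.card_nsmul_le_sum _ _ _ fun L hL ↦ ?_
    rw [hprod]
    have : (L.map a).sum ≤ 1 := by simpa using hL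
    apply Real.rpow_le_rpow_of_exponent_le one_le_two
    nlinarith
  rw [Real.rpow_add two_pos, Real.rpow_one]
  rw [Real.rpow_neg two_pos.le, ← div_eq_mul_inv, div_le_iff₀ (by positivity)] at h3
  linarith

/-- An online mirror descent argument: on a space whose norm has a potential `‖·‖ ^ q / q` with
smoothness of power type `q`, the action of a functional of norm at most one on a finite family of
vectors is determined, up to prescribed errors, by a list of small total cost. -/
theorem exists_list_forall_sub_le {V α : Type*} [NormedAddCommGroup V] [NormedSpace ℝ V]
    {p q C : ℝ} (hpq : q.HolderConjugate p) (D : V → V → ℝ)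
    (hD : ∀ θ v, ‖θ + v‖ ^ q / q ≤ ‖θ‖ ^ q / q + D θ v + C * ‖v‖ ^ q)
    (hDs : ∀ θ (c : ℝ) v, D θ (c • v) = c * D θ v)
    (u : α → V) (a ε : α → ℝ) (ha : ∀ i, 0 < a i) (hε : ∀ i, 0 < ε i)
    (hw : ∀ i, C * ((2 * a i / ε i) * ‖u i‖) ^ q ≤ a i)
    (S : Finset (List α)) (hS : ∀ L : List α, (L.map a).sum ≤ 1 → L ∈ S)
    (l : V →L[ℝ] ℝ) (hl : ‖l‖ ≤ 1) :
    ∃ L ∈ S, ∀ i, l (u i) - D (L.map fun i ↦ (2 * a i / ε i) • u i).sum (u i) ≤ ε i := by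
  by_contra! hcon
  set th : List α → V := fun L ↦ (L.map fun i ↦ (2 * a i / ε i) • u i).sum with hth
  have hle : ∀ L : List α, (L.map a).sum ≤ l (th L) - ‖th L‖ ^ q / q → (L.map a).sum ≤ 1 := by
    intro L hL
    have h1 : l (th L) ≤ ‖th L‖ * 1 := by
      rw [mul_one]
      exact (le_abs_self _).trans (l.le_of_opNorm_le hl _ |>.trans_eq (one_mul _))
    have h2 := Real.young_inequality_of_nonneg (norm_nonneg (th L)) zero_le_one hpq
    have h3 : (1 : ℝ) ^ p / p ≤ 1 := by
      rw [Real.one_rpow]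
      exact (div_le_one hpq.symm.pos).2 hpq.symm.lt.le
    linarith
  have hex : ∀ n : ℕ, ∃ L : List α, L.length = n ∧
      (L.map a).sum ≤ l (th L) - ‖th L‖ ^ q / q := by
    intro n
    induction n with
    | zero => exact ⟨[], rfl, by simp [hth, Real.zero_rpow hpq.pos.ne']⟩
    | succ n ih =>
      obtain ⟨L, hLn, hL⟩ := ih
      obtain ⟨i, hi⟩ := hcon L (hS L (hle L hL))
      refine ⟨i :: L, by simp [hLn], ?_⟩
      have hcons : th (i :: L) = th L + (2 * a i / ε i) • u i := by
        simp [hth, add_comm]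
      have hwpos : 0 < 2 * a i / ε i := div_pos (mul_pos two_pos (ha i)) (hε i)
      have h1 := hD (th L) ((2 * a i / ε i) • u i)
      rw [hDs, norm_smul, Real.norm_of_nonneg hwpos.le] at h1
      have h2 := hw i
      have h3 : 2 * a i / ε i * ε i < 2 * a i / ε i * (l (u i) - D (th L) (u i)) :=
        mul_lt_mul_of_pos_left hi hwpos
      rw [div_mul_cancel₀ _ (hε i).ne', mul_sub] at h3
      rw [hcons, map_add, map_smul, smul_eq_mul, List.map_cons, List.sum_cons]
      linarith
  obtain ⟨L, hLn, hL⟩ := hex (S.sup List.length + 1)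
  have := Finset.le_sup (f := List.length) (hS L (hle L hL))
  omega

/-- The dyadic net point below `t` at level `j`, with spacing `2 ^ (-2 ^ j)`. -/
noncomputable def netPoint (j : ℕ) (t : ℝ) : ℝ := (⌊t * 2 ^ 2 ^ j⌋₊ : ℝ) / 2 ^ 2 ^ j

theorem netPoint_netPoint (j : ℕ) (t : ℝ) :
    netPoint j (netPoint (j + 1) t) = netPoint j t := by
  unfold netPoint
  congr 2
  have h : (2 : ℝ) ^ 2 ^ (j + 1) = 2 ^ 2 ^ j * ((2 ^ 2 ^ j : ℕ) : ℝ) := by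
    push_cast; rw [← pow_add]; ring_nf
  rw [h]
  have h2 : (⌊t * (2 ^ 2 ^ j * ((2 ^ 2 ^ j : ℕ) : ℝ))⌋₊ : ℝ) / (2 ^ 2 ^ j * ((2 ^ 2 ^ j : ℕ) : ℝ)) *
      2 ^ 2 ^ j = (⌊t * (2 ^ 2 ^ j * ((2 ^ 2 ^ j : ℕ) : ℝ))⌋₊ : ℝ) / ((2 ^ 2 ^ j : ℕ) : ℝ) := by
    field_simp
  rw [h2, Nat.floor_div_natCast, Nat.floor_natCast, ← Nat.floor_div_natCast]
  congr 1
  push_cast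
  field_simp

theorem netPoint_mem {j : ℕ} {t : ℝ} (ht : t ∈ Set.Icc (0 : ℝ) 1) :
    netPoint j t ∈ Set.Icc (0 : ℝ) 1 := by
  refine ⟨by unfold netPoint; positivity, ?_⟩
  unfold netPoint
  rw [div_le_one (by positivity)]
  refine (Nat.floor_le (mul_nonneg ht.1 (by positivity))).trans ?_
  exact mul_le_of_le_one_left (by positivity) ht.2

theorem abs_sub_netPoint_le {j : ℕ} {t : ℝ} (ht : t ∈ Set.Icc (0 : ℝ) 1) :
    |t - netPoint j t| ≤ 1 / 2 ^ 2 ^ j := by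
  unfold netPoint
  have h1 := Nat.floor_le (mul_nonneg ht.1 (by positivity : (0 : ℝ) ≤ 2 ^ 2 ^ j))
  have h2 := (Nat.lt_floor_add_one (t * 2 ^ 2 ^ j)).le
  have hN : (0 : ℝ) < 2 ^ 2 ^ j := by positivity
  rw [abs_of_nonneg, sub_le_iff_le_add, ← add_div, le_div_iff₀ hN]
  · linarith
  · rw [sub_nonneg, div_le_iff₀ hN]; exact h1

theorem exists_netPoint_eq {j : ℕ} {t : ℝ} (ht : t ∈ Set.Icc (0 : ℝ) 1) :
    ∃ r : Fin (2 ^ 2 ^ j + 1), netPoint j t = (r : ℝ) / 2 ^ 2 ^ j := by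
  refine ⟨⟨⌊t * 2 ^ 2 ^ j⌋₊, Nat.lt_succ_of_le (Nat.floor_le_of_le ?_)⟩, rfl⟩
  push_cast
  exact mul_le_of_le_one_left (by positivity) ht.2

theorem sum_netPoint_weights_le (j₀ d : ℕ) (M : ℝ) (hM : 0 < M) :
    ∑ i : (Σ i : Fin d, Fin (2 ^ 2 ^ (j₀ + i + 1) + 1) × Bool),
      (2 : ℝ) ^ (-(M * (8 * 2 ^ (j₀ + i.1 : ℕ) / M))) ≤ 1 / 2 := by
  rw [Fintype.sum_sigma]
  have h1 : ∀ i : Fin d, ∑ _r : Fin (2 ^ 2 ^ (j₀ + i + 1) + 1) × Bool,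
      (2 : ℝ) ^ (-(M * (8 * 2 ^ (j₀ + i : ℕ) / M))) ≤ 1 / 4 * (1 / 2) ^ (i : ℕ) := by
    intro i
    rw [Finset.sum_const, Finset.card_univ, Fintype.card_prod, Fintype.card_fin, Fintype.card_bool,
      mul_div_cancel₀ _ hM.ne', nsmul_eq_mul, Real.rpow_neg two_pos.le, ← div_eq_mul_inv,
      div_le_iff₀ (by positivity)]
    have e1 : (8 : ℝ) * 2 ^ (j₀ + i : ℕ) = ((8 * 2 ^ (j₀ + i : ℕ) : ℕ) : ℝ) := by push_cast; rfl
    rw [e1, Real.rpow_natCast]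
    have e2 : (1 / 4 * (1 / 2) ^ (i : ℕ) : ℝ) = 1 / 2 ^ ((i : ℕ) + 2) := by
      rw [pow_add, one_div_pow]; field_simp; norm_num
    rw [e2, one_div_mul_eq_div, le_div_iff₀ (by positivity)]
    have e3 : ((2 ^ 2 ^ (j₀ + i + 1) + 1 : ℕ) : ℝ) ≤ 2 ^ (2 ^ (j₀ + i + 1) + 1) := by
      rw [pow_succ (2 : ℝ)]
      push_cast
      have : (1 : ℝ) ≤ 2 ^ 2 ^ (j₀ + i + 1) := one_le_pow₀ one_le_two
      linarith
    push_cast at e3 ⊢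
    calc _ ≤ (2 : ℝ) ^ (2 ^ (j₀ + i + 1) + 1) * 2 * 2 ^ ((i : ℕ) + 2) := by gcongr
      _ = (2 : ℝ) ^ (2 ^ (j₀ + i + 1) + 1 + 1 + ((i : ℕ) + 2)) := by ring
      _ ≤ _ := by
        apply pow_le_pow_right₀ one_le_two
        have := Nat.lt_two_pow_self (n := j₀ + i)
        rw [pow_succ]
        omega
  refine (Finset.sum_le_sum fun i _ ↦ h1 i).trans ?_
  rw [← Finset.mul_sum, Fin.sum_univ_eq_sum_range (fun i ↦ (1 / 2 : ℝ) ^ i)]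
  have h2 : ∑ i ∈ Finset.range d, (1 / 2 : ℝ) ^ i ≤ 2 := by
    have := summable_geometric_two.sum_le_tsum (Finset.range d) (fun i _ ↦ by positivity)
    rwa [tsum_geometric_two] at this
  linarith

/-- The dual unit ball of a space with a smooth norm of power type `q`, acting on a curve `K` with
logarithmic modulus of continuity, splits into few classes on which the action varies little. -/
theorem exists_coding {V : Type*} [NormedAddCommGroup V] [NormedSpace ℝ V]
    {p q C A : ℝ} (hpq : q.HolderConjugate p) (D : V → V → ℝ)
    (hD : ∀ θ v, ‖θ + v‖ ^ q / q ≤ ‖θ‖ ^ q / q + D θ v + C * ‖v‖ ^ q)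
    (hDs : ∀ θ (c : ℝ) v, D θ (c • v) = c * D θ v) (hC : 0 ≤ C)
    (hA : 0 < A) (hAC : C * (2 / A) ^ q ≤ 1)
    (K : ℝ → V) {R ρ α : ℝ} (hR : 0 < R) (hρ : 0 < ρ)
    (hKR : ∀ t ∈ Set.Icc (0 : ℝ) 1, ‖K t‖ ≤ R)
    (hK : ∀ s ∈ Set.Icc (0 : ℝ) 1, ∀ t ∈ Set.Icc (0 : ℝ) 1, ∀ j : ℕ,
      |s - t| ≤ 1 / 2 ^ 2 ^ j → ‖K s - K t‖ ≤ ρ * ((2 : ℝ) ^ j) ^ (-α))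
    (j₀ d Q : ℕ) (hQ : 0 < Q) {M : ℝ} (hM : 0 < M) :
    ∃ (β : Type) (F : Finset β) (code : (V →L[ℝ] ℝ) → β),
      (∀ l, ‖l‖ ≤ 1 → code l ∈ F) ∧
      (F.card : ℝ) ≤ 2 ^ (M + 1) * (2 * Q + 1) ^ (2 ^ 2 ^ j₀ + 1) ∧
      ∀ l l', ‖l‖ ≤ 1 → ‖l'‖ ≤ 1 → code l = code l' → ∀ t ∈ Set.Icc (0 : ℝ) 1,
        |l (K t) - l' (K t)| ≤ R / Q +
          ∑ i ∈ Finset.range d,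
            2 * (A * (ρ * ((2 : ℝ) ^ (j₀ + i)) ^ (-α)) * (8 * 2 ^ (j₀ + i) / M) ^ (1 / p)) +
          2 * (ρ * ((2 : ℝ) ^ (j₀ + d)) ^ (-α)) := by
  classical
  set v : ∀ i : Fin d, Fin (2 ^ 2 ^ (j₀ + i + 1) + 1) → V := fun i r ↦
    K ((r : ℝ) / 2 ^ 2 ^ (j₀ + i + 1)) - K (netPoint (j₀ + i) ((r : ℝ) / 2 ^ 2 ^ (j₀ + i + 1)))
    with hv
  set ι := Σ i : Fin d, Fin (2 ^ 2 ^ (j₀ + i + 1) + 1) × Bool with hι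
  set u : ι → V := fun x ↦ if x.2.2 then v x.1 x.2.1 else (-1 : ℝ) • v x.1 x.2.1 with hu
  set a : ι → ℝ := fun x ↦ 8 * 2 ^ (j₀ + x.1 : ℕ) / M with ha
  set e : ℕ → ℝ := fun i ↦ A * (ρ * ((2 : ℝ) ^ (j₀ + i)) ^ (-α)) * (8 * 2 ^ (j₀ + i) / M) ^ (1 / p)
    with he
  set ε : ι → ℝ := fun x ↦ e x.1 with hε
  have hunit : ∀ (N : ℕ) (r : Fin (2 ^ N + 1)), (r : ℝ) / 2 ^ N ∈ Set.Icc (0 : ℝ) 1 := by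
    intro N r
    refine ⟨by positivity, ?_⟩
    rw [div_le_one (by positivity)]
    exact_mod_cast Nat.lt_succ_iff.1 r.2
  have hvn : ∀ i r, ‖v i r‖ ≤ ρ * ((2 : ℝ) ^ (j₀ + i : ℕ)) ^ (-α) := fun i r ↦
    hK _ (hunit _ r) _ (netPoint_mem (hunit _ r)) _ (abs_sub_netPoint_le (hunit _ r))
  have hun : ∀ x, ‖u x‖ ≤ ρ * ((2 : ℝ) ^ (j₀ + x.1 : ℕ)) ^ (-α) := by
    intro x
    simp only [hu]
    split_ifs
    · exact hvn _ _
    · rw [norm_smul]; simpa using hvn x.1 x.2.1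
  have hapos : ∀ x, 0 < a x := fun x ↦ by simp only [ha]; positivity
  have hepos : ∀ x, 0 < ε x := fun x ↦ by simp only [hε, he]; positivity
  have hw : ∀ x, C * ((2 * a x / ε x) * ‖u x‖) ^ q ≤ a x := by
    intro x
    have h1 : (2 * a x / ε x) * ‖u x‖ ≤ (2 / A) * a x ^ (1 / q) := by
      have hr : 0 < ρ * ((2 : ℝ) ^ (j₀ + x.1 : ℕ)) ^ (-α) := by positivity
      have hε' : ε x = A * (ρ * ((2 : ℝ) ^ (j₀ + x.1 : ℕ)) ^ (-α)) * a x ^ (1 / p) := rfl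
      have h2 : a x = a x ^ (1 / q) * a x ^ (1 / p) := by
        rw [← Real.rpow_add (hapos x), one_div, one_div, hpq.inv_add_inv_eq_one, Real.rpow_one]
      have h3 : 0 < a x ^ (1 / p) := Real.rpow_pos_of_pos (hapos x) _
      rw [hε']
      calc _ ≤ 2 * a x / (A * (ρ * ((2 : ℝ) ^ (j₀ + x.1 : ℕ)) ^ (-α)) * a x ^ (1 / p)) *
            (ρ * ((2 : ℝ) ^ (j₀ + x.1 : ℕ)) ^ (-α)) := by
            have := hapos x
            have := hun x
            gcongr
        _ = (2 / A) * (a x / a x ^ (1 / p)) := by field_simp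
        _ = (2 / A) * a x ^ (1 / q) := by
            congr 1
            rw [div_eq_iff h3.ne']
            exact h2
    have h0 : 0 ≤ (2 * a x / ε x) * ‖u x‖ := by
      have := hapos x; have := hepos x; positivity
    calc _ ≤ C * ((2 / A) * a x ^ (1 / q)) ^ q := by
          gcongr
          exact hpq.nonneg
      _ = C * (2 / A) ^ q * a x := by
          rw [Real.mul_rpow (by positivity) (Real.rpow_nonneg (hapos x).le _),
            ← Real.rpow_mul (hapos x).le, one_div_mul_cancel hpq.ne_zero, Real.rpow_one, mul_assoc]
      _ ≤ a x := mul_le_of_le_one_left (hapos x).le hAC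
  obtain ⟨S, hS, hScard⟩ := exists_finset_lists a hapos M hM.le
    (sum_netPoint_weights_le j₀ d M hM)
  have hex : ∀ l : V →L[ℝ] ℝ, ∃ L, ‖l‖ ≤ 1 → L ∈ S ∧ ∀ x,
      l (u x) - D (L.map fun i ↦ (2 * a i / ε i) • u i).sum (u x) ≤ ε x := by
    intro l
    by_cases hl : ‖l‖ ≤ 1
    · obtain ⟨L, h1, h2⟩ := exists_list_forall_sub_le hpq D hD hDs u a ε hapos hepos hw S hS l hl
      exact ⟨L, fun _ ↦ ⟨h1, h2⟩⟩
    · exact ⟨[], fun h ↦ (hl h).elim⟩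
  choose f hf using hex
  set g : (V →L[ℝ] ℝ) → Fin (2 ^ 2 ^ j₀ + 1) → ℤ := fun l r ↦
    ⌊l (K ((r : ℝ) / 2 ^ 2 ^ j₀)) * Q / R⌋ with hg
  refine ⟨List ι × (Fin (2 ^ 2 ^ j₀ + 1) → ℤ),
    S ×ˢ Fintype.piFinset fun _ ↦ Finset.Icc (-(Q : ℤ)) Q, fun l ↦ (f l, g l), ?_, ?_, ?_⟩
  · intro l hl
    rw [Finset.mem_product]
    refine ⟨(hf l hl).1, Fintype.mem_piFinset.2 fun r ↦ Finset.mem_Icc.2 ?_⟩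
    have h1 : |l (K ((r : ℝ) / 2 ^ 2 ^ j₀))| ≤ R :=
      (l.le_of_opNorm_le hl _).trans ((one_mul _).trans_le (hKR _ (hunit _ r)))
    obtain ⟨h2, h3⟩ := abs_le.1 h1
    have hQ' : (0 : ℝ) < Q := by exact_mod_cast hQ
    constructor
    · rw [Int.le_floor, le_div_iff₀ hR]
      push_cast
      nlinarith
    · refine Int.cast_le (R := ℝ).1 ((Int.floor_le _).trans ?_)
      rw [div_le_iff₀ hR]
      push_cast
      nlinarith
  · rw [Finset.card_product, Fintype.card_piFinset]
    simp only [Finset.prod_const, Finset.card_univ, Fintype.card_fin, Int.card_Icc]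
    have : (((Q : ℤ) + 1 - -(Q : ℤ)).toNat) = 2 * Q + 1 := by omega
    rw [this]
    push_cast
    gcongr
  · intro l l' hl hl' hll t ht
    obtain ⟨hfl, hgl⟩ := Prod.mk.inj hll
    have hlevel : ∀ i < d, |l (K (netPoint (j₀ + (i + 1)) t) - K (netPoint (j₀ + i) t)) -
        l' (K (netPoint (j₀ + (i + 1)) t) - K (netPoint (j₀ + i) t))| ≤ 2 * e i := by
      intro i hi
      obtain ⟨r, hr⟩ := exists_netPoint_eq (j := j₀ + i + 1) ht
      have hvr : K (netPoint (j₀ + (i + 1)) t) - K (netPoint (j₀ + i) t) = v ⟨i, hi⟩ r := by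
        simp only [hv]
        rw [← hr, netPoint_netPoint]
        rfl
      rw [hvr]
      have hone : ∀ m : V →L[ℝ] ℝ, ‖m‖ ≤ 1 →
          |m (v ⟨i, hi⟩ r) - D ((f m).map fun i ↦ (2 * a i / ε i) • u i).sum (v ⟨i, hi⟩ r)| ≤
            e i := by
        intro m hm
        have h1 := (hf m hm).2 ⟨⟨i, hi⟩, r, true⟩
        have h2 := (hf m hm).2 ⟨⟨i, hi⟩, r, false⟩
        simp only [hu, hε, if_true, Bool.false_eq_true, if_false, map_smul, smul_eq_mul, hDs]
          at h1 h2
        rw [abs_le]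
        constructor <;> linarith
      have h1 := abs_le.1 (hone l hl)
      have h2 := abs_le.1 (hone l' hl')
      rw [← hfl] at h2
      rw [abs_le]
      constructor <;> linarith [h1.1, h1.2, h2.1, h2.2]
    have hbase : |l (K (netPoint j₀ t)) - l' (K (netPoint j₀ t))| ≤ R / Q := by
      obtain ⟨r, hr⟩ := exists_netPoint_eq (j := j₀) ht
      rw [hr]
      have h1 := Int.abs_sub_lt_one_of_floor_eq_floor (congrFun hgl r)
      have hQ' : (0 : ℝ) < Q := by exact_mod_cast hQ
      rw [← sub_div, ← sub_mul, abs_div, abs_mul, abs_of_pos hR, abs_of_pos hQ',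
        div_lt_one hR] at h1
      rw [le_div_iff₀ hQ']
      exact h1.le
    have hind : ∀ i ≤ d, |l (K (netPoint (j₀ + i) t)) - l' (K (netPoint (j₀ + i) t))| ≤
        R / Q + ∑ i ∈ Finset.range i, 2 * e i := by
      intro i
      induction i with
      | zero => intro _; simpa using hbase
      | succ i ih =>
        intro hi
        have h1 := abs_le.1 (ih (by omega))
        have h2 := abs_le.1 (hlevel i (by omega))
        rw [map_sub, map_sub] at h2
        rw [Finset.sum_range_succ, abs_le]
        constructor <;> linarith [h1.1, h1.2, h2.1, h2.2]
    have hlast : ∀ m : V →L[ℝ] ℝ, ‖m‖ ≤ 1 →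
        |m (K t) - m (K (netPoint (j₀ + d) t))| ≤ ρ * ((2 : ℝ) ^ (j₀ + d)) ^ (-α) := by
      intro m hm
      rw [← map_sub]
      exact (m.le_of_opNorm_le hm _).trans ((one_mul _).trans_le
        (hK _ ht _ (netPoint_mem ht) _ (abs_sub_netPoint_le ht)))
    have h1 := abs_le.1 (hind d le_rfl)
    have h2 := abs_le.1 (hlast l hl)
    have h3 := abs_le.1 (hlast l' hl')
    rw [abs_le]
    constructor <;> linarith [h1.1, h1.2, h2.1, h2.2, h3.1, h3.2]

theorem abs_rpow_sub_rpow_le {r x y : ℝ} (hr : 0 ≤ r) (hr1 : r ≤ 1) (hx : 0 ≤ x) (hy : 0 ≤ y) :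
    |x ^ r - y ^ r| ≤ |x - y| ^ r := by
  wlog hxy : y ≤ x generalizing x y
  · rw [abs_sub_comm, abs_sub_comm x]
    exact this hy hx (le_of_not_ge hxy)
  have h := Real.rpow_add_le_add_rpow (sub_nonneg.2 hxy) hy hr hr1
  rw [sub_add_cancel] at h
  rw [abs_of_nonneg (sub_nonneg.2 (Real.rpow_le_rpow hy hxy hr)), abs_of_nonneg (sub_nonneg.2 hxy)]
  linarith

/-- The odd power function of exponent `q - 1 ∈ (0, 1]` is Hölder continuous. -/
theorem abs_oddPow_sub_oddPow_le {q : ℝ} (hq : 1 < q) (hq2 : q ≤ 2) (x y : ℝ) :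
    |(|x| ^ (q - 2) * x - |y| ^ (q - 2) * y)| ≤ 2 * |x - y| ^ (q - 1) := by
  have key : ∀ z : ℝ, 0 ≤ z → |z| ^ (q - 2) * z = z ^ (q - 1) := by
    intro z hz
    rw [abs_of_nonneg hz]
    rcases hz.eq_or_lt with rfl | hz
    · simp [Real.zero_rpow (sub_pos.2 hq).ne']
    · rw [← Real.rpow_add_one hz.ne']; ring_nf
  have hneg : ∀ z : ℝ, |(-z)| ^ (q - 2) * (-z) = -(|z| ^ (q - 2) * z) := by
    intro z; rw [abs_neg]; ring
  have hmain : ∀ x y : ℝ, 0 ≤ x →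
      |(|x| ^ (q - 2) * x - |y| ^ (q - 2) * y)| ≤ 2 * |x - y| ^ (q - 1) := by
    intro x y hx
    rcases le_total 0 y with hy | hy
    · rw [key x hx, key y hy]
      have := abs_rpow_sub_rpow_le (sub_pos.2 hq).le (by linarith) hx hy
      have h0 : 0 ≤ |x - y| ^ (q - 1) := by positivity
      linarith
    · obtain ⟨z, rfl⟩ : ∃ z, y = -z := ⟨-y, by simp⟩
      have hz : 0 ≤ z := by linarith
      rw [hneg, key x hx, key z hz, sub_neg_eq_add, sub_neg_eq_add, abs_of_nonneg (by positivity),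
        abs_of_nonneg (by positivity)]
      have h1 : x ^ (q - 1) ≤ (x + z) ^ (q - 1) :=
        Real.rpow_le_rpow hx (by linarith) (sub_pos.2 hq).le
      have h2 : z ^ (q - 1) ≤ (x + z) ^ (q - 1) :=
        Real.rpow_le_rpow hz (by linarith) (sub_pos.2 hq).le
      linarith
  rcases le_total 0 x with hx | hx
  · exact hmain x y hx
  · have := hmain (-x) (-y) (by linarith)
    rw [hneg, hneg] at this
    rw [← abs_neg, ← abs_neg (x - y)]
    convert this using 2 <;> ring_nf

theorem abs_add_rpow_div_le {q : ℝ} (hq : 1 < q) (hq2 : q ≤ 2) (a b : ℝ) :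
    |a + b| ^ q / q ≤ |a| ^ q / q + |a| ^ (q - 2) * a * b + 2 * |b| ^ q := by
  set y := a + b with hy
  have hpq := Real.HolderConjugate.conjExponent hq
  set p := q.conjExponent
  have hpow : ∀ z : ℝ, |z| * |z| ^ (q - 1) = |z| ^ q := by
    intro z
    rw [mul_comm]
    rcases (abs_nonneg z).eq_or_lt with h | h
    · rw [← h, Real.zero_rpow (by linarith : q ≠ 0)]; simp
    · rw [← Real.rpow_add_one h.ne']; ring_nf
  have habs : |(|y| ^ (q - 2) * y)| = |y| ^ (q - 1) := by
    rw [abs_mul, abs_of_nonneg (by positivity : 0 ≤ |y| ^ (q - 2))]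
    rcases (abs_nonneg y).eq_or_lt with h | h
    · rw [← h, Real.zero_rpow (sub_pos.2 hq).ne']; simp
    · rw [← Real.rpow_add_one h.ne']; ring_nf
  have h1 : |y| ^ (q - 2) * y * a ≤ |a| ^ q / q + |y| ^ q / p := by
    have h := Real.young_inequality_of_nonneg (abs_nonneg a)
      (by positivity : 0 ≤ |y| ^ (q - 1)) hpq
    rw [← Real.rpow_mul (abs_nonneg y), hpq.sub_one_mul_conj] at h
    refine le_trans ((le_abs_self _).trans_eq ?_) h
    rw [abs_mul, habs, mul_comm]
  have h2 : |y| ^ (q - 2) * y * y = |y| ^ q := by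
    rw [mul_assoc, ← abs_mul_abs_self y, ← mul_assoc, mul_comm]
    have : |y| ^ (q - 2) * |y| = |y| ^ (q - 1) := by
      rw [← habs, abs_mul, abs_of_nonneg (by positivity : 0 ≤ |y| ^ (q - 2))]
    rw [this, hpow]
  have h3 : (|y| ^ (q - 2) * y - |a| ^ (q - 2) * a) * b ≤ 2 * |b| ^ q := by
    refine (le_abs_self _).trans ?_
    rw [abs_mul]
    have h := abs_oddPow_sub_oddPow_le hq hq2 y a
    rw [show y - a = b by rw [hy]; ring] at h
    calc _ ≤ 2 * |b| ^ (q - 1) * |b| := by gcongr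
      _ = 2 * |b| ^ q := by rw [← hpow b]; ring
  have h4 : |y| ^ q / q + |y| ^ q / p = |y| ^ q := by
    rw [div_eq_mul_inv, div_eq_mul_inv, ← mul_add, hpq.inv_add_inv_eq_one, mul_one]
  have h5 : |y| ^ (q - 2) * y * y = |y| ^ (q - 2) * y * a + |y| ^ (q - 2) * y * b := by
    rw [← mul_add, ← hy]
  linarith

theorem Lp_norm_rpow_eq_integral {Ω : Type*} [MeasurableSpace Ω] {μ : Measure Ω} {q : ℝ}
    (hq : 0 < q) (f : Lp ℝ (ENNReal.ofReal q) μ) : ‖f‖ ^ q = ∫ x, |f x| ^ q ∂μ := by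
  have h0 : 0 ≤ ∫ x, |f x| ^ q ∂μ := integral_nonneg fun x ↦ by positivity
  rw [Lp.norm_def, (Lp.memLp f).eLpNorm_eq_integral_rpow_norm (by simpa using hq)
    ENNReal.ofReal_ne_top]
  simp only [ENNReal.toReal_ofReal hq.le, Real.norm_eq_abs]
  rw [ENNReal.toReal_ofReal (by positivity), ← Real.rpow_mul h0, inv_mul_cancel₀ hq.ne',
    Real.rpow_one]

theorem Lp_integrable_abs_rpow {Ω : Type*} [MeasurableSpace Ω] {μ : Measure Ω} {q : ℝ}
    (hq : 0 < q) (f : Lp ℝ (ENNReal.ofReal q) μ) : Integrable (fun x ↦ |f x| ^ q) μ := by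
  have := (Lp.memLp f).integrable_norm_rpow (by simpa using hq) ENNReal.ofReal_ne_top
  simpa [ENNReal.toReal_ofReal hq.le] using this

/-- The norm of `L_q`, `1 < q ≤ 2`, is smooth of power type `q`. -/
theorem exists_Lp_smooth {Ω : Type*} [MeasurableSpace Ω] (μ : Measure Ω) {q : ℝ}
    (hq : 1 < q) (hq2 : q ≤ 2) :
    ∃ D : Lp ℝ (ENNReal.ofReal q) μ → Lp ℝ (ENNReal.ofReal q) μ → ℝ,
      (∀ θ v, ‖θ + v‖ ^ q / q ≤ ‖θ‖ ^ q / q + D θ v + 2 * ‖v‖ ^ q) ∧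
      ∀ θ (c : ℝ) v, D θ (c • v) = c * D θ v := by
  have hq0 : 0 < q := by linarith
  have hpq := Real.HolderConjugate.conjExponent hq
  refine ⟨fun θ v ↦ ∫ x, |θ x| ^ (q - 2) * θ x * v x ∂μ, fun θ v ↦ ?_, fun θ c v ↦ ?_⟩
  · have hint : Integrable (fun x ↦ |θ x| ^ (q - 2) * θ x * v x) μ := by
      have hm : AEStronglyMeasurable (fun x ↦ |θ x| ^ (q - 2) * θ x * v x) μ := by
        have h1 := (Lp.aestronglyMeasurable θ).aemeasurable
        have h2 := (Lp.aestronglyMeasurable v).aemeasurable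
        exact ((((h1.abs).pow_const (q - 2)).mul h1).mul h2).aestronglyMeasurable
      refine (((Lp_integrable_abs_rpow hq0 θ).div_const q.conjExponent).add
        ((Lp_integrable_abs_rpow hq0 v).div_const q)).mono' hm (ae_of_all _ fun x ↦ ?_)
      have h := Real.young_inequality_of_nonneg (by positivity : 0 ≤ |θ x| ^ (q - 1))
        (abs_nonneg (v x)) hpq.symm
      rw [← Real.rpow_mul (abs_nonneg (θ x)), hpq.sub_one_mul_conj] at h
      refine le_trans (le_of_eq ?_) h
      rw [Real.norm_eq_abs, abs_mul, abs_mul, abs_of_nonneg (by positivity : 0 ≤ |θ x| ^ (q - 2))]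
      congr 1
      rcases (abs_nonneg (θ x)).eq_or_lt with h | h
      · rw [← h, Real.zero_rpow (sub_pos.2 hq).ne']; simp
      · rw [← Real.rpow_add_one h.ne']; ring_nf
    have hsum : Integrable (fun x ↦ |θ x| ^ q / q + |θ x| ^ (q - 2) * θ x * v x) μ :=
      ((Lp_integrable_abs_rpow hq0 θ).div_const q).add hint
    have hv := (Lp_integrable_abs_rpow hq0 v).const_mul 2
    rw [Lp_norm_rpow_eq_integral hq0, Lp_norm_rpow_eq_integral hq0, Lp_norm_rpow_eq_integral hq0,
      ← integral_div, ← integral_div, ← integral_const_mul,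
      ← integral_add ((Lp_integrable_abs_rpow hq0 θ).div_const q) hint, ← integral_add hsum hv]
    refine integral_mono_ae ((Lp_integrable_abs_rpow hq0 _).div_const q) (hsum.add hv) ?_
    filter_upwards [Lp.coeFn_add θ v] with x hx
    rw [hx]
    exact abs_add_rpow_div_le hq hq2 (θ x) (v x)
  · rw [← integral_const_mul]
    refine integral_congr_ae ?_
    filter_upwards [Lp.coeFn_smul c v] with x hx
    rw [hx, Pi.smul_apply, smul_eq_mul]
    ring

/-- The Volterra kernel generated by `k`. -/
noncomputable def volterraKernel (k : ℝ → ℝ) (t x : ℝ) : ℝ := if x < t then k (t - x) else 0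

theorem measurable_volterraKernel {k : ℝ → ℝ} (hk : Measurable k) (t : ℝ) :
    Measurable (volterraKernel k t) :=
  Measurable.ite measurableSet_Iio (hk.comp (measurable_const.sub measurable_id)) measurable_const

theorem memLp_volterraKernel {k : ℝ → ℝ} {q : ℝ} (hq : 0 < q) (hk : Measurable k)
    (hk0 : ∀ x ∈ Set.Ioc (0 : ℝ) 1, 0 ≤ k x)
    (hint : IntervalIntegrable (fun x ↦ k x ^ q) volume 0 1) {t : ℝ}
    (ht : t ∈ Set.Icc (0 : ℝ) 1) :
    MemLp (volterraKernel k t) (ENNReal.ofReal q) (volume.restrict (Set.Icc (0 : ℝ) 1)) := by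
  rw [← integrable_norm_rpow_iff (measurable_volterraKernel hk t).aestronglyMeasurable
    (by simpa using hq) ENNReal.ofReal_ne_top, ENNReal.toReal_ofReal hq.le]
  have h1 : IntervalIntegrable (fun x ↦ k x ^ q) volume 0 t :=
    hint.mono_set (by rw [Set.uIcc_of_le ht.1, Set.uIcc_of_le zero_le_one]; exact
      Set.Icc_subset_Icc_right ht.2)
  have h2 := (h1.comp_sub_left t).symm
  rw [sub_zero, sub_self, intervalIntegrable_iff_integrableOn_Ioo_of_le ht.1] at h2
  have h3 := h2.integrable_indicator measurableSet_Ioo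
  refine (h3.restrict (s := Set.Icc (0 : ℝ) 1)).congr ?_
  have h4 : ∀ᵐ x ∂(volume.restrict (Set.Icc (0 : ℝ) 1)), x ≠ 0 :=
    ae_restrict_of_ae (Measure.ae_ne volume 0)
  filter_upwards [ae_restrict_mem measurableSet_Icc, h4] with x hx hx0
  unfold volterraKernel
  have hx1 : 0 < x := lt_of_le_of_ne hx.1 hx0.symm
  by_cases hxt : x < t
  · rw [if_pos hxt, Set.indicator_of_mem (Set.mem_Ioo.2 ⟨hx1, hxt⟩), Real.norm_of_nonneg]
    exact hk0 _ ⟨by linarith, by linarith [ht.2]⟩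
  · rw [if_neg hxt, Set.indicator_of_notMem (fun h ↦ hxt h.2), norm_zero, Real.zero_rpow hq.ne']

theorem integral_volterraKernel_sub_le {k : ℝ → ℝ} {q : ℝ} (hq : 1 ≤ q) (hk : Measurable k)
    (hk0 : ∀ x ∈ Set.Ioc (0 : ℝ) 1, 0 ≤ k x) (hanti : AntitoneOn k (Set.Ioc 0 1))
    (hint : IntervalIntegrable (fun x ↦ k x ^ q) volume 0 1) {s t : ℝ}
    (hs : 0 ≤ s) (hst : s ≤ t) (ht : t ≤ 1) :
    ∫ x in (0 : ℝ)..1, |volterraKernel k t x - volterraKernel k s x| ^ q ≤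
      2 * ∫ x in (0 : ℝ)..(t - s), k x ^ q := by
  have hq0 : 0 < q := by linarith
  set F : ℝ → ℝ := fun x ↦ |volterraKernel k t x - volterraKernel k s x| ^ q with hF
  have hFi : IntervalIntegrable F volume 0 1 := by
    rw [intervalIntegrable_iff_integrableOn_Icc_of_le zero_le_one]
    have h := ((memLp_volterraKernel hq0 hk hk0 hint ⟨hs.trans hst, ht⟩).sub
      (memLp_volterraKernel hq0 hk hk0 hint ⟨hs, hst.trans ht⟩)).integrable_norm_rpow
      (by simpa using hq0) ENNReal.ofReal_ne_top
    simpa [ENNReal.toReal_ofReal hq0.le, IntegrableOn, hF] using h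
  have hsub : ∀ {f : ℝ → ℝ}, IntervalIntegrable f volume 0 1 → ∀ a b : ℝ, 0 ≤ a → a ≤ b → b ≤ 1 →
      IntervalIntegrable f volume a b := by
    intro f hf a b ha hab hb
    refine hf.mono_set ?_
    rw [Set.uIcc_of_le hab, Set.uIcc_of_le zero_le_one]
    exact Set.Icc_subset_Icc ha hb
  have hg0 : ∀ x ∈ Set.Ioc (0 : ℝ) 1, 0 ≤ k x ^ q := fun x hx ↦ Real.rpow_nonneg (hk0 x hx) q
  have e1 : ∫ x in (0 : ℝ)..1, F x = (∫ x in (0 : ℝ)..s, F x) + (∫ x in s..t, F x) +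
      ∫ x in t..1, F x := by
    rw [intervalIntegral.integral_add_adjacent_intervals (hsub hFi 0 s le_rfl hs (by linarith))
      (hsub hFi s t hs hst ht), intervalIntegral.integral_add_adjacent_intervals
      (hsub hFi 0 t le_rfl (by linarith) ht) (hsub hFi t 1 (by linarith) ht le_rfl)]
  have e2 : ∫ x in t..1, F x = 0 := by
    rw [intervalIntegral.integral_congr (g := fun _ ↦ 0)]
    · simp
    · intro x hx
      rw [Set.uIcc_of_le ht] at hx
      simp only [hF, volterraKernel]
      rw [if_neg (not_lt.2 hx.1), if_neg (not_lt.2 (hst.trans hx.1)), sub_zero, abs_zero,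
        Real.zero_rpow hq0.ne']
  have it : ∀ a b, 0 ≤ a → a ≤ b → b ≤ t →
      IntervalIntegrable (fun x ↦ k (t - x) ^ q) volume a b := by
    intro a b ha hab hb
    have := (hsub hint (t - b) (t - a) (by linarith) (by linarith) (by linarith)).comp_sub_left t
    simpa using this.symm
  have is : IntervalIntegrable (fun x ↦ k (s - x) ^ q) volume 0 s := by
    have := (hsub hint 0 s le_rfl hs (by linarith)).comp_sub_left s
    simpa using this.symm
  have e3 : ∫ x in s..t, F x ≤ ∫ x in (0 : ℝ)..(t - s), k x ^ q := by
    have : ∫ x in s..t, k (t - x) ^ q = ∫ x in (0 : ℝ)..(t - s), k x ^ q := by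
      rw [intervalIntegral.integral_comp_sub_left (fun x ↦ k x ^ q) t, sub_self]
    rw [← this]
    refine intervalIntegral.integral_mono_on_of_le_Ioo hst (hsub hFi s t hs hst ht)
      (it s t hs hst le_rfl) fun x hx ↦ ?_
    simp only [hF, volterraKernel]
    rw [if_pos hx.2, if_neg (not_lt.2 hx.1.le), sub_zero, abs_of_nonneg]
    exact hk0 _ ⟨by linarith [hx.2], by linarith [hx.1]⟩
  have e4 : ∫ x in (0 : ℝ)..s, F x ≤
      (∫ x in (0 : ℝ)..s, k x ^ q) - ∫ x in (t - s)..t, k x ^ q := by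
    have h1 : ∫ x in (0 : ℝ)..s, k (t - x) ^ q = ∫ x in (t - s)..t, k x ^ q := by
      rw [intervalIntegral.integral_comp_sub_left (fun x ↦ k x ^ q) t, sub_zero]
    have h2 : ∫ x in (0 : ℝ)..s, k (s - x) ^ q = ∫ x in (0 : ℝ)..s, k x ^ q := by
      rw [intervalIntegral.integral_comp_sub_left (fun x ↦ k x ^ q) s, sub_zero, sub_self]
    rw [← h1, ← h2, ← intervalIntegral.integral_sub is (it 0 s le_rfl hs hst)]
    refine intervalIntegral.integral_mono_on_of_le_Ioo hs (hsub hFi 0 s le_rfl hs (by linarith))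
      (is.sub (it 0 s le_rfl hs hst)) fun x hx ↦ ?_
    simp only [hF, volterraKernel]
    have hs' : s - x ∈ Set.Ioc (0 : ℝ) 1 := ⟨by linarith [hx.2], by linarith [hx.1]⟩
    have ht' : t - x ∈ Set.Ioc (0 : ℝ) 1 := ⟨by linarith [hx.2], by linarith [hx.1]⟩
    have hle : k (t - x) ≤ k (s - x) := hanti hs' ht' (by linarith)
    rw [if_pos (hx.2.trans_le hst), if_pos hx.2, abs_sub_comm, abs_of_nonneg (sub_nonneg.2 hle)]
    have := Real.add_rpow_le_rpow_add (sub_nonneg.2 hle) (hk0 _ ht') hq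
    rw [sub_add_cancel] at this
    linarith
  have e5 : ∫ x in (0 : ℝ)..s, k x ^ q ≤ ∫ x in (0 : ℝ)..t, k x ^ q := by
    rw [← intervalIntegral.integral_add_adjacent_intervals (hsub hint 0 s le_rfl hs (by linarith))
      (hsub hint s t hs hst ht)]
    have : 0 ≤ ∫ x in s..t, k x ^ q := by
      rw [intervalIntegral.integral_of_le hst]
      refine setIntegral_nonneg measurableSet_Ioc fun x hx ↦ hg0 x ⟨?_, ?_⟩
      · linarith [hx.1]
      · linarith [hx.2]
    linarith
  have e6 : ∫ x in (0 : ℝ)..t, k x ^ q =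
      (∫ x in (0 : ℝ)..(t - s), k x ^ q) + ∫ x in (t - s)..t, k x ^ q :=
    (intervalIntegral.integral_add_adjacent_intervals
      (hsub hint 0 (t - s) le_rfl (by linarith) (by linarith))
      (hsub hint (t - s) t (by linarith) (by linarith) ht)).symm
  linarith

/-- The logarithmically perturbed critical power `x ^ (-1/q) (c - log x) ^ (-β)`. -/
noncomputable def logKernel (q β c x : ℝ) : ℝ := x ^ (-(1 / q)) * (c - Real.log x) ^ (-β)

theorem measurable_logKernel (q β c : ℝ) : Measurable (logKernel q β c) := by
  unfold logKernel
  fun_prop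

theorem sub_log_pos {c x : ℝ} (hc : 0 < c) (hx : x ∈ Set.Ioc (0 : ℝ) 1) : 0 < c - Real.log x := by
  have := Real.log_nonpos hx.1.le hx.2
  linarith

theorem logKernel_nonneg {q β c x : ℝ} (hc : 0 < c) (hx : x ∈ Set.Ioc (0 : ℝ) 1) :
    0 ≤ logKernel q β c x :=
  mul_nonneg (Real.rpow_nonneg hx.1.le _) (Real.rpow_nonneg (sub_log_pos hc hx).le _)

theorem integral_logKernel_rpow {q β c : ℝ} (hq : 0 < q) (hβ : 1 < β * q) (hc : 0 < c) {h : ℝ}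
    (hh : h ∈ Set.Ioc (0 : ℝ) 1) :
    IntervalIntegrable (fun x ↦ logKernel q β c x ^ q) volume 0 h ∧
    ∫ x in (0 : ℝ)..h, logKernel q β c x ^ q = (c - Real.log h) ^ (1 - β * q) / (β * q - 1) := by
  set H : ℝ → ℝ := fun x ↦ if x ≤ 0 then 0 else (c - Real.log x) ^ (1 - β * q) / (β * q - 1) with hH
  have hmem : ∀ x ∈ Set.Ioo 0 h, x ∈ Set.Ioc (0 : ℝ) 1 := fun x hx ↦ ⟨hx.1, hx.2.le.trans hh.2⟩
  have hHpos : ∀ x, 0 < x → H x = (c - Real.log x) ^ (1 - β * q) / (β * q - 1) := fun x hx ↦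
    if_neg (not_le.2 hx)
  have hderiv : ∀ x ∈ Set.Ioo 0 h, HasDerivAt H (logKernel q β c x ^ q) x := by
    intro x hx
    have hpos := sub_log_pos hc (hmem x hx)
    have h1 : HasDerivAt (fun x ↦ (c - Real.log x) ^ (1 - β * q) / (β * q - 1))
        ((-x⁻¹) * (1 - β * q) * (c - Real.log x) ^ (1 - β * q - 1) / (β * q - 1)) x :=
      (((Real.hasDerivAt_log hx.1.ne').const_sub c).rpow_const (Or.inl hpos.ne')).div_const _
    have h2 : (-x⁻¹) * (1 - β * q) * (c - Real.log x) ^ (1 - β * q - 1) / (β * q - 1) =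
        logKernel q β c x ^ q := by
      unfold logKernel
      rw [Real.mul_rpow (Real.rpow_nonneg hx.1.le _) (Real.rpow_nonneg hpos.le _),
        ← Real.rpow_mul hx.1.le, ← Real.rpow_mul hpos.le, show -(1 / q) * q = -1 by field_simp,
        Real.rpow_neg_one, show 1 - β * q - 1 = -β * q by ring]
      have : β * q - 1 ≠ 0 := (sub_pos.2 hβ).ne'
      field_simp
      ring
    rw [h2] at h1
    refine h1.congr_of_eventuallyEq ?_
    filter_upwards [lt_mem_nhds hx.1] with y hy
    exact hHpos y hy
  have hcont : ContinuousOn H (Set.Icc 0 h) := by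
    intro x hx
    rcases hx.1.eq_or_lt with rfl | hx0
    · have h0 : Filter.Tendsto (fun x ↦ (c - Real.log x) ^ (1 - β * q) / (β * q - 1))
          (nhdsWithin 0 (Set.Ioi 0)) (nhds 0) := by
        have h1 : Filter.Tendsto (fun x ↦ c - Real.log x) (nhdsWithin 0 (Set.Ioi 0))
            Filter.atTop := by
          simpa [sub_eq_add_neg] using Filter.tendsto_atTop_add_const_left _ c
            (Filter.tendsto_neg_atBot_atTop.comp Real.tendsto_log_nhdsGT_zero)
        have h2 := (tendsto_rpow_neg_atTop (sub_pos.2 hβ)).comp h1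
        have h3 := h2.div_const (β * q - 1)
        simpa [Function.comp_def] using h3
      have h4 : ContinuousWithinAt H (Set.Ioi 0) 0 := by
        have : H 0 = 0 := if_pos le_rfl
        rw [ContinuousWithinAt, this]
        refine h0.congr' ?_
        filter_upwards [self_mem_nhdsWithin] with y hy
        exact (hHpos y hy).symm
      refine (continuousWithinAt_Ioi_iff_Ici.1 h4).mono Set.Icc_subset_Ici_self
    · refine ContinuousAt.continuousWithinAt ?_
      have hpos := sub_log_pos hc ⟨hx0, hx.2.trans hh.2⟩
      have h1 : ContinuousAt (fun x ↦ (c - Real.log x) ^ (1 - β * q) / (β * q - 1)) x :=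
        ((continuousAt_const.sub (Real.continuousAt_log hx0.ne')).rpow_const
          (Or.inl hpos.ne')).div_const _
      refine h1.congr ?_
      filter_upwards [lt_mem_nhds hx0] with y hy
      exact (hHpos y hy).symm
  have hint : IntervalIntegrable (fun x ↦ logKernel q β c x ^ q) volume 0 h := by
    rw [intervalIntegrable_iff_integrableOn_Ioc_of_le hh.1.le]
    exact intervalIntegral.integrableOn_deriv_of_nonneg hcont hderiv fun x hx ↦
      Real.rpow_nonneg (logKernel_nonneg hc (hmem x hx)) q
  refine ⟨hint, ?_⟩
  rw [intervalIntegral.integral_eq_sub_of_hasDerivAt_of_le hh.1.le hcont hderiv hint,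
    hHpos h hh.1, show H 0 = 0 from if_pos le_rfl, sub_zero]

theorem exists_volterra_curve {q β c : ℝ} (hq : 1 < q) (hβ : 1 / q < β) (hc : 0 < c)
    (hmono : StrictAntiOn (logKernel q β c) (Set.Ioc 0 1)) [Fact (1 ≤ ENNReal.ofReal q)] :
    ∃ (G : ℝ → Lp ℝ (ENNReal.ofReal q) (volume.restrict (Set.Icc (0 : ℝ) 1))) (ρ : ℝ), 0 < ρ ∧
      (∀ t ∈ Set.Icc (0 : ℝ) 1,
        G t =ᵐ[volume.restrict (Set.Icc (0 : ℝ) 1)] volterraKernel (logKernel q β c) t) ∧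
      ∀ s ∈ Set.Icc (0 : ℝ) 1, ∀ t ∈ Set.Icc (0 : ℝ) 1, ∀ h ∈ Set.Ioc (0 : ℝ) 1, |s - t| ≤ h →
        ‖G s - G t‖ ≤ ρ * (c - Real.log h) ^ (-(β - 1 / q)) := by
  classical
  have hq0 : 0 < q := by linarith
  have hβq : 1 < β * q := by rwa [div_lt_iff₀ hq0] at hβ
  set k := logKernel q β c with hk
  have hkm : Measurable k := measurable_logKernel q β c
  have hk0 : ∀ x ∈ Set.Ioc (0 : ℝ) 1, 0 ≤ k x := fun x hx ↦ logKernel_nonneg hc hx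
  have hint := (integral_logKernel_rpow (q := q) hq0 hβq hc (h := 1) (by simp)).1
  have hmem := fun t ht ↦ memLp_volterraKernel (t := t) hq0 hkm hk0 hint ht
  set G : ℝ → Lp ℝ (ENNReal.ofReal q) (volume.restrict (Set.Icc (0 : ℝ) 1)) := fun t ↦
    if ht : t ∈ Set.Icc (0 : ℝ) 1 then (hmem t ht).toLp else 0 with hG
  have hGae : ∀ t ∈ Set.Icc (0 : ℝ) 1,
      G t =ᵐ[volume.restrict (Set.Icc (0 : ℝ) 1)] volterraKernel k t := by
    intro t ht
    simp only [hG, dif_pos ht]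
    exact MemLp.coeFn_toLp _
  have hβq' : 0 < β * q - 1 := sub_pos.2 hβq
  refine ⟨G, (2 / (β * q - 1)) ^ (1 / q), by positivity, hGae, ?_⟩
  intro s hs t ht h hh hst
  wlog hle : s ≤ t generalizing s t
  · rw [norm_sub_rev]
    exact this t ht s hs (by rwa [abs_sub_comm]) (le_of_not_ge hle)
  rw [abs_sub_comm, abs_of_nonneg (sub_nonneg.2 hle)] at hst
  have hL := sub_log_pos hc hh
  rw [← Real.rpow_le_rpow_iff (norm_nonneg _) (by positivity) hq0]
  have e1 : ((2 / (β * q - 1)) ^ (1 / q) * (c - Real.log h) ^ (-(β - 1 / q))) ^ q =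
      2 * ((c - Real.log h) ^ (1 - β * q) / (β * q - 1)) := by
    rw [Real.mul_rpow (by positivity) (by positivity), ← Real.rpow_mul (by positivity),
      ← Real.rpow_mul hL.le, one_div_mul_cancel hq0.ne', Real.rpow_one,
      show -(β - 1 / q) * q = 1 - β * q by field_simp; ring]
    ring
  have hI := integral_logKernel_rpow hq0 hβq hc hh
  rw [e1, ← hI.2, Lp_norm_rpow_eq_integral hq0]
  have e2 : ∫ x in Set.Icc (0 : ℝ) 1, |(G s - G t) x| ^ q =
      ∫ x in (0 : ℝ)..1, |volterraKernel k t x - volterraKernel k s x| ^ q := by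
    rw [intervalIntegral.integral_of_le zero_le_one, ← integral_Icc_eq_integral_Ioc]
    refine integral_congr_ae ?_
    filter_upwards [Lp.coeFn_sub (G s) (G t), hGae s hs, hGae t ht] with x h1 h2 h3
    rw [h1, Pi.sub_apply, h2, h3, abs_sub_comm]
  rw [e2]
  refine (integral_volterraKernel_sub_le hq.le hkm hk0 hmono.antitoneOn hint hs.1 hle ht.2).trans ?_
  gcongr
  have h1 : IntervalIntegrable (fun x ↦ k x ^ q) volume 0 (t - s) := by
    refine hI.1.mono_set ?_
    rw [Set.uIcc_of_le (sub_nonneg.2 hle), Set.uIcc_of_le hh.1.le]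
    exact Set.Icc_subset_Icc_right hst
  have h2 : IntervalIntegrable (fun x ↦ k x ^ q) volume (t - s) h := by
    refine hI.1.mono_set ?_
    rw [Set.uIcc_of_le hst, Set.uIcc_of_le hh.1.le]
    exact Set.Icc_subset_Icc_left (sub_nonneg.2 hle)
  rw [← intervalIntegral.integral_add_adjacent_intervals h1 h2]
  have : 0 ≤ ∫ x in (t - s)..h, k x ^ q := by
    rw [intervalIntegral.integral_of_le hst]
    refine setIntegral_nonneg measurableSet_Ioc fun x hx ↦ Real.rpow_nonneg (hk0 x ⟨?_, ?_⟩) q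
    · linarith [hx.1]
    · linarith [hx.2, hh.2]
  linarith

theorem logKernel_zero {q β c : ℝ} (hq : 0 < q) : logKernel q β c 0 = 0 := by
  unfold logKernel
  rw [Real.zero_rpow (neg_ne_zero.2 (one_div_pos.2 hq).ne'), zero_mul]

theorem logKernel_abs_sub {q β c : ℝ} (hq : 0 < q) (t x : ℝ) :
    logKernel q β c |t - x| = volterraKernel (logKernel q β c) t x +
      volterraKernel (logKernel q β c) (1 - t) (1 - x) := by
  unfold volterraKernel
  rcases lt_trichotomy x t with h | rfl | h
  · rw [if_pos h, if_neg (by linarith), abs_of_pos (sub_pos.2 h), add_zero]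
  · simp [logKernel_zero hq]
  · rw [if_neg h.not_gt, if_pos (by linarith), abs_of_neg (sub_neg.2 h), zero_add]
    congr 1; ring

theorem measurePreserving_one_sub :
    MeasurePreserving (fun x : ℝ ↦ 1 - x) (volume.restrict (Set.Icc (0 : ℝ) 1))
      (volume.restrict (Set.Icc (0 : ℝ) 1)) := by
  have h := (Measure.measurePreserving_sub_left (volume : Measure ℝ) (1 : ℝ)).restrict_preimage
    (measurableSet_Icc (a := (0 : ℝ)) (b := 1))
  rwa [Set.preimage_const_sub_Icc, sub_self, sub_zero] at h

theorem exists_kernel_curve {q β c : ℝ} (hq : 1 < q) (hβ : 1 / q < β) (hc : 0 < c)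
    (hmono : StrictAntiOn (logKernel q β c) (Set.Ioc 0 1)) [Fact (1 ≤ ENNReal.ofReal q)]
    (K : ℝ → ℝ → ℝ) (hK : (K = fun t x ↦ logKernel q β c |t - x|) ∨
      K = volterraKernel (logKernel q β c)) :
    ∃ (G : ℝ → Lp ℝ (ENNReal.ofReal q) (volume.restrict (Set.Icc (0 : ℝ) 1))) (ρ : ℝ), 0 < ρ ∧
      (∀ t ∈ Set.Icc (0 : ℝ) 1, G t =ᵐ[volume.restrict (Set.Icc (0 : ℝ) 1)] K t) ∧
      ∀ s ∈ Set.Icc (0 : ℝ) 1, ∀ t ∈ Set.Icc (0 : ℝ) 1, ∀ h ∈ Set.Ioc (0 : ℝ) 1, |s - t| ≤ h →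
        ‖G s - G t‖ ≤ ρ * (c - Real.log h) ^ (-(β - 1 / q)) := by
  obtain ⟨G, ρ, hρ, hG, hd⟩ := exists_volterra_curve hq hβ hc hmono
  rcases hK with rfl | rfl
  · set r := Lp.compMeasurePreserving (E := ℝ) (p := ENNReal.ofReal q) (fun x : ℝ ↦ 1 - x)
      measurePreserving_one_sub with hr
    have hmem : ∀ t ∈ Set.Icc (0 : ℝ) 1, 1 - t ∈ Set.Icc (0 : ℝ) 1 := fun t ht ↦
      ⟨by linarith [ht.2], by linarith [ht.1]⟩
    refine ⟨fun t ↦ G t + r (G (1 - t)), 2 * ρ, by positivity, fun t ht ↦ ?_, ?_⟩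
    · have h1 := Lp.coeFn_compMeasurePreserving (G (1 - t)) measurePreserving_one_sub
      have h2 := measurePreserving_one_sub.quasiMeasurePreserving.ae (hG (1 - t) (hmem t ht))
      filter_upwards [Lp.coeFn_add (G t) (r (G (1 - t))), hG t ht, h1, h2] with x a1 a2 a3 a4
      rw [a1, Pi.add_apply, a2, hr, a3, Function.comp_apply, a4, logKernel_abs_sub (by linarith)]
    · intro s hs t ht h hh hst
      have e : G s + r (G (1 - s)) - (G t + r (G (1 - t))) =
          (G s - G t) + r (G (1 - s) - G (1 - t)) := by
        rw [map_sub]; abel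
      rw [e]
      refine (norm_add_le _ _).trans ?_
      rw [hr, Lp.norm_compMeasurePreserving]
      have h1 := hd s hs t ht h hh hst
      have h2 := hd (1 - s) (hmem s hs) (1 - t) (hmem t ht) h hh
        (by rw [abs_sub_comm]; convert hst using 2; ring)
      linarith
  · exact ⟨G, ρ, hρ, hG, hd⟩

theorem opDyadEntropyNum_le_of_coding {X Y β : Type*} [SeminormedAddCommGroup X]
    [SeminormedAddCommGroup Y] [NormedSpace ℝ X] [NormedSpace ℝ Y] (T : X →L[ℝ] Y) {n : ℕ} {ε : ℝ}
    (hε : 0 ≤ ε) (F : Finset β) (hF : F.card ≤ 2 ^ (n - 1)) (code : X → β)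
    (hcode : ∀ f, ‖f‖ ≤ 1 → code f ∈ F)
    (h : ∀ f g, ‖f‖ ≤ 1 → ‖g‖ ≤ 1 → code f = code g → ‖T f - T g‖ ≤ ε) :
    opDyadEntropyNum T n ≤ ε := by
  classical
  unfold opDyadEntropyNum opEntropyNum entropyNum
  refine csInf_le ⟨0, fun x hx ↦ hx.1⟩ ⟨hε, ?_⟩
  set rep : β → X := fun b ↦ if hb : ∃ f, ‖f‖ ≤ 1 ∧ code f = b then hb.choose else 0 with hrep
  refine ⟨F.image (fun b ↦ T (rep b)), Finset.card_image_le.trans hF, ?_⟩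
  rintro _ ⟨f, hf, rfl⟩
  rw [mem_closedBall_zero_iff] at hf
  have hb : ∃ g, ‖g‖ ≤ 1 ∧ code g = code f := ⟨f, hf, rfl⟩
  simp only [Set.mem_iUnion]
  refine ⟨T (rep (code f)), Finset.mem_image_of_mem _ (hcode f hf), ?_⟩
  rw [Metric.mem_closedBall, dist_eq_norm]
  have := hb.choose_spec
  refine h f _ hf ?_ ?_ <;> simp only [hrep, dif_pos hb]
  · exact this.1
  · exact this.2.symm

theorem exists_forall_le_of_eventually_le {e g : ℕ → ℝ} (hg : ∀ n, 1 ≤ n → 0 < g n) {C : ℝ}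
    (h : ∀ᶠ n in Filter.atTop, e n ≤ C * g n) : ∃ c > 0, ∀ n, 1 ≤ n → e n ≤ c * g n := by
  obtain ⟨N, hN⟩ := Filter.eventually_atTop.1 h
  have hs : 0 ≤ ∑ i ∈ Finset.range N, |e i / g i| := Finset.sum_nonneg fun i _ ↦ abs_nonneg _
  refine ⟨|C| + 1 + ∑ i ∈ Finset.range N, |e i / g i|, by positivity, fun n hn ↦ ?_⟩
  have hgn := hg n hn
  rcases le_or_gt N n with h1 | h1
  · refine (hN n h1).trans ?_
    gcongr
    linarith [le_abs_self C]
  · rw [← div_le_iff₀ hgn]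
    have := Finset.single_le_sum (f := fun i ↦ |e i / g i|) (fun i _ ↦ abs_nonneg _)
      (Finset.mem_range.2 h1)
    linarith [le_abs_self (e n / g n), abs_nonneg C]

section Pairing

variable {Ω : Type*} [MeasurableSpace Ω]

theorem abs_integral_mul_le_Lp {μ : Measure Ω} {p q : ℝ} (hqp : q.HolderConjugate p)
    (g : Lp ℝ (ENNReal.ofReal q) μ) (f : Lp ℝ (ENNReal.ofReal p) μ) :
    |∫ x, g x * f x ∂μ| ≤ ‖g‖ * ‖f‖ := by
  have hg : 0 ≤ ‖g‖ := ENNReal.toReal_nonneg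
  have hf : 0 ≤ ‖f‖ := ENNReal.toReal_nonneg
  have h := integral_mul_norm_le_Lp_mul_Lq hqp (Lp.memLp g) (Lp.memLp f)
  simp only [Real.norm_eq_abs] at h
  rw [← Lp_norm_rpow_eq_integral hqp.pos, ← Lp_norm_rpow_eq_integral hqp.symm.pos,
    ← Real.rpow_mul hg, ← Real.rpow_mul hf, mul_one_div_cancel hqp.ne_zero,
    mul_one_div_cancel hqp.symm.ne_zero, Real.rpow_one, Real.rpow_one] at h
  refine le_trans ?_ h
  simpa only [Real.norm_eq_abs, abs_mul] using
    norm_integral_le_integral_norm (μ := μ) (fun x ↦ g x * f x)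

theorem exists_Lp_pairing (μ : Measure Ω) {p q : ℝ} (hqp : q.HolderConjugate p)
    [Fact (1 ≤ ENNReal.ofReal q)] [Fact (1 ≤ ENNReal.ofReal p)] :
    ∃ B : Lp ℝ (ENNReal.ofReal p) μ →L[ℝ] Lp ℝ (ENNReal.ofReal q) μ →L[ℝ] ℝ,
      (∀ f g, B f g = ∫ x, g x * f x ∂μ) ∧ ∀ f, ‖B f‖ ≤ ‖f‖ := by
  have : ENNReal.HolderConjugate (ENNReal.ofReal q) (ENNReal.ofReal p) := hqp.ennrealOfReal
  have e : ∀ f g, ((ContinuousLinearMap.mul ℝ ℝ).lpPairing μ (ENNReal.ofReal q)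
      (ENNReal.ofReal p)).flip f g = ∫ x, g x * f x ∂μ := fun f g ↦ by
    rw [ContinuousLinearMap.flip_apply, ContinuousLinearMap.lpPairing_eq_integral]
    rfl
  refine ⟨_, e, fun f ↦ ?_⟩
  refine ContinuousLinearMap.opNorm_le_bound _ (norm_nonneg _) fun g ↦ ?_
  rw [e, Real.norm_eq_abs, mul_comm]
  exact abs_integral_mul_le_Lp hqp g f

end Pairing

theorem exists_operator_of_curve {V X : Type*} [NormedAddCommGroup V] [NormedSpace ℝ V]
    [NormedAddCommGroup X] [NormedSpace ℝ X] (B : X →L[ℝ] V →L[ℝ] ℝ) {G : ℝ → V}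
    (hG : ContinuousOn G (Set.Icc 0 1)) :
    ∃ T : X →L[ℝ] C(Set.Icc (0 : ℝ) 1, ℝ), ∀ f t, T f t = B f (G t) := by
  obtain ⟨R, hR⟩ := isCompact_Icc.exists_bound_of_continuousOn hG
  have hR0 : 0 ≤ R := (norm_nonneg _).trans (hR 0 (by simp))
  have hc : Continuous fun t : Set.Icc (0 : ℝ) 1 ↦ G t :=
    continuousOn_iff_continuous_domRestrict.1 hG
  refine ⟨LinearMap.mkContinuous
    { toFun := fun f ↦ ⟨fun t ↦ B f (G t), (B f).continuous.comp hc⟩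
      map_add' := fun f g ↦ by ext t; simp
      map_smul' := fun a f ↦ by ext t; simp } (‖B‖ * R) fun f ↦ ?_, fun f t ↦ rfl⟩
  rw [ContinuousMap.norm_le _ (by positivity)]
  intro t
  calc ‖B f (G t)‖ ≤ ‖B‖ * ‖f‖ * ‖G t‖ := B.le_opNorm₂ f (G t)
    _ ≤ ‖B‖ * ‖f‖ * R := by gcongr; exact hR t t.2
    _ = ‖B‖ * R * ‖f‖ := by ring

theorem two_pow_two_pow_sq_le {n : ℕ} (hn : 4 ≤ n) :
    (2 ^ 2 ^ (Nat.log 2 (Nat.log 2 n) - 1)) ^ 2 ≤ n := by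
  have hm : 2 ≤ Nat.log 2 n := by
    rw [Nat.le_log_iff_pow_le (by norm_num) (by omega)]; omega
  have h1 : 1 ≤ Nat.log 2 (Nat.log 2 n) := by
    rw [Nat.le_log_iff_pow_le (by norm_num) (by omega)]; omega
  have h2 : 2 ^ Nat.log 2 (Nat.log 2 n) ≤ Nat.log 2 n := Nat.pow_log_le_self 2 (by omega)
  have h3 : 2 ^ (Nat.log 2 (Nat.log 2 n) - 1) * 2 = 2 ^ Nat.log 2 (Nat.log 2 n) := by
    rw [← pow_succ]; congr 1; omega
  rw [← pow_mul, h3]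
  exact (Nat.pow_le_pow_right (by norm_num) h2).trans (Nat.pow_log_le_self 2 (by omega))

theorem eventually_coding_card_le {α : ℝ} (hα : 0 < α) :
    ∀ᶠ n : ℕ in Filter.atTop, (2 : ℝ) ^ ((n : ℝ) / 4 + 1) *
      (2 * (⌈(n : ℝ) ^ α⌉₊ : ℝ) + 1) ^ (2 ^ 2 ^ (Nat.log 2 (Nat.log 2 n) - 1) + 1) ≤
        (2 : ℝ) ^ (n - 1) := by
  have ht : Filter.Tendsto (fun n : ℕ ↦ (n : ℝ) ^ (1 / 4 : ℝ)) Filter.atTop Filter.atTop :=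
    (tendsto_rpow_atTop (by norm_num)).comp tendsto_natCast_atTop_atTop
  filter_upwards [ht.eventually_ge_atTop (2 * (6 + 16 * α)),
    Filter.eventually_ge_atTop 8] with n h1 h8
  have hn8 : (8 : ℝ) ≤ n := by exact_mod_cast h8
  have hn0 : (0 : ℝ) < n := by linarith
  set y : ℝ := (n : ℝ) ^ (1 / 4 : ℝ) with hy
  have hy4 : y ^ 4 = n := by
    rw [hy, ← Real.rpow_natCast, ← Real.rpow_mul hn0.le]; norm_num
  have hy0 : 0 < y := Real.rpow_pos_of_pos hn0 _
  have hy1 : 1 ≤ y := Real.one_le_rpow (by linarith) (by norm_num)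
  set N : ℕ := 2 ^ 2 ^ (Nat.log 2 (Nat.log 2 n) - 1) with hN
  have hN2 : (N : ℝ) ≤ y ^ 2 := by
    have : ((N ^ 2 : ℕ) : ℝ) ≤ n := by exact_mod_cast two_pow_two_pow_sq_le (by omega)
    push_cast at this
    rw [← hy4] at this
    exact le_of_sq_le_sq (by nlinarith) (by positivity)
  have hna : 1 ≤ (n : ℝ) ^ α := Real.one_le_rpow (by linarith) hα.le
  have hb : 2 * (⌈(n : ℝ) ^ α⌉₊ : ℝ) + 1 ≤ 5 * (n : ℝ) ^ α := by
    have := Nat.ceil_lt_add_one (zero_le_one.trans hna)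
    linarith
  have hlog : Real.logb 2 (5 * (n : ℝ) ^ α) ≤ (3 + 8 * α) * y := by
    have l2 := Real.log_two_gt_d9
    have l5 : Real.log 5 ≤ 3 * Real.log 2 := by
      rw [show 3 * Real.log 2 = Real.log (2 ^ 3) by rw [Real.log_pow]; norm_num]
      exact Real.log_le_log (by norm_num) (by norm_num)
    have ln : Real.log n ≤ 4 * y := by
      have := Real.log_le_rpow_div hn0.le (show (0 : ℝ) < 1 / 4 by norm_num)
      rw [← hy] at this
      linarith
    rw [Real.logb, div_le_iff₀ (by linarith), Real.log_mul (by norm_num) (by positivity),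
      Real.log_rpow hn0]
    have a1 : α * Real.log n ≤ α * (4 * y) := by gcongr
    have a2 : α * y * (1 / 2) ≤ α * y * Real.log 2 := by gcongr; linarith
    have a3 : 1 * Real.log 2 ≤ y * Real.log 2 := by gcongr
    nlinarith
  have h5 : (0 : ℝ) < 5 * (n : ℝ) ^ α := by positivity
  calc (2 : ℝ) ^ ((n : ℝ) / 4 + 1) * (2 * (⌈(n : ℝ) ^ α⌉₊ : ℝ) + 1) ^ (N + 1)
      ≤ (2 : ℝ) ^ ((n : ℝ) / 4 + 1) * (5 * (n : ℝ) ^ α) ^ (N + 1) := by gcongr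
    _ = (2 : ℝ) ^ ((n : ℝ) / 4 + 1) * (2 : ℝ) ^ (Real.logb 2 (5 * (n : ℝ) ^ α) * (N + 1)) := by
        rw [Real.rpow_mul (by norm_num), Real.rpow_logb (by norm_num) (by norm_num) h5,
          ← Real.rpow_natCast]
        push_cast; rfl
    _ = (2 : ℝ) ^ ((n : ℝ) / 4 + 1 + Real.logb 2 (5 * (n : ℝ) ^ α) * (N + 1)) := by
        exact (Real.rpow_add (by norm_num) _ _).symm
    _ ≤ (2 : ℝ) ^ ((n - 1 : ℕ) : ℝ) := by
        refine Real.rpow_le_rpow_of_exponent_le (by norm_num) ?_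
        rw [Nat.cast_sub (by omega), Nat.cast_one]
        have a1 : Real.logb 2 (5 * (n : ℝ) ^ α) * (N + 1) ≤ (3 + 8 * α) * y * (y ^ 2 + y ^ 2) := by
          gcongr
          nlinarith
        have a2 : (2 * (6 + 16 * α)) * y ^ 3 ≤ y * y ^ 3 := by gcongr
        nlinarith
    _ = (2 : ℝ) ^ (n - 1) := by rw [Real.rpow_natCast]

theorem eventually_opDyadEntropyNum_le {V X : Type*} [NormedAddCommGroup V] [NormedSpace ℝ V]
    [NormedAddCommGroup X] [NormedSpace ℝ X] {p q : ℝ} (hqp : q.HolderConjugate p)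
    (D : V → V → ℝ) (hD : ∀ θ v, ‖θ + v‖ ^ q / q ≤ ‖θ‖ ^ q / q + D θ v + 2 * ‖v‖ ^ q)
    (hDs : ∀ θ (c : ℝ) v, D θ (c • v) = c * D θ v)
    (K : ℝ → V) {R ρ α : ℝ} (hR : 0 < R) (hρ : 0 < ρ) (hα : 0 < α)
    (hKR : ∀ t ∈ Set.Icc (0 : ℝ) 1, ‖K t‖ ≤ R)
    (hK : ∀ s ∈ Set.Icc (0 : ℝ) 1, ∀ t ∈ Set.Icc (0 : ℝ) 1, ∀ j : ℕ,
      |s - t| ≤ 1 / 2 ^ 2 ^ j → ‖K s - K t‖ ≤ ρ * ((2 : ℝ) ^ j) ^ (-α))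
    (B : X → V →L[ℝ] ℝ) (hB : ∀ f, ‖f‖ ≤ 1 → ‖B f‖ ≤ 1)
    (T : X →L[ℝ] C(Set.Icc (0 : ℝ) 1, ℝ)) (hT : ∀ f t, T f t = B f (K t)) :
    ∃ C, 0 ≤ C ∧ ∀ᶠ n : ℕ in Filter.atTop, opDyadEntropyNum T n ≤
      C * ((n : ℝ) ^ (-α) + (n : ℝ) ^ (-(1 / p)) *
        ∑ i ∈ Finset.range (Nat.log 2 n - (Nat.log 2 (Nat.log 2 n) - 1)),
          ((2 : ℝ) ^ (Nat.log 2 (Nat.log 2 n) - 1 + i)) ^ (1 / p - α)) := by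
  refine ⟨R + 8 * ρ * 32 ^ (1 / p) + 2 * ρ * 2 ^ α, by positivity, ?_⟩
  filter_upwards [eventually_coding_card_le hα, Filter.eventually_ge_atTop 1] with n hcard hn1
  have hn : (0 : ℝ) < n := by exact_mod_cast hn1
  set m := Nat.log 2 n with hm
  set j₀ := Nat.log 2 m - 1 with hj
  set d := m - j₀ with hd
  set Q := ⌈(n : ℝ) ^ α⌉₊ with hQ
  have hjm : j₀ + d = m := by
    have := Nat.log_le_self 2 m
    omega
  have hna : 0 < (n : ℝ) ^ α := Real.rpow_pos_of_pos hn _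
  have hAC : (2 : ℝ) * (2 / 4) ^ q ≤ 1 := by
    have := Real.rpow_le_rpow_of_exponent_ge (x := 2 / 4) (by norm_num) (by norm_num)
      hqp.lt.le
    rw [Real.rpow_one] at this
    linarith
  obtain ⟨β, F, code, hF, hFc, hcode⟩ := exists_coding hqp D hD hDs (by norm_num)
    (by norm_num : (0 : ℝ) < 4) hAC K hR hρ hKR hK j₀ d Q (Nat.ceil_pos.2 hna)
    (by positivity : 0 < (n : ℝ) / 4)
  have hS : 0 ≤ ∑ i ∈ Finset.range d, ((2 : ℝ) ^ (j₀ + i)) ^ (1 / p - α) :=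
    Finset.sum_nonneg fun i _ ↦ by positivity
  set S := ∑ i ∈ Finset.range d, ((2 : ℝ) ^ (j₀ + i)) ^ (1 / p - α) with hSdef
  have hX : 0 ≤ (n : ℝ) ^ (-(1 / p)) * S := by positivity
  have hY : 0 ≤ (n : ℝ) ^ (-α) := by positivity
  refine opDyadEntropyNum_le_of_coding T (by positivity) F ?_ (fun f ↦ code (B f))
    (fun f hf ↦ hF _ (hB f hf)) fun f g hf hg hfg ↦ ?_
  · have := hFc.trans hcard
    exact_mod_cast this
  · rw [ContinuousMap.norm_le _ (by positivity)]
    intro t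
    rw [ContinuousMap.sub_apply, hT, hT, Real.norm_eq_abs]
    refine (hcode _ _ (hB f hf) (hB g hg) hfg t t.2).trans ?_
    have e1 : R / Q ≤ R * (n : ℝ) ^ (-α) := by
      rw [Real.rpow_neg hn.le, ← div_eq_mul_inv]
      gcongr
      exact Nat.le_ceil _
    have e2 : ∑ i ∈ Finset.range d, 2 * (4 * (ρ * ((2 : ℝ) ^ (j₀ + i)) ^ (-α)) *
        (8 * 2 ^ (j₀ + i) / ((n : ℝ) / 4)) ^ (1 / p)) =
        8 * ρ * 32 ^ (1 / p) * ((n : ℝ) ^ (-(1 / p)) * S) := by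
      rw [hSdef, Finset.mul_sum, Finset.mul_sum]
      refine Finset.sum_congr rfl fun i _ ↦ ?_
      have hx : (0 : ℝ) < 2 ^ (j₀ + i) := by positivity
      rw [show 8 * 2 ^ (j₀ + i) / ((n : ℝ) / 4) = 32 * (2 ^ (j₀ + i) * (n : ℝ)⁻¹) by
          field_simp; norm_num,
        Real.mul_rpow (by norm_num) (by positivity), Real.mul_rpow hx.le (by positivity),
        Real.inv_rpow hn.le, ← Real.rpow_neg hn.le, sub_eq_neg_add, Real.rpow_add hx]
      ring
    have e3 : ((2 : ℝ) ^ (j₀ + d)) ^ (-α) ≤ 2 ^ α * (n : ℝ) ^ (-α) := by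
      rw [hjm]
      have h1 : (n : ℝ) ≤ 2 * 2 ^ m := by
        have := (Nat.lt_pow_succ_log_self (b := 2) (by norm_num) n).le
        rw [pow_succ, mul_comm] at this
        exact_mod_cast this
      have h2 : (n : ℝ) ^ α ≤ 2 ^ α * (2 ^ m) ^ α := by
        rw [← Real.mul_rpow (by norm_num) (by positivity)]
        gcongr
      rw [Real.rpow_neg (by positivity), Real.rpow_neg hn.le, ← div_eq_mul_inv,
        inv_eq_one_div, div_le_div_iff₀ (by positivity) hna]
      linarith
    rw [e2]
    have e4 : 2 * (ρ * ((2 : ℝ) ^ (j₀ + d)) ^ (-α)) ≤ 2 * ρ * 2 ^ α * (n : ℝ) ^ (-α) := by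
      calc _ ≤ 2 * (ρ * (2 ^ α * (n : ℝ) ^ (-α))) := by gcongr
        _ = _ := by ring
    have c1 : 0 ≤ 8 * ρ * 32 ^ (1 / p) * (n : ℝ) ^ (-α) := by positivity
    have c2 : 0 ≤ (R + 2 * ρ * 2 ^ α) * ((n : ℝ) ^ (-(1 / p)) * S) := by positivity
    nlinarith

theorem sum_dyadic_rpow_eq (j₀ d : ℕ) (γ : ℝ) :
    ∑ i ∈ Finset.range d, ((2 : ℝ) ^ (j₀ + i)) ^ γ =
      ((2 : ℝ) ^ j₀) ^ γ * ∑ i ∈ Finset.range d, ((2 : ℝ) ^ γ) ^ i := by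
  rw [Finset.mul_sum]
  refine Finset.sum_congr rfl fun i _ ↦ ?_
  rw [pow_add, Real.mul_rpow (by positivity) (by positivity), Real.rpow_pow_comm (by norm_num)]

theorem sum_dyadic_rpow_le_of_pos {γ : ℝ} (hγ : 0 < γ) (j₀ d : ℕ) :
    ∑ i ∈ Finset.range d, ((2 : ℝ) ^ (j₀ + i)) ^ γ ≤
      ((2 : ℝ) ^ γ - 1)⁻¹ * ((2 : ℝ) ^ (j₀ + d)) ^ γ := by
  have h1 : 0 < (2 : ℝ) ^ γ - 1 := sub_pos.2 (Real.one_lt_rpow (by norm_num) hγ)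
  rw [sum_dyadic_rpow_eq, geom_sum_eq (by linarith), pow_add,
    Real.mul_rpow (by positivity) (by positivity), ← Real.rpow_pow_comm (by norm_num) γ d,
    mul_left_comm, inv_mul_eq_div]
  gcongr
  linarith

theorem sum_dyadic_rpow_le_of_neg {γ : ℝ} (hγ : γ < 0) (j₀ d : ℕ) :
    ∑ i ∈ Finset.range d, ((2 : ℝ) ^ (j₀ + i)) ^ γ ≤
      (1 - (2 : ℝ) ^ γ)⁻¹ * ((2 : ℝ) ^ j₀) ^ γ := by
  have h1 : (2 : ℝ) ^ γ < 1 := Real.rpow_lt_one_of_one_lt_of_neg (by norm_num) hγ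
  rw [sum_dyadic_rpow_eq, mul_comm]
  gcongr
  have h0 : (0 : ℝ) ≤ 2 ^ γ := by positivity
  exact (summable_geometric_of_lt_one h0 h1).sum_le_tsum _ (fun _ _ ↦ by positivity) |>.trans_eq
    (tsum_geometric_of_lt_one h0 h1)

theorem natLog_le_logb {n : ℕ} (hn : 1 ≤ n) : (Nat.log 2 n : ℝ) ≤ Real.logb 2 ((n : ℝ) + 1) := by
  have hn' : (0 : ℝ) < n := by exact_mod_cast hn
  rw [Real.le_logb_iff_rpow_le (by norm_num) (by positivity), Real.rpow_natCast]
  have : ((2 ^ Nat.log 2 n : ℕ) : ℝ) ≤ n := by exact_mod_cast Nat.pow_log_le_self 2 (by omega)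
  push_cast at this
  linarith

theorem logb_le_two_pow {n : ℕ} (hn : 4 ≤ n) :
    Real.logb 2 ((n : ℝ) + 1) ≤ 8 * 2 ^ (Nat.log 2 (Nat.log 2 n) - 1) := by
  have hm : 2 ≤ Nat.log 2 n := by
    rw [Nat.le_log_iff_pow_le (by norm_num) (by omega)]; omega
  have h1 : 1 ≤ Nat.log 2 (Nat.log 2 n) := by
    rw [Nat.le_log_iff_pow_le (by norm_num) (by omega)]; omega
  have h2 := Nat.lt_pow_succ_log_self (b := 2) (by norm_num) n
  have h3 := Nat.lt_pow_succ_log_self (b := 2) (by norm_num) (Nat.log 2 n)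
  have h4 : 2 ^ (Nat.log 2 (Nat.log 2 n)).succ =
      4 * 2 ^ (Nat.log 2 (Nat.log 2 n) - 1) := by
    rw [show (Nat.log 2 (Nat.log 2 n)).succ = (Nat.log 2 (Nat.log 2 n) - 1) + 2 by omega, pow_add]
    ring
  have h5 : Real.logb 2 ((n : ℝ) + 1) ≤ (Nat.log 2 n + 1 : ℕ) := by
    rw [Real.logb_le_iff_le_rpow (by norm_num) (by positivity), Real.rpow_natCast]
    exact_mod_cast h2
  refine h5.trans ?_
  have : Nat.log 2 n + 1 ≤ 8 * 2 ^ (Nat.log 2 (Nat.log 2 n) - 1) := by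
    have : 0 < 2 ^ (Nat.log 2 (Nat.log 2 n) - 1) := by positivity
    omega
  exact_mod_cast this

theorem logb_add_one_le (n : ℕ) : Real.logb 2 ((n : ℝ) + 1) ≤ n := by
  rw [Real.logb_le_iff_le_rpow (by norm_num) (by positivity), Real.rpow_natCast]
  exact_mod_cast Nat.lt_two_pow_self

theorem exists_entropy_bound {e : ℕ → ℝ} {p q β C : ℝ} (hqp : q.HolderConjugate p) (hC : 0 ≤ C)
    (he : ∀ᶠ n : ℕ in Filter.atTop, e n ≤ C * ((n : ℝ) ^ (-(β - 1 / q)) + (n : ℝ) ^ (-(1 / p)) *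
      ∑ i ∈ Finset.range (Nat.log 2 n - (Nat.log 2 (Nat.log 2 n) - 1)),
        ((2 : ℝ) ^ (Nat.log 2 (Nat.log 2 n) - 1 + i)) ^ (1 / p - (β - 1 / q)))) :
    ∃ c > 0, ∀ n : ℕ, 1 ≤ n →
      (β < 1 → e n ≤ c * (n : ℝ) ^ (1 / q - β)) ∧
      (1 < β → e n ≤ c * (n : ℝ) ^ (-(1 / p)) * (Real.logb 2 ((n : ℝ) + 1)) ^ (1 - β)) ∧
      (β = 1 → e n ≤ c * (n : ℝ) ^ (-(1 / p)) * Real.logb 2 ((n : ℝ) + 1)) := by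
  have hγ : 1 / p - (β - 1 / q) = 1 - β := by
    have := hqp.inv_add_inv_eq_one
    rw [one_div, one_div]
    linarith
  rw [hγ] at he
  have hα : -(β - 1 / q) = -(1 / p) + (1 - β) := by linarith
  have hlog : ∀ n : ℕ, 1 ≤ n → 1 ≤ Real.logb 2 ((n : ℝ) + 1) := fun n hn ↦ by
    have : (1 : ℝ) ≤ n := by exact_mod_cast hn
    rw [Real.le_logb_iff_rpow_le (by norm_num) (by positivity), Real.rpow_one]
    linarith
  have hcast : ∀ {n : ℕ}, 1 ≤ n → (0 : ℝ) < n := fun hn ↦ by exact_mod_cast hn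
  have hsplit : ∀ {n : ℕ}, 1 ≤ n →
      (n : ℝ) ^ (-(β - 1 / q)) = (n : ℝ) ^ (-(1 / p)) * (n : ℝ) ^ (1 - β) := fun hn ↦ by
    rw [hα, Real.rpow_add (hcast hn)]
  rcases lt_trichotomy β 1 with h | h | h
  · have hγ0 : 0 < 1 - β := sub_pos.2 h
    have h1 : 0 < (2 : ℝ) ^ (1 - β) - 1 := sub_pos.2 (Real.one_lt_rpow (by norm_num) hγ0)
    have hex : ∃ c > 0, ∀ n : ℕ, 1 ≤ n → e n ≤ c * (n : ℝ) ^ (1 / q - β) := by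
      refine exists_forall_le_of_eventually_le
        (g := fun n ↦ (n : ℝ) ^ (1 / q - β)) (C := C * (1 + ((2 : ℝ) ^ (1 - β) - 1)⁻¹))
        (fun n hn ↦ Real.rpow_pos_of_pos (hcast hn) _) ?_
      filter_upwards [he, Filter.eventually_ge_atTop 1] with n hen hn
      refine hen.trans ?_
      rw [mul_assoc]
      gcongr
      have hS := sum_dyadic_rpow_le_of_pos hγ0 (Nat.log 2 (Nat.log 2 n) - 1)
        (Nat.log 2 n - (Nat.log 2 (Nat.log 2 n) - 1))
      have hle : Nat.log 2 (Nat.log 2 n) - 1 + (Nat.log 2 n - (Nat.log 2 (Nat.log 2 n) - 1)) =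
          Nat.log 2 n := by
        have := Nat.log_le_self 2 (Nat.log 2 n)
        omega
      have hmn : (2 : ℝ) ^ Nat.log 2 n ≤ n := by
        exact_mod_cast Nat.pow_log_le_self 2 (by omega)
      rw [hle] at hS
      have hS' := hS.trans (mul_le_mul_of_nonneg_left
        (Real.rpow_le_rpow (by positivity) hmn hγ0.le) (inv_nonneg.2 h1.le))
      rw [show 1 / q - β = -(β - 1 / q) by ring, one_add_mul]
      refine add_le_add le_rfl ?_
      calc _ ≤ (n : ℝ) ^ (-(1 / p)) * (((2 : ℝ) ^ (1 - β) - 1)⁻¹ * (n : ℝ) ^ (1 - β)) := by gcongr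
        _ = _ := by rw [hsplit hn]; ring
    obtain ⟨c, hc, H⟩ := hex
    exact ⟨c, hc, fun n hn ↦ ⟨fun _ ↦ H n hn, fun h' ↦ absurd h' h.not_gt,
      fun h' ↦ absurd h' h.ne⟩⟩
  · have hex : ∃ c > 0, ∀ n : ℕ, 1 ≤ n →
        e n ≤ c * ((n : ℝ) ^ (-(1 / p)) * Real.logb 2 ((n : ℝ) + 1)) := by
      refine exists_forall_le_of_eventually_le
        (g := fun n ↦ (n : ℝ) ^ (-(1 / p)) * Real.logb 2 ((n : ℝ) + 1)) (C := C * 2)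
        (fun n hn ↦ mul_pos (Real.rpow_pos_of_pos (hcast hn) _)
          (zero_lt_one.trans_le (hlog n hn))) ?_
      filter_upwards [he, Filter.eventually_ge_atTop 1] with n hen hn
      refine hen.trans ?_
      rw [mul_assoc, hsplit hn, ← mul_add, mul_left_comm (2 : ℝ)]
      subst h
      simp only [sub_self, Real.rpow_zero, Finset.sum_const, Finset.card_range, nsmul_eq_mul,
        mul_one]
      gcongr
      have h2 : ((Nat.log 2 n - (Nat.log 2 (Nat.log 2 n) - 1) : ℕ) : ℝ) ≤ Nat.log 2 n := by
        exact_mod_cast Nat.sub_le _ _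
      linarith [natLog_le_logb hn, hlog n hn]
    obtain ⟨c, hc, H⟩ := hex
    exact ⟨c, hc, fun n hn ↦ ⟨fun h' ↦ absurd h h'.ne, fun h' ↦ absurd h h'.ne',
      fun _ ↦ (H n hn).trans_eq (mul_assoc _ _ _).symm⟩⟩
  · have hγ0 : 1 - β < 0 := sub_neg.2 h
    have h1 : 0 < 1 - (2 : ℝ) ^ (1 - β) :=
      sub_pos.2 (Real.rpow_lt_one_of_one_lt_of_neg (by norm_num) hγ0)
    have hex : ∃ c > 0, ∀ n : ℕ, 1 ≤ n →
        e n ≤ c * ((n : ℝ) ^ (-(1 / p)) * Real.logb 2 ((n : ℝ) + 1) ^ (1 - β)) := by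
      refine exists_forall_le_of_eventually_le
        (g := fun n ↦ (n : ℝ) ^ (-(1 / p)) * Real.logb 2 ((n : ℝ) + 1) ^ (1 - β))
        (C := C * (1 + (1 - (2 : ℝ) ^ (1 - β))⁻¹ * (1 / 8) ^ (1 - β)))
        (fun n hn ↦ mul_pos (Real.rpow_pos_of_pos (hcast hn) _)
          (Real.rpow_pos_of_pos (zero_lt_one.trans_le (hlog n hn)) _)) ?_
      filter_upwards [he, Filter.eventually_ge_atTop 4] with n hen hn4
      have hn : 1 ≤ n := by omega
      have hL := zero_lt_one.trans_le (hlog n hn)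
      refine hen.trans ?_
      rw [mul_assoc, hsplit hn, ← mul_add, mul_left_comm (1 + _)]
      have hS := sum_dyadic_rpow_le_of_neg hγ0 (Nat.log 2 (Nat.log 2 n) - 1)
        (Nat.log 2 n - (Nat.log 2 (Nat.log 2 n) - 1))
      have h2 : ((2 : ℝ) ^ (Nat.log 2 (Nat.log 2 n) - 1)) ^ (1 - β) ≤
          (1 / 8 * Real.logb 2 ((n : ℝ) + 1)) ^ (1 - β) :=
        Real.rpow_le_rpow_of_nonpos (by positivity) (by linarith [logb_le_two_pow hn4]) hγ0.le
      rw [Real.mul_rpow (by norm_num) hL.le] at h2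
      have h3 : (n : ℝ) ^ (1 - β) ≤ Real.logb 2 ((n : ℝ) + 1) ^ (1 - β) :=
        Real.rpow_le_rpow_of_nonpos hL (logb_add_one_le n) hγ0.le
      have h4 := hS.trans (mul_le_mul_of_nonneg_left h2 (inv_nonneg.2 h1.le))
      gcongr
      linarith
    obtain ⟨c, hc, H⟩ := hex
    exact ⟨c, hc, fun n hn ↦ ⟨fun h' ↦ absurd h' h.not_gt,
      fun _ ↦ (H n hn).trans_eq (mul_assoc _ _ _).symm, fun h' ↦ absurd h' h.ne'⟩⟩

/-- For `2 ≤ p < ∞` and `k(x) = x^{-1/p'} (c₀ − ln x)^{-β}` with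
`1/p' < β < ∞` and `c₀ > 0` such that `k` is strictly decreasing on `(0,1]`, the operator
`T_K` (with `K` the weakly singular or the Volterra kernel) maps `L_p[0,1]` boundedly into
`C[0,1]`, and `e_n(T_K) ≤ c n^{1/p'-β}` if `1/p' < β < 1`,
`e_n(T_K) ≤ c n^{-1/p} (log(n+1))^{1-β}` if `1 < β < ∞`, and
`e_n(T_K) ≤ c n^{-1/p} log(n+1)` if `β = 1`. -/
theorem stmt14 (p p' β c₀ : ℝ) (hp : 2 ≤ p) (hp' : 1 / p + 1 / p' = 1)
    (hβ : 1 / p' < β) (hc₀ : 0 < c₀)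
    (hmono : StrictAntiOn (fun x : ℝ => x ^ (-(1 / p')) * (c₀ - Real.log x) ^ (-β))
      (Set.Ioc 0 1)) :
    letI : Fact (1 ≤ ENNReal.ofReal p) := ⟨ENNReal.one_le_ofReal.mpr (by linarith)⟩
    ∀ K : ℝ → ℝ → ℝ,
      ((K = fun t x => |t - x| ^ (-(1 / p')) * (c₀ - Real.log |t - x|) ^ (-β)) ∨
       (K = fun t x => if x < t then (t - x) ^ (-(1 / p')) * (c₀ - Real.log (t - x)) ^ (-β)
            else 0)) →
      ∃ T : Lp ℝ (ENNReal.ofReal p) (volume.restrict (Set.Icc (0:ℝ) 1)) →L[ℝ]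
          C(Set.Icc (0:ℝ) 1, ℝ),
        (∀ (f : Lp ℝ (ENNReal.ofReal p) (volume.restrict (Set.Icc (0:ℝ) 1)))
            (t : Set.Icc (0:ℝ) 1),
          T f t = ∫ x in (0:ℝ)..1, K (t : ℝ) x * f x) ∧
        ∃ c > 0, ∀ n : ℕ, 1 ≤ n →
          (β < 1 → opDyadEntropyNum T n ≤ c * (n : ℝ) ^ (1 / p' - β)) ∧
          (1 < β → opDyadEntropyNum T n ≤
            c * (n : ℝ) ^ (-(1 / p)) * (Real.logb 2 ((n : ℝ) + 1)) ^ (1 - β)) ∧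
          (β = 1 → opDyadEntropyNum T n ≤
            c * (n : ℝ) ^ (-(1 / p)) * Real.logb 2 ((n : ℝ) + 1)) := by
  intro K hK
  have : Fact (1 ≤ ENNReal.ofReal p) := ⟨ENNReal.one_le_ofReal.mpr (by linarith)⟩
  have hpp : p.HolderConjugate p' := by
    rw [Real.holderConjugate_iff]
    exact ⟨by linarith, by simpa only [one_div] using hp'⟩
  have hqp := hpp.symm
  have hq2 : p' ≤ 2 := by
    have h1 : 1 / p ≤ 1 / 2 := one_div_le_one_div_of_le (by norm_num) hp
    exact (one_div_le_one_div (by norm_num) hqp.pos).1 (by linarith)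
  have : Fact (1 ≤ ENNReal.ofReal p') := ⟨ENNReal.one_le_ofReal.mpr hqp.lt.le⟩
  obtain ⟨G, ρ, hρ, hG, hd⟩ := exists_kernel_curve hqp.lt hβ hc₀ hmono K hK
  obtain ⟨D, hD, hDs⟩ := exists_Lp_smooth (volume.restrict (Set.Icc (0 : ℝ) 1)) hqp.lt hq2
  obtain ⟨B, hB, hBn⟩ := exists_Lp_pairing (volume.restrict (Set.Icc (0 : ℝ) 1)) hqp
  have hα : 0 < β - 1 / p' := sub_pos.2 hβ
  have hl2 : 0 < Real.log 2 := Real.log_pos (by norm_num)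
  have hmod : ∀ s ∈ Set.Icc (0 : ℝ) 1, ∀ t ∈ Set.Icc (0 : ℝ) 1, ∀ j : ℕ,
      |s - t| ≤ 1 / 2 ^ 2 ^ j →
        ‖G s - G t‖ ≤ ρ * Real.log 2 ^ (-(β - 1 / p')) * ((2 : ℝ) ^ j) ^ (-(β - 1 / p')) := by
    intro s hs t ht j hst
    have h1 : (1 : ℝ) ≤ 2 ^ 2 ^ j := one_le_pow₀ (by norm_num)
    refine (hd s hs t ht _ ⟨by positivity, (div_le_one (by positivity)).2 h1⟩ hst).trans ?_
    rw [mul_assoc, ← Real.mul_rpow hl2.le (by positivity)]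
    refine mul_le_mul_of_nonneg_left ?_ hρ.le
    have h2 : 0 < Real.log 2 * 2 ^ j := by positivity
    refine Real.rpow_le_rpow_of_nonpos h2 ?_ (neg_nonpos.2 hα.le)
    rw [one_div, Real.log_inv, Real.log_pow]
    push_cast
    linarith
  have hcont : ContinuousOn G (Set.Icc 0 1) := by
    rw [Metric.continuousOn_iff]
    intro t ht ε hε
    have hlim : Filter.Tendsto (fun j : ℕ ↦ ρ * Real.log 2 ^ (-(β - 1 / p')) *
        ((2 : ℝ) ^ j) ^ (-(β - 1 / p'))) Filter.atTop (nhds 0) := by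
      have := ((tendsto_rpow_neg_atTop hα).comp
        (tendsto_pow_atTop_atTop_of_one_lt (one_lt_two (α := ℝ)))).const_mul
          (ρ * Real.log 2 ^ (-(β - 1 / p')))
      rwa [mul_zero] at this
    obtain ⟨j, hj⟩ := (hlim.eventually_lt_const hε).exists
    refine ⟨1 / 2 ^ 2 ^ j, by positivity, fun s hs hst ↦ ?_⟩
    rw [dist_eq_norm]
    exact (hmod s hs t ht j hst.le).trans_lt hj
  obtain ⟨R, hR⟩ := isCompact_Icc.exists_bound_of_continuousOn hcont
  obtain ⟨T, hT⟩ := exists_operator_of_curve B hcont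
  refine ⟨T, fun f t ↦ ?_, ?_⟩
  · rw [hT, hB, intervalIntegral.integral_of_le zero_le_one, ← integral_Icc_eq_integral_Ioc]
    refine integral_congr_ae ?_
    filter_upwards [hG t t.2] with x hx
    rw [hx]
  · obtain ⟨C, hC, he⟩ := eventually_opDyadEntropyNum_le hqp D hD hDs G
      (R := max R 1) (by positivity) (by positivity) hα
      (fun t ht ↦ (hR t ht).trans (le_max_left _ _)) hmod (fun f ↦ B f)
      (fun f hf ↦ (hBn f).trans hf) T hT
    exact exists_entropy_bound hqp hC he
end

section
/- Let 1 < p < ∞, let k : (0,1] → ℝ be non-negative, continuous and strictly decreasing with lim_{x→0} k(x) = ∞ and k ∈ L_{p'}[0,1], and let T_K : L_p[0,1] → C[0,1] be the Volterra operator (T_K f)(t) = ∫_0^t k(t−x) f(x) dx. Then for all n ∈ ℕ: e_n(T_K : L_p[0,1] → C[0,1]) ≥ ε_{2^n − 1}(T_K : L_p[0,1] → C[0,1]) ≥ ∫_0^{1/n} k(x) dx. -/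
open MeasureTheory

theorem entropyNum_set_nonempty {X : Type*} [PseudoMetricSpace X] [Nonempty X] {A : Set X}
    (hA : Bornology.IsBounded A) {n : ℕ} (hn : 1 ≤ n) :
    {ε : ℝ | 0 ≤ ε ∧ ∃ T : Finset X, T.card ≤ n ∧
      A ⊆ ⋃ x ∈ T, Metric.closedBall x ε}.Nonempty := by
  obtain ⟨c⟩ := ‹Nonempty X›
  obtain ⟨r, hr⟩ := hA.subset_closedBall c
  refine ⟨max r 0, le_max_right _ _, {c}, by simpa using hn, ?_⟩
  simpa using hr.trans (Metric.closedBall_subset_closedBall (le_max_left r 0))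

theorem entropyNum_anti {X : Type*} [PseudoMetricSpace X] [Nonempty X] {A : Set X}
    (hA : Bornology.IsBounded A) {m n : ℕ} (hm : 1 ≤ m) (hmn : m ≤ n) :
    entropyNum A n ≤ entropyNum A m :=
  csInf_le_csInf ⟨0, fun _ h => h.1⟩ (entropyNum_set_nonempty hA hm)
    fun _ ⟨h0, T, hT, hAT⟩ => ⟨h0, T, hT.trans hmn, hAT⟩

/-- A bounded set containing more than `n` points at pairwise distance at least `2 * δ` has
`n`-th entropy number at least `δ`. -/
theorem le_entropyNum_of_separated {X ι : Type*} [PseudoMetricSpace X] [Nonempty X] {A : Set X}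
    (hA : Bornology.IsBounded A) {n : ℕ} (hn : 1 ≤ n) (s : Finset ι) (hs : n < s.card)
    (f : ι → X) (hf : ∀ i ∈ s, f i ∈ A) {δ : ℝ}
    (hδ : ∀ i ∈ s, ∀ j ∈ s, i ≠ j → 2 * δ ≤ dist (f i) (f j)) :
    δ ≤ entropyNum A n := by
  refine le_csInf (entropyNum_set_nonempty hA hn) ?_
  rintro ε ⟨-, T, hT, hAT⟩
  have hcover : ∀ i, ∃ x, i ∈ s → x ∈ T ∧ dist (f i) x ≤ ε := by
    intro i
    by_cases hi : i ∈ s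
    · obtain ⟨x, hx, hxi⟩ := Set.mem_iUnion₂.1 (hAT (hf i hi))
      exact ⟨x, fun _ => ⟨hx, hxi⟩⟩
    · exact ⟨f i, fun h => absurd h hi⟩
  choose c hc using hcover
  obtain ⟨i, hi, j, hj, hij, hcij⟩ := Finset.exists_ne_map_eq_of_card_lt_of_maps_to
    (hT.trans_lt hs) (f := c) fun i hi => (hc i hi).1
  have hdi := (hc i hi).2
  have hdj := (hc j hj).2
  rw [← hcij] at hdj
  linarith [hδ i hi j hj hij, dist_triangle_right (f i) (f j) (c i)]

/-- The step function equal to `1` on the cells `[i / n, (i + 1) / n)` with `i ∈ S`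
and to `-1` elsewhere. -/
noncomputable def signStep (n : ℕ) (S : Finset ℕ) (x : ℝ) : ℝ :=
  if ⌊(n : ℝ) * x⌋₊ ∈ S then 1 else -1

theorem measurable_signStep (n : ℕ) (S : Finset ℕ) : Measurable (signStep n S) := by
  have h : Measurable fun x : ℝ => ⌊(n : ℝ) * x⌋₊ :=
    Nat.measurable_floor.comp (measurable_const_mul _)
  exact Measurable.ite (h (MeasurableSet.of_discrete (s := (S : Set ℕ)))) measurable_const
    measurable_const

theorem norm_signStep (n : ℕ) (S : Finset ℕ) (x : ℝ) : ‖signStep n S x‖ = 1 := by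
  unfold signStep
  split_ifs <;> simp

theorem memLp_signStep (n : ℕ) (S : Finset ℕ) (q : ENNReal) (μ : Measure ℝ)
    [IsFiniteMeasure μ] : MemLp (signStep n S) q μ :=
  MemLp.of_bound (measurable_signStep n S).aestronglyMeasurable 1
    (Filter.Eventually.of_forall fun x => (norm_signStep n S x).le)

theorem norm_toLp_signStep_le (n : ℕ) (S : Finset ℕ) (q : ENNReal) (μ : Measure ℝ)
    [IsProbabilityMeasure μ] : ‖(memLp_signStep n S q μ).toLp‖ ≤ 1 := by
  rw [Lp.norm_toLp]
  have h : eLpNorm (signStep n S) q μ ≤ 1 := by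
    simpa using eLpNorm_le_of_ae_bound (p := q) (μ := μ) (f := signStep n S) (C := 1)
      (Filter.Eventually.of_forall fun x => (norm_signStep n S x).le)
  simpa using ENNReal.toReal_mono ENNReal.one_ne_top h

/-- If `i` is the first index at which `S` and `S'` differ, then `signStep n S - signStep n S'`
vanishes on `[0, i / n)` and is `±2` on `[i / n, (i + 1) / n)`. -/
theorem exists_signStep_sub_eq {n : ℕ} (hn : 1 ≤ n) {S S' : Finset ℕ} {i : ℕ}
    (hi : ¬(i ∈ S ↔ i ∈ S')) (hlt : ∀ j < i, (j ∈ S ↔ j ∈ S')) :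
    ∃ c : ℝ, |c| = 2 ∧ ∀ x ∈ Set.Ioo (0 : ℝ) ((i + 1) / n),
      signStep n S x - signStep n S' x = (Set.Ici ((i : ℝ) / n)).indicator (fun _ => c) x := by
  have hn0 : (0 : ℝ) < n := by exact_mod_cast hn
  refine ⟨(if i ∈ S then 1 else -1) - (if i ∈ S' then 1 else -1), ?_, ?_⟩
  · by_cases h : i ∈ S <;> by_cases h' : i ∈ S' <;> simp_all <;> norm_num
  · rintro x ⟨hx0, hx1⟩
    rw [lt_div_iff₀ hn0, mul_comm] at hx1
    have hnx : 0 ≤ (n : ℝ) * x := by positivity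
    by_cases hx : (i : ℝ) / n ≤ x
    · have hfl : ⌊(n : ℝ) * x⌋₊ = i := by
        rw [Nat.floor_eq_iff hnx]
        rw [div_le_iff₀ hn0, mul_comm] at hx
        exact ⟨hx, hx1⟩
      simp [signStep, hfl, hx]
    · have hfl : ⌊(n : ℝ) * x⌋₊ < i := by
        rw [Nat.floor_lt hnx]
        rw [not_le, lt_div_iff₀ hn0, mul_comm] at hx
        exact hx
      simp [signStep, hx, hlt _ hfl]

theorem integral_mul_indicator_Ici (k : ℝ → ℝ) {a t : ℝ} (c : ℝ) (ha : 0 ≤ a) (hat : a ≤ t) :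
    ∫ x in (0 : ℝ)..t, k (t - x) * (Set.Ici a).indicator (fun _ => c) x =
      c * ∫ x in (0 : ℝ)..(t - a), k x := by
  have hset : (Set.Ioo 0 t ∩ Set.Ici a : Set ℝ) =ᵐ[volume] (Set.Ioc a t : Set ℝ) := by
    have h0 : ∀ᵐ x : ℝ, x ≠ 0 := Measure.ae_ne volume 0
    have h1 : ∀ᵐ x : ℝ, x ≠ a := Measure.ae_ne volume a
    have h2 : ∀ᵐ x : ℝ, x ≠ t := Measure.ae_ne volume t
    filter_upwards [h0, h1, h2] with x hx0 hxa hxt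
    apply propext
    change (((0 < x ∧ x < t) ∧ a ≤ x) ↔ (a < x ∧ x ≤ t))
    grind
  have hmul : (fun x => k (t - x) * (Set.Ici a).indicator (fun _ => c) x) =
      (Set.Ici a).indicator fun x => c * k (t - x) := by
    ext x
    by_cases hx : x ∈ Set.Ici a <;> simp [hx, mul_comm]
  rw [intervalIntegral.integral_of_le (ha.trans hat), integral_Ioc_eq_integral_Ioo, hmul,
    setIntegral_indicator measurableSet_Ici, setIntegral_congr_set hset,
    ← intervalIntegral.integral_of_le hat, intervalIntegral.integral_const_mul,
    intervalIntegral.integral_comp_sub_left, sub_self]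

theorem abs_integral_mul_signStep_sub (k : ℝ → ℝ) {n : ℕ} (hn : 1 ≤ n) {S S' : Finset ℕ} {i : ℕ}
    (hi : ¬(i ∈ S ↔ i ∈ S')) (hlt : ∀ j < i, (j ∈ S ↔ j ∈ S')) :
    |∫ x in (0 : ℝ)..((i + 1) / n), k ((i + 1) / n - x) * (signStep n S x - signStep n S' x)| =
      2 * |∫ x in (0 : ℝ)..(1 / n), k x| := by
  obtain ⟨c, hc, h⟩ := exists_signStep_sub_eq hn hi hlt
  have hle : (i : ℝ) / n ≤ (i + 1) / n := by gcongr; linarith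
  have hcongr : ∫ x in (0 : ℝ)..((i + 1) / n),
        k ((i + 1) / n - x) * (signStep n S x - signStep n S' x) =
      ∫ x in (0 : ℝ)..((i + 1) / n),
        k ((i + 1) / n - x) * (Set.Ici ((i : ℝ) / n)).indicator (fun _ => c) x := by
    rw [intervalIntegral.integral_of_le (by positivity),
      intervalIntegral.integral_of_le (by positivity),
      integral_Ioc_eq_integral_Ioo, integral_Ioc_eq_integral_Ioo]
    exact setIntegral_congr_fun measurableSet_Ioo fun x hx => by simp only [h x hx]
  rw [hcongr, integral_mul_indicator_Ici k c (by positivity) hle, abs_mul, hc, ← sub_div,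
    add_sub_cancel_left]

/-- For `1 < p < ∞`, a kernel function `k` with `k ∈ L_{p'}[0,1]` and the
Volterra operator `T_K : L_p[0,1] → C[0,1]`, `(T_K f)(t) = ∫₀ᵗ k(t−x) f(x) dx`, one has
`e_n(T_K) ≥ ε_{2ⁿ−1}(T_K) ≥ ∫₀^{1/n} k(x) dx` for all `n ∈ ℕ`. -/
theorem stmt15 (p p' : ℝ) (hp : 1 < p) (hp' : 1 / p + 1 / p' = 1) (k : ℝ → ℝ)
    (hk0 : ∀ x ∈ Set.Ioc (0 : ℝ) 1, 0 ≤ k x)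
    (hkc : ContinuousOn k (Set.Ioc 0 1))
    (hkd : StrictAntiOn k (Set.Ioc 0 1))
    (hksing : Filter.Tendsto k (nhdsWithin 0 (Set.Ioi 0)) Filter.atTop)
    (hkq : MeasureTheory.IntegrableOn (fun x => k x ^ p') (Set.Ioc 0 1)) :
    letI : Fact (1 ≤ ENNReal.ofReal p) := ⟨ENNReal.one_le_ofReal.mpr hp.le⟩
    ∀ T : Lp ℝ (ENNReal.ofReal p) (volume.restrict (Set.Icc (0:ℝ) 1)) →L[ℝ]
        C(Set.Icc (0:ℝ) 1, ℝ),
      (∀ (f : Lp ℝ (ENNReal.ofReal p) (volume.restrict (Set.Icc (0:ℝ) 1)))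
          (t : Set.Icc (0:ℝ) 1),
        T f t = ∫ x in (0:ℝ)..(t : ℝ), k ((t : ℝ) - x) * f x) →
      ∀ n : ℕ, 1 ≤ n →
        opEntropyNum T (2 ^ n - 1) ≤ opDyadEntropyNum T n ∧
        (∫ x in (0:ℝ)..(1 / (n : ℝ)), k x) ≤ opEntropyNum T (2 ^ n - 1) := by
  intro T hT n hn
  have : Fact (1 ≤ ENNReal.ofReal p) := ⟨ENNReal.one_le_ofReal.mpr hp.le⟩
  have hbdd : Bornology.IsBounded (T '' Metric.closedBall 0 1) :=
    T.lipschitz.isBounded_image Metric.isBounded_closedBall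
  have hpow : 2 ^ n = 2 * 2 ^ (n - 1) := by rw [← pow_succ', Nat.sub_add_cancel hn]
  have hpos : 1 ≤ 2 ^ (n - 1) := Nat.one_le_two_pow
  refine ⟨entropyNum_anti hbdd hpos (by omega), ?_⟩
  have : IsProbabilityMeasure (volume.restrict (Set.Icc (0 : ℝ) 1)) := ⟨by simp⟩
  let f : Finset ℕ → Lp ℝ (ENNReal.ofReal p) (volume.restrict (Set.Icc (0 : ℝ) 1)) :=
    fun S => (memLp_signStep n S _ _).toLp
  have hf : ∀ S, f S ∈ Metric.closedBall 0 1 := fun S =>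
    mem_closedBall_zero_iff.2 (norm_toLp_signStep_le n S _ _)
  have hcard : 1 ≤ 2 ^ n - 1 := by omega
  refine le_entropyNum_of_separated hbdd hcard (Finset.range n).powerset
    (by rw [Finset.card_powerset, Finset.card_range]; omega) (fun S => T (f S))
    (fun S _ => Set.mem_image_of_mem T (hf S)) ?_
  intro S hS S' hS' hne
  have hex : ∃ i, ¬(i ∈ S ↔ i ∈ S') := by
    by_contra! h
    exact hne (Finset.ext h)
  classical
  obtain ⟨i, hi, hlt⟩ : ∃ i, ¬(i ∈ S ↔ i ∈ S') ∧ ∀ j < i, (j ∈ S ↔ j ∈ S') :=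
    ⟨Nat.find hex, Nat.find_spec hex, fun j hj => not_not.1 (Nat.find_min hex hj)⟩
  have hin : i + 1 ≤ n := by
    rw [Finset.mem_powerset] at hS hS'
    by_contra h
    have hni : i ∉ Finset.range n := by simp; omega
    exact hi (iff_of_false (fun h => hni (hS h)) fun h => hni (hS' h))
  have hn0 : (0 : ℝ) < n := by exact_mod_cast hn
  have ht0 : (0 : ℝ) ≤ (i + 1) / n := by positivity
  have ht1 : ((i : ℝ) + 1) / n ≤ 1 := by
    rw [div_le_one hn0]
    exact_mod_cast hin
  have hae : ∀ᵐ x ∂volume.restrict (Set.Icc (0 : ℝ) 1),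
      (f S - f S') x = signStep n S x - signStep n S' x := by
    filter_upwards [Lp.coeFn_sub (f S) (f S'), (memLp_signStep n S _ _).coeFn_toLp,
      (memLp_signStep n S' _ _).coeFn_toLp] with x h h1 h2
    rw [h, Pi.sub_apply, h1, h2]
  have heval : T (f S - f S') ⟨(i + 1) / n, ht0, ht1⟩ = ∫ x in (0 : ℝ)..((i + 1) / n),
      k ((i + 1) / n - x) * (signStep n S x - signStep n S' x) := by
    rw [hT, intervalIntegral.integral_of_le ht0, intervalIntegral.integral_of_le ht0]
    refine integral_congr_ae ?_
    have hsub : Set.Ioc (0 : ℝ) ((i + 1) / n) ⊆ Set.Icc 0 1 :=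
      fun x hx => ⟨hx.1.le, hx.2.trans ht1⟩
    filter_upwards [ae_restrict_of_ae_restrict_of_subset hsub hae] with x hx
    rw [hx]
  calc 2 * ∫ x in (0 : ℝ)..(1 / n), k x
      ≤ 2 * |∫ x in (0 : ℝ)..(1 / n), k x| := by gcongr; exact le_abs_self _
    _ = ‖T (f S - f S') ⟨(i + 1) / n, ht0, ht1⟩‖ := by
      rw [heval, Real.norm_eq_abs, abs_integral_mul_signStep_sub k hn hi hlt]
    _ ≤ ‖T (f S - f S')‖ := ContinuousMap.norm_coe_le_norm _ _
    _ = dist (T (f S)) (T (f S')) := by rw [map_sub, dist_eq_norm]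
end
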